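/- Let Ω ⋐ ℂ² be a bounded strongly pseudoconvex domain and ℋ(Ω) = 𝒪(Ω) ∩ C⁰(closure Ω). For a nonempty closed S ⊆ bΩ, let Ŝ = {z ∈ closure Ω : |f(z)| ≤ sup_S |f| for all f ∈ ℋ(Ω)}. If Ŝ ∖ S failed the local maximum property, there would exist a holomorphic polynomial Q on ℂ² such that Re Q restricted to Ŝ ∖ S has a strict local maximum at some point; then f = exp(Q) ∈ ℋ(Ω) and |f| = exp(Re Q) attains a local maximum on Ŝ at a point of Ŝ ∖ S, contradicting Rossi's local maximum modulus principle. Hence Ŝ ∖ S has the local maximum property. -/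

import Mathlib

open Complex

noncomputable section

def wdz1 (f : ℂ × ℂ → ℂ) (z : ℂ × ℂ) : ℂ :=
  (1 / 2) * (fderiv ℝ f z (1, 0) - Complex.I * fderiv ℝ f z (Complex.I, 0))

def wdzbar1 (f : ℂ × ℂ → ℂ) (z : ℂ × ℂ) : ℂ :=
  (1 / 2) * (fderiv ℝ f z (1, 0) + Complex.I * fderiv ℝ f z (Complex.I, 0))

def wdz2 (f : ℂ × ℂ → ℂ) (z : ℂ × ℂ) : ℂ :=
  (1 / 2) * (fderiv ℝ f z (0, 1) - Complex.I * fderiv ℝ f z (0, Complex.I))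

def wdzbar2 (f : ℂ × ℂ → ℂ) (z : ℂ × ℂ) : ℂ :=
  (1 / 2) * (fderiv ℝ f z (0, 1) + Complex.I * fderiv ℝ f z (0, Complex.I))

/-- The Levi (complex Hessian) form of a real-valued function `ρ` at `z` applied to `w`. -/
def leviForm (ρ : ℂ × ℂ → ℝ) (z : ℂ × ℂ) (w : ℂ × ℂ) : ℝ :=
  let ρC : ℂ × ℂ → ℂ := fun v => (ρ v : ℂ)
  ((wdzbar1 (wdz1 ρC) z) * w.1 * (starRingEnd ℂ) w.1
    + (wdzbar2 (wdz1 ρC) z) * w.1 * (starRingEnd ℂ) w.2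
    + (wdzbar1 (wdz2 ρC) z) * w.2 * (starRingEnd ℂ) w.1
    + (wdzbar2 (wdz2 ρC) z) * w.2 * (starRingEnd ℂ) w.2).re

/-- `Ω` is a strongly pseudoconvex domain: it has a C² strictly plurisubharmonic defining
function with nonvanishing differential on the boundary. -/
def IsStronglyPseudoconvex (Ω : Set (ℂ × ℂ)) : Prop :=
  ∃ (U : Set (ℂ × ℂ)) (ρ : ℂ × ℂ → ℝ), IsOpen U ∧ closure Ω ⊆ U ∧
    ContDiffOn ℝ 2 ρ U ∧ Ω = {z ∈ U | ρ z < 0} ∧ frontier Ω = {z ∈ U | ρ z = 0} ∧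
    (∀ z ∈ U, ∀ w : ℂ × ℂ, w ≠ 0 → 0 < leviForm ρ z w) ∧
    ∀ z ∈ frontier Ω, fderiv ℝ ρ z ≠ 0

/-- Evaluation of a polynomial in two variables at a point of ℂ². -/
def polyEval (P : MvPolynomial (Fin 2) ℂ) (z : ℂ × ℂ) : ℂ :=
  MvPolynomial.eval (fun i : Fin 2 => if i = 0 then z.1 else z.2) P

/-- The local maximum property (via Slodkowski's polynomial criterion): every point of `X`
has a neighborhood `U` such that for every compact `K ⊆ U` and every polynomial `P`, the
maximum of `|P|` over `K ∩ X` is attained on `X ∩ bK`. -/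
def HasLocalMaxProperty (X : Set (ℂ × ℂ)) : Prop :=
  ∀ x ∈ X, ∃ U ∈ nhds x, ∀ K : Set (ℂ × ℂ), IsCompact K → K ⊆ U →
    ∀ P : MvPolynomial (Fin 2) ℂ, ∀ z ∈ K ∩ X,
      ∃ w ∈ X ∩ frontier K, ‖polyEval P z‖ ≤ ‖polyEval P w‖

section
open Complex
open MeasureTheory ComplexConjugate

instance instHaarCC : (volume : Measure (ℂ × ℂ)).IsAddHaarMeasure :=
  inferInstanceAs ((volume : Measure ℂ).prod (volume : Measure ℂ)).IsAddHaarMeasure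

/-- Wirtinger derivative in the direction `e`. -/
def dz (e : ℂ × ℂ) (f : ℂ × ℂ → ℂ) (x : ℂ × ℂ) : ℂ :=
  (1 / 2) * (fderiv ℝ f x e - Complex.I * fderiv ℝ f x (Complex.I • e))

/-- Conjugate Wirtinger derivative in the direction `e`. -/
def db (e : ℂ × ℂ) (f : ℂ × ℂ → ℂ) (x : ℂ × ℂ) : ℂ :=
  (1 / 2) * (fderiv ℝ f x e + Complex.I * fderiv ℝ f x (Complex.I • e))

lemma wdz1_eq : wdz1 = dz (1, 0) := by
  funext f x; simp [wdz1, dz]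
lemma wdz2_eq : wdz2 = dz (0, 1) := by
  funext f x; simp [wdz2, dz]
lemma wdzbar1_eq : wdzbar1 = db (1, 0) := by
  funext f x; simp [wdzbar1, db]
lemma wdzbar2_eq : wdzbar2 = db (0, 1) := by
  funext f x; simp [wdzbar2, db]

lemma dz_mul {e x} {f g : ℂ × ℂ → ℂ} (hf : DifferentiableAt ℝ f x) (hg : DifferentiableAt ℝ g x) :
    dz e (fun y => f y * g y) x = dz e f x * g x + f x * dz e g x := by
  simp only [dz, fderiv_fun_mul hf hg]
  simp only [add_apply, smul_apply, smul_eq_mul]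
  ring

lemma db_mul {e x} {f g : ℂ × ℂ → ℂ} (hf : DifferentiableAt ℝ f x) (hg : DifferentiableAt ℝ g x) :
    db e (fun y => f y * g y) x = db e f x * g x + f x * db e g x := by
  simp only [db, fderiv_fun_mul hf hg]
  simp only [add_apply, smul_apply, smul_eq_mul]
  ring

lemma dz_add {e x} {f g : ℂ × ℂ → ℂ} (hf : DifferentiableAt ℝ f x) (hg : DifferentiableAt ℝ g x) :
    dz e (fun y => f y + g y) x = dz e f x + dz e g x := by
  simp only [dz, fderiv_fun_add hf hg, add_apply]
  ring

lemma db_add {e x} {f g : ℂ × ℂ → ℂ} (hf : DifferentiableAt ℝ f x) (hg : DifferentiableAt ℝ g x) :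
    db e (fun y => f y + g y) x = db e f x + db e g x := by
  simp only [db, fderiv_fun_add hf hg, add_apply]
  ring

lemma dz_sub {e x} {f g : ℂ × ℂ → ℂ} (hf : DifferentiableAt ℝ f x) (hg : DifferentiableAt ℝ g x) :
    dz e (fun y => f y - g y) x = dz e f x - dz e g x := by
  simp only [dz, fderiv_fun_sub hf hg, sub_apply]
  ring

lemma db_sub {e x} {f g : ℂ × ℂ → ℂ} (hf : DifferentiableAt ℝ f x) (hg : DifferentiableAt ℝ g x) :
    db e (fun y => f y - g y) x = db e f x - db e g x := by
  simp only [db, fderiv_fun_sub hf hg, sub_apply]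
  ring

lemma fderiv_conj {f : ℂ × ℂ → ℂ} {x v} (hf : DifferentiableAt ℝ f x) :
    fderiv ℝ (fun y => conj (f y)) x v = conj (fderiv ℝ f x v) := by
  have := (Complex.conjCLE.toContinuousLinearMap.hasFDerivAt (x := f x)).comp x hf.hasFDerivAt
  have h2 := this.fderiv
  have h3 : (fun y => conj (f y)) = (⇑Complex.conjCLE.toContinuousLinearMap ∘ f) := by
    funext y; simp
  rw [h3, h2]; simp

lemma dz_conj {e x} {f : ℂ × ℂ → ℂ} (hf : DifferentiableAt ℝ f x) :
    dz e (fun y => conj (f y)) x = conj (db e f x) := by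
  simp only [dz, db, fderiv_conj hf]
  simp only [map_mul, map_add, map_sub, map_div₀, map_one, Complex.conj_ofNat, Complex.conj_I]
  ring

lemma db_conj {e x} {f : ℂ × ℂ → ℂ} (hf : DifferentiableAt ℝ f x) :
    db e (fun y => conj (f y)) x = conj (dz e f x) := by
  simp only [dz, db, fderiv_conj hf]
  simp only [map_mul, map_add, map_sub, map_div₀, map_one, Complex.conj_ofNat, Complex.conj_I]
  ring

lemma conj_dz_ofReal {e x} {r : ℂ × ℂ → ℝ} (hf : DifferentiableAt ℝ r x) :
    conj (dz e (fun y => (r y : ℂ)) x) = db e (fun y => (r y : ℂ)) x := by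
  have h : DifferentiableAt ℝ (fun y => (r y : ℂ)) x :=
    Complex.ofRealCLM.differentiableAt.comp x hf
  rw [← db_conj h]
  simp

lemma dz_congr {e x} {f g : ℂ × ℂ → ℂ} (h : f =ᶠ[nhds x] g) : dz e f x = dz e g x := by
  simp [dz, h.fderiv_eq]
lemma db_congr {e x} {f g : ℂ × ℂ → ℂ} (h : f =ᶠ[nhds x] g) : db e f x = db e g x := by
  simp [db, h.fderiv_eq]

lemma contDiff_dz {e} {f : ℂ × ℂ → ℂ} (hf : ContDiff ℝ 2 f) : ContDiff ℝ 1 (dz e f) := by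
  have h : ContDiff ℝ 1 (fderiv ℝ f) := hf.fderiv_right (by norm_num)
  unfold dz
  exact contDiff_const.mul ((h.clm_apply contDiff_const).sub
    (contDiff_const.mul (h.clm_apply contDiff_const)))

lemma contDiff_db {e} {f : ℂ × ℂ → ℂ} (hf : ContDiff ℝ 2 f) : ContDiff ℝ 1 (db e f) := by
  have h : ContDiff ℝ 1 (fderiv ℝ f) := hf.fderiv_right (by norm_num)
  unfold db
  exact contDiff_const.mul ((h.clm_apply contDiff_const).add
    (contDiff_const.mul (h.clm_apply contDiff_const)))

lemma continuous_dz {e} {f : ℂ × ℂ → ℂ} (hf : ContDiff ℝ 1 f) : Continuous (dz e f) := by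
  have h : Continuous (fderiv ℝ f) := hf.continuous_fderiv (by norm_num)
  unfold dz
  fun_prop

lemma continuous_db {e} {f : ℂ × ℂ → ℂ} (hf : ContDiff ℝ 1 f) : Continuous (db e f) := by
  have h : Continuous (fderiv ℝ f) := hf.continuous_fderiv (by norm_num)
  unfold db
  fun_prop

lemma fderiv_fderiv_apply {f : ℂ × ℂ → ℂ} {x u v} (hf : ContDiffAt ℝ 2 f x) :
    fderiv ℝ (fun y => fderiv ℝ f y u) x v = fderiv ℝ (fderiv ℝ f) x v u := by
  have h : DifferentiableAt ℝ (fderiv ℝ f) x :=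
    (hf.fderiv_right (m := 1) (by norm_num)).differentiableAt (by norm_num)
  rw [fderiv_clm_apply h (differentiableAt_const u)]
  simp

lemma fderiv_dz {e} {f : ℂ × ℂ → ℂ} {x v} (hf : ContDiffAt ℝ 2 f x) :
    fderiv ℝ (dz e f) x v = (1 / 2) * (fderiv ℝ (fderiv ℝ f) x v e
      - Complex.I * fderiv ℝ (fderiv ℝ f) x v (Complex.I • e)) := by
  have h : DifferentiableAt ℝ (fderiv ℝ f) x :=
    (hf.fderiv_right (m := 1) (by norm_num)).differentiableAt (by norm_num)
  have h1 : ∀ u, DifferentiableAt ℝ (fun y => fderiv ℝ f y u) x := fun u =>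
    h.clm_apply (differentiableAt_const u)
  have : dz e f = fun y => (1 / 2 : ℂ) * ((fun y => fderiv ℝ f y e) y
      - Complex.I * (fun y => fderiv ℝ f y (Complex.I • e)) y) := by
    funext y; rfl
  rw [this, ((((h1 e).hasFDerivAt).fun_sub
    ((h1 (Complex.I • e)).hasFDerivAt.const_mul Complex.I)).const_mul (1 / 2 : ℂ)).fderiv]
  simp only [smul_apply, sub_apply, fderiv_fderiv_apply hf, smul_eq_mul]

lemma fderiv_db {e} {f : ℂ × ℂ → ℂ} {x v} (hf : ContDiffAt ℝ 2 f x) :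
    fderiv ℝ (db e f) x v = (1 / 2) * (fderiv ℝ (fderiv ℝ f) x v e
      + Complex.I * fderiv ℝ (fderiv ℝ f) x v (Complex.I • e)) := by
  have h : DifferentiableAt ℝ (fderiv ℝ f) x :=
    (hf.fderiv_right (m := 1) (by norm_num)).differentiableAt (by norm_num)
  have h1 : ∀ u, DifferentiableAt ℝ (fun y => fderiv ℝ f y u) x := fun u =>
    h.clm_apply (differentiableAt_const u)
  have : db e f = fun y => (1 / 2 : ℂ) * ((fun y => fderiv ℝ f y e) y
      + Complex.I * (fun y => fderiv ℝ f y (Complex.I • e)) y) := by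
    funext y; rfl
  rw [this, ((((h1 e).hasFDerivAt).fun_add
    ((h1 (Complex.I • e)).hasFDerivAt.const_mul Complex.I)).const_mul (1 / 2 : ℂ)).fderiv]
  simp only [smul_apply, add_apply, fderiv_fderiv_apply hf, smul_eq_mul]

lemma symm_snd {F : Type*} [NormedAddCommGroup F] [NormedSpace ℝ F] {f : ℂ × ℂ → F} {x u v}
    (hf : ContDiffAt ℝ 2 f x) :
    fderiv ℝ (fderiv ℝ f) x u v = fderiv ℝ (fderiv ℝ f) x v u :=
  (hf.isSymmSndFDerivAt (by simp)).eq u v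

lemma db_dz_comm {e e'} {f : ℂ × ℂ → ℂ} {x} (hf : ContDiffAt ℝ 2 f x) :
    db e' (dz e f) x = dz e (db e' f) x := by
  rw [db, dz, fderiv_dz hf, fderiv_dz hf, fderiv_db hf, fderiv_db hf,
    symm_snd (u := e') (v := e) hf, symm_snd (u := e') (v := Complex.I • e) hf,
    symm_snd (u := Complex.I • e') (v := e) hf,
    symm_snd (u := Complex.I • e') (v := Complex.I • e) hf]
  ring

lemma db_db_comm {e e'} {f : ℂ × ℂ → ℂ} {x} (hf : ContDiffAt ℝ 2 f x) :
    db e' (db e f) x = db e (db e' f) x := by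
  rw [db, db, fderiv_db hf, fderiv_db hf, fderiv_db hf, fderiv_db hf,
    symm_snd (u := e') (v := e) hf, symm_snd (u := e') (v := Complex.I • e) hf,
    symm_snd (u := Complex.I • e') (v := e) hf,
    symm_snd (u := Complex.I • e') (v := Complex.I • e) hf]
  ring

lemma integrable_fderiv {f : ℂ × ℂ → ℂ} (hf : ContDiff ℝ 1 f) (hc : HasCompactSupport f) (v) :
    Integrable (fun x => fderiv ℝ f x v) := by
  apply Continuous.integrable_of_hasCompactSupport
  · have h : Continuous (fderiv ℝ f) := hf.continuous_fderiv (by norm_num)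
    fun_prop
  · exact hc.fderiv_apply ℝ v

lemma integral_fderiv_zero {f : ℂ × ℂ → ℂ} (hf : ContDiff ℝ 1 f) (hc : HasCompactSupport f) (v) :
    ∫ x, fderiv ℝ f x v = 0 := by
  have := integral_mul_fderiv_eq_neg_fderiv_mul_of_integrable (μ := volume)
    (f := fun _ : ℂ × ℂ => (1 : ℂ)) (g := f) (v := v) (by simp)
    (by simpa using integrable_fderiv hf hc v)
    (by simpa using hf.continuous.integrable_of_hasCompactSupport hc)
    (fun x _ => differentiableAt_const _) (fun x _ => hf.differentiable (by norm_num) x)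
  simpa using this

lemma integral_dz_zero {e} {f : ℂ × ℂ → ℂ} (hf : ContDiff ℝ 1 f) (hc : HasCompactSupport f) :
    ∫ x, dz e f x = 0 := by
  unfold dz
  rw [integral_const_mul, integral_sub (integrable_fderiv hf hc _)
    ((integrable_fderiv hf hc _).const_mul _), integral_const_mul, integral_fderiv_zero hf hc,
    integral_fderiv_zero hf hc]
  simp

lemma integral_db_zero {e} {f : ℂ × ℂ → ℂ} (hf : ContDiff ℝ 1 f) (hc : HasCompactSupport f) :
    ∫ x, db e f x = 0 := by
  unfold db
  rw [integral_const_mul, integral_add (integrable_fderiv hf hc _)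
    ((integrable_fderiv hf hc _).const_mul _), integral_const_mul, integral_fderiv_zero hf hc,
    integral_fderiv_zero hf hc]
  simp

lemma dz_eq_zero_of_notMem {e} {f : ℂ × ℂ → ℂ} {x} (h : x ∉ tsupport f) : dz e f x = 0 := by
  have : f =ᶠ[nhds x] 0 := notMem_tsupport_iff_eventuallyEq.mp h
  rw [dz_congr this]; simp [dz]

lemma db_eq_zero_of_notMem {e} {f : ℂ × ℂ → ℂ} {x} (h : x ∉ tsupport f) : db e f x = 0 := by
  have : f =ᶠ[nhds x] 0 := notMem_tsupport_iff_eventuallyEq.mp h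
  rw [db_congr this]; simp [db]

lemma hcs_dz {e} {f : ℂ × ℂ → ℂ} (hc : HasCompactSupport f) : HasCompactSupport (dz e f) :=
  HasCompactSupport.intro hc (fun _ hx => dz_eq_zero_of_notMem hx)

lemma hcs_db {e} {f : ℂ × ℂ → ℂ} (hc : HasCompactSupport f) : HasCompactSupport (db e f) :=
  HasCompactSupport.intro hc (fun _ hx => db_eq_zero_of_notMem hx)

/-- integration by parts -/
lemma ibp_dz {e} {f g : ℂ × ℂ → ℂ} (hf : ContDiff ℝ 1 f) (hg : ContDiff ℝ 1 g)
    (hc : HasCompactSupport f) : ∫ x, f x * dz e g x = - ∫ x, dz e f x * g x := by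
  have h := integral_dz_zero (e := e) (hf.mul hg) (hc.mul_right)
  have h1 : ∀ x, dz e (fun y => f y * g y) x = dz e f x * g x + f x * dz e g x := fun x =>
    dz_mul (hf.differentiable (by norm_num) x) (hg.differentiable (by norm_num) x)
  have e1 : Integrable (fun x => dz e f x * g x) :=
    ((continuous_dz hf).mul hg.continuous).integrable_of_hasCompactSupport (hcs_dz hc).mul_right
  have e2 : Integrable (fun x => f x * dz e g x) :=
    (hf.continuous.mul (continuous_dz hg)).integrable_of_hasCompactSupport hc.mul_right
  simp only [h1] at h
  rw [integral_add e1 e2] at h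
  linear_combination h

lemma ibp_db {e} {f g : ℂ × ℂ → ℂ} (hf : ContDiff ℝ 1 f) (hg : ContDiff ℝ 1 g)
    (hc : HasCompactSupport f) : ∫ x, f x * db e g x = - ∫ x, db e f x * g x := by
  have h := integral_db_zero (e := e) (hf.mul hg) (hc.mul_right)
  have h1 : ∀ x, db e (fun y => f y * g y) x = db e f x * g x + f x * db e g x := fun x =>
    db_mul (hf.differentiable (by norm_num) x) (hg.differentiable (by norm_num) x)
  have e1 : Integrable (fun x => db e f x * g x) :=
    ((continuous_db hf).mul hg.continuous).integrable_of_hasCompactSupport (hcs_db hc).mul_right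
  have e2 : Integrable (fun x => f x * db e g x) :=
    (hf.continuous.mul (continuous_db hg)).integrable_of_hasCompactSupport hc.mul_right
  simp only [h1] at h
  rw [integral_add e1 e2] at h
  linear_combination h

end

section
open Complex
open MeasureTheory ComplexConjugate

lemma ii_add {E : Type*} [NormedAddCommGroup E] {f g : ℂ × ℂ → E} (hf : Integrable f)
    (hg : Integrable g) : Integrable (fun x => f x + g x) := hf.add hg

lemma ii_sub {E : Type*} [NormedAddCommGroup E] {f g : ℂ × ℂ → E} (hf : Integrable f)
    (hg : Integrable g) : Integrable (fun x => f x - g x) := hf.sub hg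

/-- weighted adjoint derivative -/
def dl (φ : ℂ × ℂ → ℝ) (e : ℂ × ℂ) (p : ℂ × ℂ → ℂ) (x : ℂ × ℂ) : ℂ :=
  dz e p x - dz e (fun y => (φ y : ℂ)) x * p x

/-- complex weight -/
def wt (φ : ℂ × ℂ → ℝ) (x : ℂ × ℂ) : ℂ := Complex.exp (-(φ x : ℂ))

lemma contDiff_ofReal {φ : ℂ × ℂ → ℝ} {n} (hφ : ContDiff ℝ n φ) :
    ContDiff ℝ n (fun y => (φ y : ℂ)) := Complex.ofRealCLM.contDiff.comp hφ

lemma contDiff_wt {φ : ℂ × ℂ → ℝ} {n} (hφ : ContDiff ℝ n φ) : ContDiff ℝ n (wt φ) :=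
  (contDiff_ofReal hφ).neg.cexp

lemma fderiv_wt {φ : ℂ × ℂ → ℝ} {x v} (hφ : DifferentiableAt ℝ φ x) :
    fderiv ℝ (wt φ) x v = - wt φ x * fderiv ℝ (fun y => (φ y : ℂ)) x v := by
  have h : DifferentiableAt ℝ (fun y => (φ y : ℂ)) x :=
    Complex.ofRealCLM.differentiableAt.comp x hφ
  have := (h.hasFDerivAt.fun_neg.cexp).fderiv
  unfold wt
  rw [this]; simp

lemma dz_wt {φ : ℂ × ℂ → ℝ} {x e} (hφ : DifferentiableAt ℝ φ x) :
    dz e (wt φ) x = - wt φ x * dz e (fun y => (φ y : ℂ)) x := by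
  simp only [dz, fderiv_wt hφ]; ring

lemma db_wt {φ : ℂ × ℂ → ℝ} {x e} (hφ : DifferentiableAt ℝ φ x) :
    db e (wt φ) x = - wt φ x * db e (fun y => (φ y : ℂ)) x := by
  simp only [db, fderiv_wt hφ]; ring

lemma contDiff_conj {f : ℂ × ℂ → ℂ} {n} (hf : ContDiff ℝ n f) :
    ContDiff ℝ n (fun y => conj (f y)) := Complex.conjCLE.contDiff.comp hf

lemma mkh_term {φ : ℂ × ℂ → ℝ} {e e' : ℂ × ℂ} {p q : ℂ × ℂ → ℂ} (hφ : ContDiff ℝ 2 φ)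
    (hp : ContDiff ℝ 2 p) (hq : ContDiff ℝ 2 q) (hpc : HasCompactSupport p)
    (hqc : HasCompactSupport q) :
    ∫ x, wt φ x * (dl φ e p x * conj (dl φ e' q x)) =
    ∫ x, wt φ x * (db e' (dz e (fun y => (φ y : ℂ))) x * p x * conj (q x)
      + db e' p x * conj (db e q x)) := by
  have hφ' := contDiff_ofReal hφ
  have hw := contDiff_wt hφ
  have hdφ := contDiff_dz (e := e) hφ'
  have hdp := contDiff_dz (e := e) hp
  have hdbp := contDiff_db (e := e') hp
  have h12 : (1 : WithTop ℕ∞) ≤ 2 := by norm_num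
  have hq1 : ContDiff ℝ 1 q := hq.of_le h12
  have hp1 : ContDiff ℝ 1 p := hp.of_le h12
  have hdl : ContDiff ℝ 1 (dl φ e p) := hdp.sub (hdφ.mul hp1)
  have hcq := contDiff_conj hq1
  have hcqc : HasCompactSupport (fun y => conj (q y)) := hqc.comp_left (by simp)
  have D : ∀ {f : ℂ × ℂ → ℂ}, ContDiff ℝ 1 f → ∀ x, DifferentiableAt ℝ f x := fun hf x =>
    hf.differentiable (by norm_num) x
  have hφd : ∀ x, DifferentiableAt ℝ φ x := fun x => hφ.differentiable (by norm_num) x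
  have hF : ContDiff ℝ 1 (fun x => wt φ x * (dl φ e p x * conj (q x))) :=
    (hw.of_le h12).mul (hdl.mul hcq)
  have hG : ContDiff ℝ 1 (fun x => wt φ x * (db e' p x * conj (q x))) :=
    (hw.of_le h12).mul (hdbp.mul hcq)
  have hFc : HasCompactSupport (fun x => wt φ x * (dl φ e p x * conj (q x))) :=
    (hcqc.mul_left).mul_left
  have hGc : HasCompactSupport (fun x => wt φ x * (db e' p x * conj (q x))) :=
    (hcqc.mul_left).mul_left
  have iF := integral_db_zero (e := e') hF hFc
  have iG := integral_dz_zero (e := e) hG hGc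
  have key : ∀ x, wt φ x * (dl φ e p x * conj (dl φ e' q x)) =
     wt φ x * (db e' (dz e (fun y => (φ y : ℂ))) x * p x * conj (q x)
      + db e' p x * conj (db e q x)) +
      (db e' (fun x => wt φ x * (dl φ e p x * conj (q x))) x -
        dz e (fun x => wt φ x * (db e' p x * conj (q x))) x) := by
    intro x
    rw [db_mul (D (hw.of_le h12) x) (D (hdl.mul hcq) x), db_mul (D hdl x) (D hcq x),
      dz_mul (D (hw.of_le h12) x) (D (hdbp.mul hcq) x), dz_mul (D hdbp x) (D hcq x),
      db_wt (hφd x), dz_wt (hφd x), db_conj (D hq1 x), dz_conj (D hq1 x)]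
    have : db e' (dl φ e p) x = dz e (db e' p) x -
      (db e' (dz e (fun y => (φ y : ℂ))) x * p x + dz e (fun y => (φ y : ℂ)) x * db e' p x) := by
      rw [← db_dz_comm hp.contDiffAt, ← db_mul (D hdφ x) (D hp1 x),
        ← db_sub (D hdp x) (D (hdφ.mul hp1) x)]
      rfl
    rw [this]
    have c : conj (dl φ e' q x) = conj (dz e' q x) - db e' (fun y => (φ y : ℂ)) x * conj (q x) := by
      rw [dl, map_sub, map_mul, conj_dz_ofReal (hφd x)]
    rw [c]
    simp only [dl]
    ring
  have ci : ∀ {f : ℂ × ℂ → ℂ}, Continuous f → HasCompactSupport f → Integrable f :=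
    fun h h' => h.integrable_of_hasCompactSupport h'
  have i2 := ci (continuous_db (e := e') hF) (hcs_db hFc)
  have i3 := ci (continuous_dz (e := e) hG) (hcs_dz hGc)
  have i1 : Integrable (fun x => wt φ x * (db e' (dz e (fun y => (φ y : ℂ))) x * p x * conj (q x)
      + db e' p x * conj (db e q x))) := by
    apply ci
    · have := continuous_db (e := e') hdφ
      have := continuous_db (e := e) hq1
      have := continuous_db (e := e') hp1
      have := hw.continuous
      have := hp.continuous
      have := hq.continuous
      fun_prop
    · refine HasCompactSupport.mul_left (HasCompactSupport.add hcqc.mul_left ?_)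
      exact (hcs_db hpc).mul_right
  simp only [key]
  rw [integral_add i1 (ii_sub i2 i3), integral_sub i2 i3, iF, iG]
  simp

lemma norm_wt (φ : ℂ × ℂ → ℝ) (x) : wt φ x = (Real.exp (-φ x) : ℂ) := by
  simp [wt]

lemma continuous_leviForm {φ : ℂ × ℂ → ℝ} (hφ : ContDiff ℝ 2 φ) {p q : ℂ × ℂ → ℂ}
    (hp : Continuous p) (hq : Continuous q) :
    Continuous (fun x => leviForm φ x (p x, q x)) := by
  have hφ' := contDiff_ofReal hφ
  unfold leviForm
  simp only [wdz1_eq, wdz2_eq, wdzbar1_eq, wdzbar2_eq]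
  have h1 := continuous_db (e := (1,0)) (contDiff_dz (e := (1,0)) hφ')
  have h2 := continuous_db (e := (0,1)) (contDiff_dz (e := (1,0)) hφ')
  have h3 := continuous_db (e := (1,0)) (contDiff_dz (e := (0,1)) hφ')
  have h4 := continuous_db (e := (0,1)) (contDiff_dz (e := (0,1)) hφ')
  generalize db (1,0) (dz (1,0) _) = F1 at *
  generalize db (0,1) (dz (1,0) _) = F2 at *
  generalize db (1,0) (dz (0,1) _) = F3 at *
  generalize db (0,1) (dz (0,1) _) = F4 at *
  fun_prop

/-- Morrey–Kohn–Hörmander inequality. -/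
lemma mkh {φ : ℂ × ℂ → ℝ} {p q : ℂ × ℂ → ℂ} (hφ : ContDiff ℝ 2 φ)
    (hp : ContDiff ℝ 2 p) (hq : ContDiff ℝ 2 q) (hpc : HasCompactSupport p)
    (hqc : HasCompactSupport q) :
    ∫ x, leviForm φ x (p x, q x) * Real.exp (-φ x) ≤
      ∫ x, (‖dl φ (1,0) p x + dl φ (0,1) q x‖ ^ 2 +
        ‖db (1,0) q x - db (0,1) p x‖ ^ 2) * Real.exp (-φ x) := by
  have hφ' := contDiff_ofReal hφ
  have hw := (contDiff_wt hφ).continuous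
  have h12 : (1 : WithTop ℕ∞) ≤ 2 := by norm_num
  have hdl : ∀ e {p}, ContDiff ℝ 2 p → Continuous (dl φ e p) := fun e {p} hp =>
    (((contDiff_dz (e := e) hp).sub ((contDiff_dz hφ').mul (hp.of_le h12)))).continuous
  have hdlc : ∀ e {p}, HasCompactSupport p → HasCompactSupport (dl φ e p) := fun e {p} hp =>
    HasCompactSupport.sub (hcs_dz hp) hp.mul_left
  have hdb : ∀ e {p}, ContDiff ℝ 2 p → Continuous (db e p) := fun e {p} hp =>
    continuous_db (hp.of_le h12)
  have hL : ∀ e e', Continuous (db e' (dz e (fun y => (φ y : ℂ)))) := fun e e' =>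
    continuous_db (contDiff_dz hφ')
  have ci : ∀ {f : ℂ × ℂ → ℂ}, Continuous f → HasCompactSupport f → Integrable f :=
    fun h h' => h.integrable_of_hasCompactSupport h'
  have cir : ∀ {f : ℂ × ℂ → ℝ}, Continuous f → HasCompactSupport f → Integrable f :=
    fun h h' => h.integrable_of_hasCompactSupport h'
  have iA : ∀ e e' {p q}, ContDiff ℝ 2 p → ContDiff ℝ 2 q → HasCompactSupport p →
      Integrable (fun x => wt φ x * (dl φ e p x * conj (dl φ e' q x))) := by
    intro e e' p q hp hq hpc
    apply ci
    · have := hdl e hp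
      have := hdl e' hq
      fun_prop
    · exact ((hdlc e hpc).mul_right).mul_left
  have iB : ∀ e e' {p q}, ContDiff ℝ 2 p → ContDiff ℝ 2 q → HasCompactSupport p →
      Integrable (fun x => wt φ x * (db e' (dz e (fun y => (φ y : ℂ))) x * p x * conj (q x)
      + db e' p x * conj (db e q x))) := by
    intro e e' p q hp hq hpc
    apply ci
    · have := hL e e'
      have := hdb e' hp
      have := hdb e hq
      have := hp.continuous
      have := hq.continuous
      fun_prop
    · refine HasCompactSupport.mul_left (HasCompactSupport.add ?_ ?_)
      · exact (hpc.mul_left).mul_right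
      · exact (hcs_db hpc).mul_right
  have t11 := mkh_term (e := (1,0)) (e' := (1,0)) hφ hp hp hpc hpc
  have t12 := mkh_term (e := (1,0)) (e' := (0,1)) hφ hp hq hpc hqc
  have t21 := mkh_term (e := (0,1)) (e' := (1,0)) hφ hq hp hqc hpc
  have t22 := mkh_term (e := (0,1)) (e' := (0,1)) hφ hq hq hqc hqc
  -- complex identity
  have E : ∫ x, (wt φ x * (dl φ (1,0) p x * conj (dl φ (1,0) p x))
      + wt φ x * (dl φ (1,0) p x * conj (dl φ (0,1) q x))
      + wt φ x * (dl φ (0,1) q x * conj (dl φ (1,0) p x))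
      + wt φ x * (dl φ (0,1) q x * conj (dl φ (0,1) q x))) =
      ∫ x, (wt φ x * (db (1,0) (dz (1,0) (fun y => (φ y : ℂ))) x * p x * conj (p x)
      + db (1,0) p x * conj (db (1,0) p x)) +
      wt φ x * (db (0,1) (dz (1,0) (fun y => (φ y : ℂ))) x * p x * conj (q x)
      + db (0,1) p x * conj (db (1,0) q x)) +
      wt φ x * (db (1,0) (dz (0,1) (fun y => (φ y : ℂ))) x * q x * conj (p x)
      + db (1,0) q x * conj (db (0,1) p x)) +
      wt φ x * (db (0,1) (dz (0,1) (fun y => (φ y : ℂ))) x * q x * conj (q x)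
      + db (0,1) q x * conj (db (0,1) q x))) := by
    rw [integral_add (ii_add (ii_add (iA _ _ hp hp hpc) (iA _ _ hp hq hpc)) (iA _ _ hq hp hqc))
      (iA _ _ hq hq hqc), integral_add (ii_add (iA _ _ hp hp hpc) (iA _ _ hp hq hpc)) (iA _ _ hq hp hqc),
      integral_add (iA _ _ hp hp hpc) (iA _ _ hp hq hpc), t11, t12, t21, t22]
    rw [integral_add (ii_add (ii_add (iB _ _ hp hp hpc) (iB _ _ hp hq hpc)) (iB _ _ hq hp hqc))
      (iB _ _ hq hq hqc), integral_add (ii_add (iB _ _ hp hp hpc) (iB _ _ hp hq hpc)) (iB _ _ hq hp hqc),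
      integral_add (iB _ _ hp hp hpc) (iB _ _ hp hq hpc)]
  have Ere := congrArg Complex.re E
  have iL := ii_add (ii_add (ii_add (iA (1,0) (1,0) hp hp hpc) (iA (1,0) (0,1) hp hq hpc))
    (iA (0,1) (1,0) hq hp hqc)) (iA (0,1) (0,1) hq hq hqc)
  have iR := ii_add (ii_add (ii_add (iB (1,0) (1,0) hp hp hpc) (iB (1,0) (0,1) hp hq hpc))
    (iB (0,1) (1,0) hq hp hqc)) (iB (0,1) (0,1) hq hq hqc)
  have rL := integral_re iL
  have rR := integral_re iR
  simp only [Pi.add_apply, RCLike.re_to_complex] at rL rR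
  rw [← rL, ← rR] at Ere
  have F1 : ∀ x, ‖dl φ (1,0) p x + dl φ (0,1) q x‖ ^ 2 * Real.exp (-φ x) =
     ((wt φ x * (dl φ (1,0) p x * conj (dl φ (1,0) p x))
      + wt φ x * (dl φ (1,0) p x * conj (dl φ (0,1) q x))
      + wt φ x * (dl φ (0,1) q x * conj (dl φ (1,0) p x))
      + wt φ x * (dl φ (0,1) q x * conj (dl φ (0,1) q x)))).re := by
    intro x
    rw [norm_wt, ← Complex.normSq_eq_norm_sq, Complex.normSq_apply]
    simp only [Complex.add_re, Complex.add_im, Complex.mul_re, Complex.mul_im, Complex.ofReal_re,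
      Complex.ofReal_im, Complex.conj_re, Complex.conj_im]
    ring
  have F2 : ∀ x, (leviForm φ x (p x, q x) - ‖db (1,0) q x - db (0,1) p x‖ ^ 2 +
      (‖db (1,0) p x‖ ^ 2 + ‖db (0,1) p x‖ ^ 2 + ‖db (1,0) q x‖ ^ 2 + ‖db (0,1) q x‖ ^ 2))
        * Real.exp (-φ x) =
     (wt φ x * (db (1,0) (dz (1,0) (fun y => (φ y : ℂ))) x * p x * conj (p x)
      + db (1,0) p x * conj (db (1,0) p x)) +
      wt φ x * (db (0,1) (dz (1,0) (fun y => (φ y : ℂ))) x * p x * conj (q x)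
      + db (0,1) p x * conj (db (1,0) q x)) +
      wt φ x * (db (1,0) (dz (0,1) (fun y => (φ y : ℂ))) x * q x * conj (p x)
      + db (1,0) q x * conj (db (0,1) p x)) +
      wt φ x * (db (0,1) (dz (0,1) (fun y => (φ y : ℂ))) x * q x * conj (q x)
      + db (0,1) q x * conj (db (0,1) q x))).re := by
    intro x
    simp only [leviForm, wdz1_eq, wdz2_eq, wdzbar1_eq, wdzbar2_eq]
    rw [norm_wt]
    simp only [← Complex.normSq_eq_norm_sq, Complex.normSq_apply]
    simp only [Complex.add_re, Complex.add_im, Complex.sub_re, Complex.sub_im, Complex.mul_re,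
      Complex.mul_im, Complex.ofReal_re,
      Complex.ofReal_im, Complex.conj_re, Complex.conj_im]
    ring
  simp only [← F1, ← F2] at Ere
  have ce : Continuous (fun x => Real.exp (-φ x)) := by have := hφ.continuous; fun_prop
  have c1 := hdl (1,0) hp
  have c2 := hdl (0,1) hq
  have c3 := hdb (1,0) hp
  have c4 := hdb (0,1) hp
  have c5 := hdb (1,0) hq
  have c6 := hdb (0,1) hq
  have c7 := continuous_leviForm hφ hp.continuous hq.continuous
  have iS : Integrable (fun x => ‖db (1,0) q x - db (0,1) p x‖ ^ 2 * Real.exp (-φ x)) := by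
    apply cir (by fun_prop)
    refine HasCompactSupport.mul_right ?_
    exact ((hcs_db (e := (1,0)) hqc).sub (hcs_db (e := (0,1)) hpc)).comp_left (g := fun z => ‖z‖ ^ 2) (by simp)
  have iT : Integrable (fun x => ‖dl φ (1,0) p x + dl φ (0,1) q x‖ ^ 2 * Real.exp (-φ x)) := by
    apply cir (by fun_prop)
    refine HasCompactSupport.mul_right ?_
    exact ((hdlc (1,0) hpc).add (hdlc (0,1) hqc)).comp_left (g := fun z => ‖z‖ ^ 2) (by simp)
  have hLc : HasCompactSupport (fun x => leviForm φ x (p x, q x)) := by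
    refine HasCompactSupport.intro (K := tsupport p ∪ tsupport q) (hpc.union hqc) ?_
    intro x hx
    have h1 : p x = 0 := image_eq_zero_of_notMem_tsupport (fun h => hx (Or.inl h))
    have h2 : q x = 0 := image_eq_zero_of_notMem_tsupport (fun h => hx (Or.inr h))
    simp [leviForm, h1, h2]
  have iV : Integrable (fun x => leviForm φ x (p x, q x) * Real.exp (-φ x)) :=
    cir (by fun_prop) hLc.mul_right
  have iW : Integrable (fun x => (leviForm φ x (p x, q x) - ‖db (1,0) q x - db (0,1) p x‖ ^ 2 +
      (‖db (1,0) p x‖ ^ 2 + ‖db (0,1) p x‖ ^ 2 + ‖db (1,0) q x‖ ^ 2 + ‖db (0,1) q x‖ ^ 2))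
        * Real.exp (-φ x)) := by
    apply cir (by fun_prop)
    refine HasCompactSupport.intro (K := tsupport p ∪ tsupport q) (hpc.union hqc) ?_
    intro x hx
    have n1 : x ∉ tsupport p := fun h => hx (Or.inl h)
    have n2 : x ∉ tsupport q := fun h => hx (Or.inr h)
    have h1 : p x = 0 := image_eq_zero_of_notMem_tsupport n1
    have h2 : q x = 0 := image_eq_zero_of_notMem_tsupport n2
    simp [leviForm, h1, h2, db_eq_zero_of_notMem n1, db_eq_zero_of_notMem n2]
  have : ∫ x, (leviForm φ x (p x, q x) * Real.exp (-φ x)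
        - ‖db (1,0) q x - db (0,1) p x‖ ^ 2 * Real.exp (-φ x)) ≤
      ∫ x, ‖dl φ (1,0) p x + dl φ (0,1) q x‖ ^ 2 * Real.exp (-φ x) := by
    rw [Ere]
    apply integral_mono (ii_sub iV iS) iW
    intro x
    have := Real.exp_pos (-φ x)
    have : 0 ≤ (‖db (1,0) p x‖ ^ 2 + ‖db (0,1) p x‖ ^ 2 + ‖db (1,0) q x‖ ^ 2 + ‖db (0,1) q x‖ ^ 2) * Real.exp (-φ x) := by positivity
    beta_reduce
    rw [add_mul, sub_mul]
    linarith
  rw [integral_sub iV iS] at this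
  simp only [add_mul]
  rw [integral_add iT iS]
  linarith

end

section
open Complex
open MeasureTheory ComplexConjugate
open Filter Topology
open scoped ENNReal

/-- mollification -/
def mo (κ f : ℂ × ℂ → ℂ) (x : ℂ × ℂ) : ℂ := ∫ t, f t * κ (x - t)

lemma mo_eq_conv (κ f : ℂ × ℂ → ℂ) :
    mo κ f = convolution f κ (ContinuousLinearMap.mul ℝ ℂ) volume := by
  funext x; rfl

lemma mo_contDiff {κ f : ℂ × ℂ → ℂ} (hκ : ContDiff ℝ 2 κ) (hc : HasCompactSupport κ)
    (hf : LocallyIntegrable f) : ContDiff ℝ 2 (mo κ f) := by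
  rw [mo_eq_conv]
  exact hc.contDiff_convolution_right (n := 2) _ hf (by exact_mod_cast hκ)

lemma fderiv_mo {κ f : ℂ × ℂ → ℂ} (hκ : ContDiff ℝ 2 κ) (hc : HasCompactSupport κ)
    (hf : LocallyIntegrable f) (x v) :
    fderiv ℝ (mo κ f) x v = ∫ t, f t * fderiv ℝ κ (x - t) v := by
  have h := hc.hasFDerivAt_convolution_right (ContinuousLinearMap.mul ℝ ℂ) hf
    (hκ.of_le (by norm_num)) x
  rw [mo_eq_conv, h.fderiv, convolution_precompR_apply _ hf (hc.fderiv ℝ)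
    (hκ.continuous_fderiv (by norm_num))]
  rfl

lemma fderiv_refl {κ : ℂ × ℂ → ℂ} (hκ : ContDiff ℝ 2 κ) (x t v) :
    fderiv ℝ (fun y => κ (x - y)) t v = - fderiv ℝ κ (x - t) v := by
  have h1 : HasFDerivAt (fun y : ℂ × ℂ => x - y) (-(ContinuousLinearMap.id ℝ (ℂ × ℂ))) t := by
    simpa using (hasFDerivAt_id t).const_sub x
  have h2 := ((hκ.differentiable (by norm_num) (x - t)).hasFDerivAt).comp t h1
  have h3 : (fun y => κ (x - y)) = κ ∘ (fun y => x - y) := rfl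
  rw [h3, h2.fderiv]; simp

lemma integrable_mo {κ f : ℂ × ℂ → ℂ} (hκ : Continuous κ) (hc : HasCompactSupport κ)
    (hf : LocallyIntegrable f) (x) : Integrable (fun t => f t * κ (x - t)) :=
  hc.convolutionExists_right (ContinuousLinearMap.mul ℝ ℂ) hf hκ x

lemma db_mo {κ f : ℂ × ℂ → ℂ} (hκ : ContDiff ℝ 2 κ) (hc : HasCompactSupport κ)
    (hf : LocallyIntegrable f) (e x) :
    db e (mo κ f) x = - ∫ t, f t * db e (fun y => κ (x - y)) t := by
  have cf : ∀ v, Continuous (fun t => fderiv ℝ κ t v) := fun v => by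
    have := hκ.continuous_fderiv (by norm_num); fun_prop
  have i : ∀ v, Integrable (fun t => f t * fderiv ℝ κ (x - t) v) := fun v =>
    integrable_mo (cf v) (hc.fderiv_apply ℝ v) hf x
  unfold db
  simp only [fderiv_refl hκ, fderiv_mo hκ hc hf]
  rw [← integral_const_mul, ← integral_add (i _) ((i _).const_mul _), ← integral_const_mul,
    ← integral_neg]
  congr 1; funext t; ring

lemma dz_mo {κ f : ℂ × ℂ → ℂ} (hκ : ContDiff ℝ 2 κ) (hc : HasCompactSupport κ)
    (hf : LocallyIntegrable f) (e x) :
    dz e (mo κ f) x = - ∫ t, f t * dz e (fun y => κ (x - y)) t := by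
  have cf : ∀ v, Continuous (fun t => fderiv ℝ κ t v) := fun v => by
    have := hκ.continuous_fderiv (by norm_num); fun_prop
  have i : ∀ v, Integrable (fun t => f t * fderiv ℝ κ (x - t) v) := fun v =>
    integrable_mo (cf v) (hc.fderiv_apply ℝ v) hf x
  unfold dz
  simp only [fderiv_refl hκ, fderiv_mo hκ hc hf]
  rw [← integral_const_mul, ← integral_sub (i _) ((i _).const_mul _), ← integral_const_mul,
    ← integral_neg]
  congr 1; funext t; ring

lemma hcs_mo {κ f : ℂ × ℂ → ℂ} (hc : HasCompactSupport κ)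
    (hf : HasCompactSupport f) : HasCompactSupport (mo κ f) := by
  rw [mo_eq_conv]
  exact hf.convolution _ hc

/-- the standard mollifier bump -/
def bmp (δ : ℝ) (hδ : 0 < δ) : ContDiffBump (0 : ℂ × ℂ) :=
  ⟨δ / 2, δ, by linarith, by linarith⟩

/-- the standard mollifier -/
def kap (n : ℕ) (x : ℂ × ℂ) : ℝ := (bmp (1 / ((n : ℝ) + 1)) (by positivity)).normed volume x

lemma kap_nonneg (n x) : 0 ≤ kap n x := ContDiffBump.nonneg_normed _ _
lemma kap_contDiff (n) : ContDiff ℝ 2 (kap n) :=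
  (bmp (1 / ((n : ℝ) + 1)) (by positivity)).contDiff_normed (n := 2)
lemma kap_hcs (n) : HasCompactSupport (kap n) := ContDiffBump.hasCompactSupport_normed _
lemma kap_integral (n) : ∫ x, kap n x = 1 := ContDiffBump.integral_normed _
lemma kap_zero {n : ℕ} {x} (h : 1 / ((n : ℝ) + 1) ≤ ‖x‖) : kap n x = 0 := by
  have : x ∉ Function.support (kap n) := by
    have : Function.support (kap n) = Metric.ball 0 (1 / ((n : ℝ) + 1)) :=
      ContDiffBump.support_normed_eq _
    rw [this]; simpa using h
  simpa using this

instance fact_two : Fact ((2 : ℝ≥0∞) ≠ ∞) := ⟨by simp⟩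

lemma translate_L2 {f : ℂ × ℂ → ℂ} (hf : MemLp f 2) :
    Tendsto (fun t : ℂ × ℂ => eLpNorm (fun x => f (x - t) - f x) 2 volume) (𝓝 0) (𝓝 0) := by
  have hm : ∀ t : ℂ × ℂ, MeasurePreserving (fun x : ℂ × ℂ => x - t) volume volume := fun t =>
    measurePreserving_sub_right volume t
  have key : Tendsto (fun t : ℂ × ℂ => Lp.compMeasurePreserving (fun x => x - t) (hm t) (hf.toLp f))
      (𝓝 0) (𝓝 (Lp.compMeasurePreserving (fun x => x - 0) (hm 0) (hf.toLp f))) := by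
    let g : C(ℂ × ℂ, C(ℂ × ℂ, ℂ × ℂ)) :=
      (ContinuousMap.mk (fun a : (ℂ × ℂ) × (ℂ × ℂ) => a.2 - a.1) (by fun_prop)).curry
    have h := Continuous.compMeasurePreservingLp (μ := (volume : Measure (ℂ × ℂ)))
      (ν := (volume : Measure (ℂ × ℂ))) (p := 2) (f := fun _ : ℂ × ℂ => hf.toLp f) (g := fun t => g t)
      continuous_const g.continuous (fun t => hm t) (by simp)
    exact h.tendsto 0
  rw [tendsto_iff_edist_tendsto_0] at key
  refine key.congr (fun t => ?_)
  rw [Lp.toLp_compMeasurePreserving hf, Lp.toLp_compMeasurePreserving hf, Lp.edist_toLp_toLp]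
  simp [Function.comp_def, Pi.sub_def]

lemma mo_L2_aux {f : ℂ × ℂ → ℂ} (hf : MemLp f 2) (hfm : StronglyMeasurable f) {ε : ℝ≥0∞} {n : ℕ}
    (hn : ∀ t, ‖t‖ < 1 / ((n : ℝ) + 1) → eLpNorm (fun x => f (x - t) - f x) 2 volume ≤ ε) :
    eLpNorm (fun x => mo (fun y => (kap n y : ℂ)) f x - f x) 2 volume ≤ ε := by
  have hli : LocallyIntegrable f := hf.locallyIntegrable (by norm_num)
  have kc : Continuous (fun y => (kap n y : ℂ)) := (contDiff_ofReal (kap_contDiff n)).continuous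
  have kcr : Continuous (kap n) := (kap_contDiff n).continuous
  have kk : HasCompactSupport (fun y => (kap n y : ℂ)) :=
    HasCompactSupport.comp_left (g := Complex.ofReal) (kap_hcs n) (by simp)
  -- pointwise representation
  have rep : ∀ x, mo (fun y => (kap n y : ℂ)) f x - f x = ∫ t, (kap n t : ℂ) * (f (x - t) - f x) := by
    intro x
    have h1 : mo (fun y => (kap n y : ℂ)) f x = ∫ t, (kap n t : ℂ) * f (x - t) := by
      unfold mo
      rw [← integral_sub_left_eq_self (fun t => f t * (kap n (x - t) : ℂ)) volume x]
      congr 1; funext t; rw [sub_sub_cancel, mul_comm]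
    have i0 : Integrable (fun t => (kap n t : ℂ)) := kc.integrable_of_hasCompactSupport kk
    have i1 : Integrable (fun t => (kap n t : ℂ) * f (x - t)) := by
      have := (integrable_mo kc kk hli x).comp_sub_left x
      refine this.congr (Eventually.of_forall fun t => ?_)
      simp [mul_comm]
    have h2 : f x = ∫ t, (kap n t : ℂ) * f x := by
      rw [integral_mul_const, integral_complex_ofReal, kap_integral]; simp
    simp only [mul_sub]
    rw [integral_sub i1 (i0.mul_const _), ← h1, ← h2]
  set w : ℂ × ℂ → ℝ≥0∞ := fun t => ENNReal.ofReal (kap n t) with hw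
  have hwm : Measurable w := kcr.measurable.ennreal_ofReal
  have hw1 : ∫⁻ t, w t = 1 := by
    rw [← ofReal_integral_eq_lintegral_ofReal (kcr.integrable_of_hasCompactSupport (kap_hcs n))
      (Eventually.of_forall (kap_nonneg n)), kap_integral]; simp
  have pt : ∀ x, ‖mo (fun y => (kap n y : ℂ)) f x - f x‖ₑ ^ (2:ℝ) ≤
      ∫⁻ t, w t * ‖f (x - t) - f x‖ₑ ^ (2:ℝ) := by
    intro x
    rw [rep]
    have hg : Measurable (fun t => ‖f (x - t) - f x‖ₑ) :=
      ((hfm.comp_measurable (measurable_const.sub measurable_id)).sub stronglyMeasurable_const).enorm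
    have a1 : ‖∫ t, (kap n t : ℂ) * (f (x - t) - f x)‖ₑ ≤ ∫⁻ t, w t * ‖f (x - t) - f x‖ₑ := by
      refine (enorm_integral_le_lintegral_enorm _).trans (le_of_eq ?_)
      congr 1; funext t
      rw [enorm_mul]; congr 1
      rw [hw, ← ofReal_norm_eq_enorm, Complex.norm_real, Real.norm_of_nonneg (kap_nonneg n t)]
    have hol := ENNReal.lintegral_mul_le_Lp_mul_Lq (volume : Measure (ℂ × ℂ))
      (p := 2) (q := 2) ⟨by norm_num, by norm_num, by norm_num⟩
      (f := fun t => w t ^ (1/2 : ℝ)) (g := fun t => w t ^ (1/2 : ℝ) * ‖f (x - t) - f x‖ₑ)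
      (hwm.pow_const _).aemeasurable ((hwm.pow_const _).mul hg).aemeasurable
    have e1 : ∀ t, w t ^ (1/2 : ℝ) * w t ^ (1/2 : ℝ) = w t := fun t => by
      rw [← ENNReal.rpow_add_of_nonneg _ _ (by norm_num) (by norm_num)]; norm_num
    have e2 : ∀ t, (w t ^ (1/2 : ℝ)) ^ (2:ℝ) = w t := fun t => by
      rw [← ENNReal.rpow_mul]; norm_num
    simp only [Pi.mul_apply, ENNReal.mul_rpow_of_nonneg _ _ (show (0:ℝ) ≤ 2 by norm_num), e2, hw1,
      ← mul_assoc, e1] at hol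
    simp only [ENNReal.one_rpow, one_mul] at hol
    calc _ ≤ (∫⁻ t, w t * ‖f (x - t) - f x‖ₑ) ^ (2:ℝ) := by gcongr
      _ ≤ ((∫⁻ t, w t * ‖f (x - t) - f x‖ₑ ^ (2:ℝ)) ^ (1/2:ℝ)) ^ (2:ℝ) := by gcongr
      _ = _ := by rw [← ENNReal.rpow_mul]; norm_num
  have L2 : ∀ g : ℂ × ℂ → ℂ, eLpNorm g 2 volume = (∫⁻ x, ‖g x‖ₑ ^ (2:ℝ)) ^ (1/2:ℝ) := fun g => by
    rw [eLpNorm_eq_lintegral_rpow_enorm_toReal (by norm_num) (by norm_num)]; simp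
  have tot : ∫⁻ x, ‖mo (fun y => (kap n y : ℂ)) f x - f x‖ₑ ^ (2:ℝ) ≤ ε ^ (2:ℝ) := by
    have hjm : Measurable (fun z : (ℂ × ℂ) × (ℂ × ℂ) => w z.2 * ‖f (z.1 - z.2) - f z.1‖ₑ ^ (2:ℝ)) := by
      have h1 : StronglyMeasurable (fun z : (ℂ × ℂ) × (ℂ × ℂ) => f (z.1 - z.2)) :=
        hfm.comp_measurable (measurable_fst.sub measurable_snd)
      have h2 : StronglyMeasurable (fun z : (ℂ × ℂ) × (ℂ × ℂ) => f z.1) :=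
        hfm.comp_measurable measurable_fst
      exact (hwm.comp measurable_snd).mul (((h1.sub h2).enorm).pow_const _)
    calc _ ≤ ∫⁻ x, ∫⁻ t, w t * ‖f (x - t) - f x‖ₑ ^ (2:ℝ) := lintegral_mono pt
      _ = ∫⁻ t, ∫⁻ x, w t * ‖f (x - t) - f x‖ₑ ^ (2:ℝ) :=
        lintegral_lintegral_swap hjm.aemeasurable
      _ ≤ ∫⁻ t, w t * ε ^ (2:ℝ) := by
        refine lintegral_mono fun t => ?_
        beta_reduce
        rw [lintegral_const_mul]
        · rcases lt_or_ge ‖t‖ (1 / ((n : ℝ) + 1)) with h | h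
          · gcongr
            have := hn t h
            rw [L2] at this
            calc _ = ((∫⁻ x, ‖f (x - t) - f x‖ₑ ^ (2:ℝ)) ^ (1/2:ℝ)) ^ (2:ℝ) := by
                  rw [← ENNReal.rpow_mul]; norm_num
              _ ≤ _ := by gcongr
          · simp [hw, kap_zero h]
        · have h1 : StronglyMeasurable (fun z : (ℂ × ℂ) => f (z - t)) :=
            hfm.comp_measurable (measurable_id.sub measurable_const)
          exact ((h1.sub hfm).enorm).pow_const _
      _ = ε ^ (2:ℝ) := by rw [lintegral_mul_const _ hwm, hw1, one_mul]
  rw [L2]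
  calc _ ≤ (ε ^ (2:ℝ)) ^ (1/2:ℝ) := by gcongr
    _ = ε := by rw [← ENNReal.rpow_mul]; norm_num

lemma mo_L2 {f : ℂ × ℂ → ℂ} (hf : MemLp f 2) :
    Tendsto (fun n => eLpNorm (fun x => mo (fun y => (kap n y : ℂ)) f x - f x) 2 volume)
      atTop (𝓝 0) := by
  set f' := hf.1.mk f with hf'
  have hae : f =ᵐ[volume] f' := hf.1.ae_eq_mk
  have hm' : StronglyMeasurable f' := hf.1.stronglyMeasurable_mk
  have hfL : MemLp f' 2 := (memLp_congr_ae hae).1 hf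
  have e1 : ∀ κ, mo κ f = mo κ f' := fun κ => by
    funext x
    unfold mo
    apply integral_congr_ae
    filter_upwards [hae] with t ht
    rw [ht]
  have e2 : ∀ n, eLpNorm (fun x => mo (fun y => (kap n y : ℂ)) f x - f x) 2 volume =
      eLpNorm (fun x => mo (fun y => (kap n y : ℂ)) f' x - f' x) 2 volume := fun n => by
    apply eLpNorm_congr_ae
    filter_upwards [hae] with t ht
    rw [ht, e1]
  simp only [e2]
  rw [ENNReal.tendsto_nhds_zero]
  intro ε hε
  have h := (ENNReal.tendsto_nhds_zero.1 (translate_L2 hfL)) ε hε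
  rw [Metric.eventually_nhds_iff] at h
  obtain ⟨δ, hδ, h⟩ := h
  obtain ⟨N, hN⟩ := exists_nat_one_div_lt hδ
  filter_upwards [eventually_ge_atTop N] with n hn
  apply mo_L2_aux hfL hm'
  intro t ht
  apply h
  rw [dist_zero_right]
  refine ht.trans (lt_of_le_of_lt ?_ hN)
  have : (N : ℝ) ≤ n := by exact_mod_cast hn
  gcongr

end

section
open Complex
open MeasureTheory ComplexConjugate
open Filter Topology
open scoped ENNReal

/-- L² convergence -/
structure L2T (fn : ℕ → ℂ × ℂ → ℂ) (f : ℂ × ℂ → ℂ) : Prop where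
  m1 : ∀ n, MemLp (fn n) 2
  m2 : MemLp f 2
  lim : Tendsto (fun n => eLpNorm (fun x => fn n x - f x) 2 volume) atTop (𝓝 0)

lemma L2T.add {fn gn f g} (h1 : L2T fn f) (h2 : L2T gn g) :
    L2T (fun n x => fn n x + gn n x) (fun x => f x + g x) where
  m1 n := (h1.m1 n).add (h2.m1 n)
  m2 := h1.m2.add h2.m2
  lim := by
    have := h1.lim.add h2.lim
    rw [add_zero] at this
    refine tendsto_of_tendsto_of_tendsto_of_le_of_le tendsto_const_nhds this (fun _ => bot_le) ?_
    intro n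
    have e : (fun x => fn n x + gn n x - (f x + g x)) =
      (fun x => fn n x - f x) + (fun x => gn n x - g x) := by
      funext x; simp only [Pi.add_apply]; ring
    beta_reduce
    rw [e]
    exact eLpNorm_add_le ((h1.m1 n).sub h1.m2).1 ((h2.m1 n).sub h2.m2).1 (by norm_num)

lemma L2T.mul {fn f} (h1 : L2T fn f) {c : ℂ × ℂ → ℂ} (hc : Continuous c) {C : ℝ}
    (hC : ∀ x, ‖c x‖ ≤ C) :
    L2T (fun n x => c x * fn n x) (fun x => c x * f x) where
  m1 n := (h1.m1 n).of_le_mul (hc.aestronglyMeasurable.mul (h1.m1 n).1)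
    (Eventually.of_forall fun x => by rw [norm_mul]; gcongr; exact hC x)
  m2 := h1.m2.of_le_mul (hc.aestronglyMeasurable.mul h1.m2.1)
    (Eventually.of_forall fun x => by rw [norm_mul]; gcongr; exact hC x)
  lim := by
    have := ENNReal.Tendsto.const_mul (a := ENNReal.ofReal C) h1.lim (Or.inr (by simp))
    rw [mul_zero] at this
    refine tendsto_of_tendsto_of_tendsto_of_le_of_le tendsto_const_nhds this (fun _ => bot_le) ?_
    intro n
    apply eLpNorm_le_mul_eLpNorm_of_ae_le_mul
    refine Eventually.of_forall fun x => ?_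
    rw [← mul_sub, norm_mul]
    gcongr; exact hC x

lemma integrable_mul_conj {f g : ℂ × ℂ → ℂ} (hf : MemLp f 2) (hg : MemLp g 2) :
    Integrable (fun x => f x * conj (g x)) := by
  have hg' : MemLp (fun x => conj (g x)) 2 := hg.star
  exact hf.integrable_mul hg'

lemma L2T.int {fn gn f g} (h1 : L2T fn f) (h2 : L2T gn g) :
    Tendsto (fun n => ∫ x, (fn n x * conj (gn n x)).re) atTop (𝓝 (∫ x, (f x * conj (g x)).re)) := by
  have inn : ∀ {f g : ℂ × ℂ → ℂ} (hf : MemLp f 2) (hg : MemLp g 2),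
      (inner ℂ (hg.toLp g) (hf.toLp f)).re = ∫ x, (f x * conj (g x)).re := by
    intro f g hf hg
    rw [L2.inner_def]
    have := integral_re (integrable_mul_conj hf hg)
    simp only [RCLike.re_to_complex] at this
    rw [this]
    congr 1
    apply integral_congr_ae
    filter_upwards [hf.coeFn_toLp, hg.coeFn_toLp] with x h1 h2
    rw [h1, h2]; simp
  have t : ∀ {fn f} (h : L2T fn f), Tendsto (fun n => (h.m1 n).toLp (fn n)) atTop (𝓝 (h.m2.toLp f)) := by
    intro fn f h
    rw [tendsto_iff_edist_tendsto_0]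
    refine h.lim.congr fun n => ?_
    rw [Lp.edist_toLp_toLp]; rfl
  have := ((t h2).inner (𝕜 := ℂ) (t h1))
  have := (Complex.continuous_re.tendsto _).comp this
  rw [inn] at this
  exact this.congr fun n => by simp [inn, Function.comp]

lemma kapC (n) : ContDiff ℝ 2 (fun y => (kap n y : ℂ)) ∧ HasCompactSupport (fun y => (kap n y : ℂ)) :=
  ⟨contDiff_ofReal (kap_contDiff n), HasCompactSupport.comp_left (g := Complex.ofReal) (kap_hcs n) (by simp)⟩

lemma L2T_mo {f : ℂ × ℂ → ℂ} (hf : MemLp f 2) (hc : HasCompactSupport f) :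
    L2T (fun n => mo (fun y => (kap n y : ℂ)) f) f where
  m1 n := (mo_contDiff (kapC n).1 (kapC n).2 (hf.locallyIntegrable (by norm_num))).continuous.memLp_of_hasCompactSupport
    (hcs_mo (kapC n).2 hc)
  m2 := hf
  lim := mo_L2 hf

lemma leviForm_bil (φ : ℂ × ℂ → ℝ) (x) (p q : ℂ) :
    leviForm φ x (p, q) =
     (((db (1,0) (dz (1,0) (fun y => (φ y : ℂ))) x * p + db (1,0) (dz (0,1) (fun y => (φ y : ℂ))) x * q) * conj p).re
    + ((db (0,1) (dz (1,0) (fun y => (φ y : ℂ))) x * p + db (0,1) (dz (0,1) (fun y => (φ y : ℂ))) x * q) * conj q).re) := by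
  simp only [leviForm, wdz1_eq, wdz2_eq, wdzbar1_eq, wdzbar2_eq]
  rw [← Complex.add_re]; congr 1; ring

lemma hcs_refl {κ : ℂ × ℂ → ℂ} (hc : HasCompactSupport κ) (x) : HasCompactSupport (fun y => κ (x - y)) :=
  hc.comp_homeomorph (Homeomorph.subLeft x)

/-- weak Morrey–Kohn–Hörmander inequality. -/
lemma wmkh {φ : ℂ × ℂ → ℝ} {a b s k : ℂ × ℂ → ℂ} (hφ : ContDiff ℝ 2 φ) (hφc : HasCompactSupport φ)
    (ha : MemLp a 2) (hb : MemLp b 2) (hs : MemLp s 2) (hk : MemLp k 2)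
    (hac : HasCompactSupport a) (hbc : HasCompactSupport b)
    (hsc : HasCompactSupport s) (hkc : HasCompactSupport k)
    (H1 : ∀ g, ContDiff ℝ 2 g → HasCompactSupport g →
      ∫ x, (b x * db (1,0) g x - a x * db (0,1) g x) = - ∫ x, s x * g x)
    (H2 : ∀ g, ContDiff ℝ 2 g → HasCompactSupport g →
      ∫ x, (a x * dz (1,0) g x + b x * dz (0,1) g x) = - ∫ x, k x * g x) :
    Integrable (fun x => leviForm φ x (a x, b x) * Real.exp (-φ x)) ∧ Integrable (fun x => (‖k x + ((-dz (1,0) (fun y => (φ y : ℂ)) x) * a x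
        + (-dz (0,1) (fun y => (φ y : ℂ)) x) * b x)‖ ^ 2 + ‖s x‖ ^ 2) * Real.exp (-φ x)) ∧
    ∫ x, leviForm φ x (a x, b x) * Real.exp (-φ x) ≤
      ∫ x, (‖k x + ((-dz (1,0) (fun y => (φ y : ℂ)) x) * a x
        + (-dz (0,1) (fun y => (φ y : ℂ)) x) * b x)‖ ^ 2 + ‖s x‖ ^ 2) * Real.exp (-φ x) := by
  have li : ∀ {f : ℂ × ℂ → ℂ}, MemLp f 2 → LocallyIntegrable f := fun h => h.locallyIntegrable (by norm_num)
  set P := fun n => mo (fun y => (kap n y : ℂ)) a with hP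
  set Q := fun n => mo (fun y => (kap n y : ℂ)) b with hQ
  set S := fun n => mo (fun y => (kap n y : ℂ)) s with hS
  set K := fun n => mo (fun y => (kap n y : ℂ)) k with hK
  have tP : L2T P a := L2T_mo ha hac
  have tQ : L2T Q b := L2T_mo hb hbc
  have tS : L2T S s := L2T_mo hs hsc
  have tK : L2T K k := L2T_mo hk hkc
  have hφ' := contDiff_ofReal hφ
  have hφc' : HasCompactSupport (fun y => (φ y : ℂ)) :=
    HasCompactSupport.comp_left (g := Complex.ofReal) hφc (by simp)
  obtain ⟨B, hB⟩ := hφc.exists_bound_of_continuous hφ.continuous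
  have kr : ∀ n x, ContDiff ℝ 2 (fun y => ((kap n (x - y) : ℝ) : ℂ)) ∧
      HasCompactSupport (fun y => ((kap n (x - y) : ℝ) : ℂ)) := fun n x =>
    ⟨(kapC n).1.comp (contDiff_const.sub contDiff_id), hcs_refl (kapC n).2 x⟩
  have cd : ∀ {κ : ℂ × ℂ → ℂ}, ContDiff ℝ 2 κ → ContDiff ℝ 1 κ := fun h => h.of_le (by norm_num)
  have im : ∀ {f g : ℂ × ℂ → ℂ}, MemLp f 2 → Continuous g → HasCompactSupport g →
      Integrable (fun x => f x * g x) := fun hf hg hgc =>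
    hf.integrable_mul (hg.memLp_of_hasCompactSupport (p := 2) hgc)
  have eS : ∀ n x, db (1,0) (Q n) x - db (0,1) (P n) x = S n x := by
    intro n x
    have := H1 _ (kr n x).1 (kr n x).2
    have i1 := im hb (continuous_db (e := (1,0)) (cd (kr n x).1)) (hcs_db (kr n x).2)
    have i2 := im ha (continuous_db (e := (0,1)) (cd (kr n x).1)) (hcs_db (kr n x).2)
    rw [integral_sub i1 i2] at this
    have eq : S n x = ∫ t, s t * (kap n (x - t) : ℂ) := rfl
    rw [eq, hP, hQ, db_mo (kapC n).1 (kapC n).2 (li ha), db_mo (kapC n).1 (kapC n).2 (li hb)]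
    linear_combination -this
  have eK : ∀ n x, dz (1,0) (P n) x + dz (0,1) (Q n) x = K n x := by
    intro n x
    have := H2 _ (kr n x).1 (kr n x).2
    have i1 := im ha (continuous_dz (e := (1,0)) (cd (kr n x).1)) (hcs_dz (kr n x).2)
    have i2 := im hb (continuous_dz (e := (0,1)) (cd (kr n x).1)) (hcs_dz (kr n x).2)
    rw [integral_add i1 i2] at this
    have eq : K n x = ∫ t, k t * (kap n (x - t) : ℂ) := rfl
    rw [eq, hP, hQ, dz_mo (kapC n).1 (kapC n).2 (li ha), dz_mo (kapC n).1 (kapC n).2 (li hb)]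
    linear_combination -this
  have ineq := fun n => mkh hφ (mo_contDiff (kapC n).1 (kapC n).2 (li ha))
    (mo_contDiff (kapC n).1 (kapC n).2 (li hb)) (hcs_mo (kapC n).2 hac) (hcs_mo (kapC n).2 hbc)
  -- coefficients
  have cL : ∀ e e', Continuous (db e' (dz e (fun y => (φ y : ℂ)))) := fun e e' =>
    continuous_db (contDiff_dz hφ')
  have bL : ∀ e e', ∃ C, ∀ x, ‖db e' (dz e (fun y => (φ y : ℂ))) x‖ ≤ C := fun e e' =>
    (hcs_db (hcs_dz hφc')).exists_bound_of_continuous (cL e e')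
  have cD : ∀ e, Continuous (fun x => - (dz e (fun y => (φ y : ℂ))) x) := fun e =>
    (contDiff_dz hφ').continuous.neg
  have bD : ∀ e, ∃ C, ∀ x, ‖-dz e (fun y => (φ y : ℂ)) x‖ ≤ C := fun e => by
    simpa using (hcs_dz hφc').exists_bound_of_continuous (contDiff_dz (e := e) hφ').continuous
  choose CL hCL using bL
  choose CD hCD using bD
  have cE : Continuous (fun x => (Real.exp (-φ x) : ℂ)) := by
    have := hφ.continuous; fun_prop
  have bE : ∀ x, ‖(Real.exp (-φ x) : ℂ)‖ ≤ Real.exp B := fun x => by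
    rw [Complex.norm_real, Real.norm_of_nonneg (Real.exp_pos _).le, Real.exp_le_exp]
    have := hB x
    rw [Real.norm_eq_abs] at this
    linarith [neg_abs_le (φ x)]
  have tF := tK.add (((tP.mul (cD (1,0)) (hCD _)).add (tQ.mul (cD (0,1)) (hCD _))))
  have r1 := (tF.mul cE bE).int tF
  have r2 := (tS.mul cE bE).int tS
  have tG1 := (((tP.mul (cL (1,0) (1,0)) (hCL _ _)).add (tQ.mul (cL (0,1) (1,0)) (hCL _ _)))).mul cE bE
  have tG2 := (((tP.mul (cL (1,0) (0,1)) (hCL _ _)).add (tQ.mul (cL (0,1) (0,1)) (hCL _ _)))).mul cE bE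
  have l1 := tG1.int tP
  have l2 := tG2.int tQ
  have sq : ∀ (c : ℝ) (z : ℂ), ((c : ℂ) * z * conj z).re = ‖z‖ ^ 2 * c := by
    intro c z
    rw [mul_assoc, Complex.mul_conj, ← Complex.ofReal_mul, Complex.ofReal_re,
      Complex.normSq_eq_norm_sq]; ring
  have lev : ∀ (c : ℝ) (p q x), leviForm φ x (p, q) * c =
     (((c : ℂ) * (db (1,0) (dz (1,0) (fun y => (φ y : ℂ))) x * p + db (1,0) (dz (0,1) (fun y => (φ y : ℂ))) x * q)) * conj p).re
    + (((c : ℂ) * (db (0,1) (dz (1,0) (fun y => (φ y : ℂ))) x * p + db (0,1) (dz (0,1) (fun y => (φ y : ℂ))) x * q)) * conj q).re := by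
    intro c p q x
    rw [leviForm_bil, mul_assoc, mul_assoc, Complex.re_ofReal_mul, Complex.re_ofReal_mul]; ring
  have ire : ∀ {f g : ℂ × ℂ → ℂ}, MemLp f 2 → MemLp g 2 → Integrable (fun x => (f x * conj (g x)).re) :=
    fun hf hg => (integrable_mul_conj hf hg).re
  have LL := l1.add l2
  have RR := r1.add r2
  rw [← integral_add (ire tG1.m2 tP.m2) (ire tG2.m2 tQ.m2)] at LL
  rw [← integral_add (ire (tF.mul cE bE).m2 tF.m2) (ire (tS.mul cE bE).m2 tS.m2)] at RR
  simp only [sq] at RR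
  simp only [← lev] at LL
  simp only [← add_mul] at RR
  have IL := ii_add (ire tG1.m2 tP.m2) (ire tG2.m2 tQ.m2)
  have IR := ii_add (ire (tF.mul cE bE).m2 tF.m2) (ire (tS.mul cE bE).m2 tS.m2)
  simp only [sq] at IR
  simp only [← lev] at IL
  simp only [← add_mul] at IR
  refine ⟨IL, IR, ?_⟩
  refine le_of_tendsto_of_tendsto' LL RR fun n => ?_
  rw [← integral_add (ire (tG1.m1 n) (tP.m1 n)) (ire (tG2.m1 n) (tQ.m1 n))]
  rw [← integral_add ((ire ((tF.mul cE bE).m1 n) (tF.m1 n)).congr (Eventually.of_forall fun x => sq _ _))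
    ((ire ((tS.mul cE bE).m1 n) (tS.m1 n)).congr (Eventually.of_forall fun x => sq _ _))]
  simp only [← lev, ← add_mul]
  refine (ineq n).trans (le_of_eq ?_)
  congr 1; funext x
  have e1 := eS n x
  have e2 := eK n x
  simp only [hP, hQ] at e1 e2
  rw [e1]
  congr 4
  simp only [dl]
  rw [← e2]; ring

end

section
open Complex
open MeasureTheory ComplexConjugate
open Filter Topology
open scoped ENNReal

/-- test functions: C² with compact support in `D`. -/
structure Tst (D : Set (ℂ × ℂ)) (g : ℂ × ℂ → ℂ) : Prop where
  cd : ContDiff ℝ 2 g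
  cs : HasCompactSupport g
  sub : tsupport g ⊆ D

lemma cut_continuous {D : Set (ℂ × ℂ)} (hD : IsOpen D) {u c : ℂ × ℂ → ℂ} (hu : Continuous u)
    (hs : tsupport u ⊆ D) (hc : ContinuousOn c D) : Continuous (fun x => c x * u x) := by
  rw [continuous_iff_continuousAt]
  intro x
  by_cases hx : x ∈ tsupport u
  · exact (hc.continuousAt (hD.mem_nhds (hs hx))).mul hu.continuousAt
  · have : u =ᶠ[𝓝 x] 0 := notMem_tsupport_iff_eventuallyEq.mp hx
    have h2 : (fun x => c x * u x) =ᶠ[𝓝 x] fun _ => 0 := by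
      filter_upwards [this] with y hy
      simp [hy]
    exact (continuousAt_const (y := (0:ℂ))).congr h2.symm

lemma cut_contDiff {D : Set (ℂ × ℂ)} (hD : IsOpen D) {u c : ℂ × ℂ → ℂ} (hu : ContDiff ℝ 2 u)
    (hs : tsupport u ⊆ D) (hc : ContDiffOn ℝ 2 c D) : ContDiff ℝ 2 (fun x => c x * u x) := by
  rw [contDiff_iff_contDiffAt]
  intro x
  by_cases hx : x ∈ tsupport u
  · exact (hc.contDiffAt (hD.mem_nhds (hs hx))).mul hu.contDiffAt
  · have : u =ᶠ[𝓝 x] 0 := notMem_tsupport_iff_eventuallyEq.mp hx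
    have h2 : (fun x => c x * u x) =ᶠ[𝓝 x] fun _ => 0 := by
      filter_upwards [this] with y hy
      simp [hy]
    exact (contDiffAt_const (c := (0:ℂ))).congr_of_eventuallyEq h2

lemma cut_memLp {D : Set (ℂ × ℂ)} (hD : IsOpen D) {u c : ℂ × ℂ → ℂ} (hu : Continuous u)
    (hcs : HasCompactSupport u)
    (hs : tsupport u ⊆ D) (hc : ContinuousOn c D) {p : ℝ≥0∞} : MemLp (fun x => c x * u x) p volume :=
  (cut_continuous hD hu hs hc).memLp_of_hasCompactSupport hcs.mul_left

lemma tsupport_db {e} {f : ℂ × ℂ → ℂ} : tsupport (db e f) ⊆ tsupport f :=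
  closure_minimal (fun x hx => by
    by_contra h
    exact hx (db_eq_zero_of_notMem h)) (isClosed_tsupport f)

lemma tsupport_dz {e} {f : ℂ × ℂ → ℂ} : tsupport (dz e f) ⊆ tsupport f :=
  closure_minimal (fun x hx => by
    by_contra h
    exact hx (dz_eq_zero_of_notMem h)) (isClosed_tsupport f)

lemma Tst.cd1 {D g} (h : Tst D g) : ContDiff ℝ 1 g := h.cd.of_le (by norm_num)

lemma Tst.conj {D g} (h : Tst D g) : Tst D (fun x => conj (g x)) where
  cd := contDiff_conj h.cd
  cs := h.cs.comp_left (by simp)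
  sub := (closure_mono (fun x hx => by
    simp only [Function.mem_support] at hx ⊢
    intro h0; apply hx; simp [h0])).trans h.sub

lemma Tst.mul_left {D g} (h : Tst D g) {u : ℂ × ℂ → ℂ} (hu : ContDiff ℝ 2 u) :
    Tst D (fun x => u x * g x) where
  cd := hu.mul h.cd
  cs := h.cs.mul_left
  sub := (tsupport_mul_subset_right).trans h.sub

lemma Tst.memLp_db {D g} (h : Tst D g) (hD : IsOpen D) (e) {c : ℂ × ℂ → ℂ} (hc : ContinuousOn c D)
    {p : ℝ≥0∞} : MemLp (fun x => c x * db e g x) p volume :=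
  cut_memLp hD (continuous_db h.cd1) (hcs_db h.cs) (tsupport_db.trans h.sub) hc

lemma Tst.memLp_dz {D g} (h : Tst D g) (hD : IsOpen D) (e) {c : ℂ × ℂ → ℂ} (hc : ContinuousOn c D)
    {p : ℝ≥0∞} : MemLp (fun x => c x * dz e g x) p volume :=
  cut_memLp hD (continuous_dz h.cd1) (hcs_dz h.cs) (tsupport_dz.trans h.sub) hc

/-- the Hilbert space of pairs -/
abbrev HH := WithLp 2 (Lp ℂ 2 (volume : Measure (ℂ × ℂ)) × Lp ℂ 2 (volume : Measure (ℂ × ℂ)))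

/-- pair of L² functions -/
def mkHH {f g : ℂ × ℂ → ℂ} (hf : MemLp f 2) (hg : MemLp g 2) : HH :=
  WithLp.toLp 2 (hf.toLp f, hg.toLp g)

lemma inner_toLp {f g : ℂ × ℂ → ℂ} (hf : MemLp f 2) (hg : MemLp g 2) :
    inner ℂ (hg.toLp g) (hf.toLp f) = ∫ x, f x * conj (g x) := by
  rw [L2.inner_def]
  apply integral_congr_ae
  filter_upwards [hf.coeFn_toLp, hg.coeFn_toLp] with x h1 h2
  rw [h1, h2]; simp

lemma inner_HH {f g f' g' : ℂ × ℂ → ℂ} (hf : MemLp f 2) (hg : MemLp g 2)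
    (hf' : MemLp f' 2) (hg' : MemLp g' 2) :
    inner ℂ (mkHH hf hg) (mkHH hf' hg') = ∫ x, (f' x * conj (f x) + g' x * conj (g x)) := by
  rw [mkHH, mkHH, WithLp.prod_inner_apply]
  simp only
  rw [inner_toLp, inner_toLp, integral_add (integrable_mul_conj hf' hf) (integrable_mul_conj hg' hg)]

lemma hilb {D : Set (ℂ × ℂ)} (hD : IsOpen D) {ω : ℂ × ℂ → ℝ} (hω : ContinuousOn ω D)
    (hpos : ∀ x ∈ D, 0 < ω x) {Θ1 Θ2 : ℂ × ℂ → ℂ} (h1 : Tst D Θ1) (h2 : Tst D Θ2) :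
    ∃ b1 b2 : ℂ × ℂ → ℂ, MemLp b1 2 ∧ MemLp b2 2 ∧
      (∀ g, Tst D g → ∫ x, (b2 x * ((ω x : ℂ)⁻¹ * db (1,0) g x) - b1 x * ((ω x : ℂ)⁻¹ * db (0,1) g x)) = 0) ∧
      ∀ h, Tst D h → ∫ x, (b1 x * ((ω x : ℂ) * dz (1,0) h x) + b2 x * ((ω x : ℂ) * dz (0,1) h x)) =
        ∫ x, (Θ1 x * dz (1,0) h x + Θ2 x * dz (0,1) h x) := by
  have cω : ContinuousOn (fun x => (ω x : ℂ)) D := Complex.continuous_ofReal.comp_continuousOn hω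
  have ciω : ContinuousOn (fun x => (ω x : ℂ)⁻¹) D := cω.inv₀ fun x hx => by
    exact_mod_cast (hpos x hx).ne'
  have hb1 : MemLp (fun x => (ω x : ℂ)⁻¹ * Θ1 x) 2 := cut_memLp hD h1.cd.continuous h1.cs h1.sub ciω
  have hb2 : MemLp (fun x => (ω x : ℂ)⁻¹ * Θ2 x) 2 := cut_memLp hD h2.cd.continuous h2.cs h2.sub ciω
  set b : HH := mkHH hb1 hb2 with hb
  have m1 : ∀ {g}, Tst D g → MemLp (fun x => - conj ((ω x : ℂ)⁻¹ * db (0,1) g x)) 2 := fun hg =>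
    (hg.memLp_db hD (0,1) ciω).star.neg
  have m2 : ∀ {g}, Tst D g → MemLp (fun x => conj ((ω x : ℂ)⁻¹ * db (1,0) g x)) 2 := fun hg =>
    (hg.memLp_db hD (1,0) ciω).star
  have n1 : ∀ {g}, Tst D g → MemLp (fun x => (ω x : ℂ) * db (1,0) g x) 2 := fun hg =>
    (hg.memLp_db hD (1,0) cω)
  have n2 : ∀ {g}, Tst D g → MemLp (fun x => (ω x : ℂ) * db (0,1) g x) 2 := fun hg =>
    (hg.memLp_db hD (0,1) cω)
  set M : Submodule ℂ HH := Submodule.span ℂ {m | ∃ g, ∃ hg : Tst D g, m = mkHH (m1 hg) (m2 hg)} with hM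
  set b' := Mᗮ.starProjection b with hb'
  have hb'M : b' ∈ Mᗮ := Submodule.starProjection_apply_mem _ _
  have hb'' : b - b' ∈ Mᗮᗮ := Submodule.sub_starProjection_mem_orthogonal _
  -- representatives
  have hr1 : MemLp (fun x => b'.fst x) 2 := Lp.memLp _
  have hr2 : MemLp (fun x => b'.snd x) 2 := Lp.memLp _
  have hbe : b' = mkHH hr1 hr2 := by
    apply WithLp.ofLp_injective
    apply Prod.ext
    · exact (Lp.toLp_coeFn b'.fst hr1).symm
    · exact (Lp.toLp_coeFn b'.snd hr2).symm
  refine ⟨_, _, hr1, hr2, ?_, ?_⟩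
  · intro g hg
    have h := (Submodule.mem_orthogonal _ _).1 hb'M (mkHH (m1 hg) (m2 hg))
      (Submodule.subset_span ⟨g, hg, rfl⟩)
    rw [hbe, inner_HH] at h
    refine Eq.trans ?_ h
    congr 1; funext x
    simp only [map_neg, Complex.conj_conj]
    ring
  · intro h0 hh0
    set g := fun x => conj (h0 x) with hgdef
    have hg : Tst D g := hh0.conj
    have hmem : mkHH (n1 hg) (n2 hg) ∈ Mᗮ := by
      have : M ≤ (Submodule.span ℂ {mkHH (n1 hg) (n2 hg)})ᗮ := by
        rw [hM, Submodule.span_le]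
        rintro _ ⟨γ, hγ, rfl⟩
        rw [SetLike.mem_coe, Submodule.mem_orthogonal_singleton_iff_inner_left, inner_HH]
        have e : ∀ x, (ω x : ℂ) * db (1,0) g x * conj (- conj ((ω x : ℂ)⁻¹ * db (0,1) γ x))
          + (ω x : ℂ) * db (0,1) g x * conj (conj ((ω x : ℂ)⁻¹ * db (1,0) γ x))
          = db (1,0) γ x * db (0,1) g x - db (0,1) γ x * db (1,0) g x := by
          intro x
          simp only [map_neg, Complex.conj_conj]
          by_cases hx : x ∈ D
          · have : (ω x : ℂ) ≠ 0 := by exact_mod_cast (hpos x hx).ne'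
            field_simp
            ring
          · have a1 := db_eq_zero_of_notMem (e := (1,0)) (fun h => hx (hg.sub h))
            have a2 := db_eq_zero_of_notMem (e := (0,1)) (fun h => hx (hg.sub h))
            simp [a1, a2]
        simp only [e]
        have j1 := ibp_db (e := (1,0)) hγ.cd1 (contDiff_db (e := (0,1)) hg.cd) hγ.cs
        have j2 := ibp_db (e := (0,1)) hγ.cd1 (contDiff_db (e := (1,0)) hg.cd) hγ.cs
        rw [integral_sub]
        · have : ∀ x, γ x * db (1,0) (db (0,1) g) x = γ x * db (0,1) (db (1,0) g) x := fun x => by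
            rw [db_db_comm hg.cd.contDiffAt]
          simp only [this] at j1
          rw [j1] at j2
          linear_combination -j2
        · exact ((continuous_db hγ.cd1).mul (continuous_db hg.cd1)).integrable_of_hasCompactSupport
            (hcs_db hγ.cs).mul_right
        · exact ((continuous_db hγ.cd1).mul (continuous_db hg.cd1)).integrable_of_hasCompactSupport
            (hcs_db hγ.cs).mul_right
      rw [Submodule.mem_orthogonal]
      intro u hu
      exact Submodule.mem_orthogonal_singleton_iff_inner_left.1 (this hu)
    have h := (Submodule.mem_orthogonal _ _).1 hb'' _ hmem
    rw [inner_sub_right, hbe, hb, inner_HH, inner_HH] at h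
    have h := (sub_eq_zero.1 h).symm
    have e : ∀ e x, dz e h0 x = conj (db e g x) := by
      intro e x
      rw [← dz_conj (hg.cd.differentiable (by norm_num) x)]
      simp [hgdef]
    simp only [e]
    calc _ = _ := ?_
      _ = _ := h
      _ = _ := ?_
    · congr 1; funext x
      simp
    · congr 1; funext x
      by_cases hx : x ∈ D
      · have : (ω x : ℂ) ≠ 0 := by exact_mod_cast (hpos x hx).ne'
        simp only [map_mul, Complex.conj_ofReal]
        field_simp
      · have a1 := db_eq_zero_of_notMem (e := (1,0)) (fun h => hx (hg.sub h))
        have a2 := db_eq_zero_of_notMem (e := (0,1)) (fun h => hx (hg.sub h))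
        simp [a1, a2]

end

section
open Complex
open MeasureTheory ComplexConjugate
open Filter Topology
open scoped ENNReal

/-- geometric data for the L² theorem -/
structure Dat (D : Set (ℂ × ℂ)) (r φ : ℂ × ℂ → ℝ) : Prop where
  op : IsOpen D
  cr : ContDiffOn ℝ 2 r D
  cφ : ContDiffOn ℝ 2 φ D
  rpos : ∀ x ∈ D, 0 < r x
  cpt : ∀ t > 0, IsCompact {x | x ∈ D ∧ t ≤ r x}
  bdd : ∃ B, ∀ x ∈ D, ‖dz (1,0) (fun y => (r y : ℂ)) x‖ ^ 2 + ‖dz (0,1) (fun y => (r y : ℂ)) x‖ ^ 2 ≤ B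
  lev : ∀ x ∈ D, ∀ p q : ℂ, 12 * (‖dz (1,0) (fun y => (r y : ℂ)) x * p
    + dz (0,1) (fun y => (r y : ℂ)) x * q‖ ^ 2 / r x ^ 2) + (‖p‖ ^ 2 + ‖q‖ ^ 2) / r x ^ 2 ≤ leviForm φ x (p, q)

/-- the weight `ω` -/
def om (r φ : ℂ × ℂ → ℝ) (x : ℂ × ℂ) : ℝ := Real.exp (-φ x / 2) / r x

lemma leviForm_congr {φ ψ : ℂ × ℂ → ℝ} {x} (h : φ =ᶠ[𝓝 x] ψ) (w) : leviForm φ x w = leviForm ψ x w := by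
  have h1 : (fun y => (φ y : ℂ)) =ᶠ[𝓝 x] (fun y => (ψ y : ℂ)) := by
    filter_upwards [h] with y hy; rw [hy]
  have h2 : ∀ e, dz e (fun y => (φ y : ℂ)) =ᶠ[𝓝 x] dz e (fun y => (ψ y : ℂ)) := fun e => by
    filter_upwards [h1.eventuallyEq_nhds] with y hy
    exact dz_congr hy
  obtain ⟨p, q⟩ := w
  simp only [leviForm_bil, db_congr (h2 _)]

lemma dz_cexp {φ : ℂ × ℂ → ℂ} {x e} (hφ : DifferentiableAt ℝ φ x) :
    dz e (fun y => Complex.exp (φ y)) x = Complex.exp (φ x) * dz e φ x := by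
  simp only [dz, (hφ.hasFDerivAt.cexp).fderiv, smul_apply, smul_eq_mul]; ring

lemma norm_db_real {η : ℂ × ℂ → ℝ} {x e} (hη : DifferentiableAt ℝ η x) :
    ‖db e (fun y => (η y : ℂ)) x‖ = ‖dz e (fun y => (η y : ℂ)) x‖ := by
  rw [← conj_dz_ofReal hη, RCLike.norm_conj]

lemma num_cs (a b c d : ℂ) : ‖a * c + b * d‖ ^ 2 ≤ (‖a‖ ^ 2 + ‖b‖ ^ 2) * (‖c‖ ^ 2 + ‖d‖ ^ 2) := by
  have h : ‖a * c + b * d‖ ≤ ‖a‖ * ‖c‖ + ‖b‖ * ‖d‖ := by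
    refine (norm_add_le _ _).trans ?_
    rw [norm_mul, norm_mul]
  calc _ ≤ (‖a‖ * ‖c‖ + ‖b‖ * ‖d‖) ^ 2 := by gcongr
    _ ≤ _ := by nlinarith [sq_nonneg (‖a‖ * ‖d‖ - ‖b‖ * ‖c‖)]

lemma num_three (x y z : ℂ) : ‖x + y + z‖ ^ 2 ≤ 3 * (‖x‖ ^ 2 + ‖y‖ ^ 2 + ‖z‖ ^ 2) := by
  have h : ‖x + y + z‖ ≤ ‖x‖ + ‖y‖ + ‖z‖ := norm_add₃_le
  calc _ ≤ (‖x‖ + ‖y‖ + ‖z‖) ^ 2 := by gcongr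
    _ ≤ _ := by nlinarith [sq_nonneg (‖x‖ - ‖y‖), sq_nonneg (‖y‖ - ‖z‖), sq_nonneg (‖x‖ - ‖z‖)]

lemma num_main {w R η : ℝ} (hw : 0 < w) (hR : 0 < R) {P T d s : ℂ} {N B L : ℝ}
    (hP : ‖P‖ ^ 2 ≤ N * B) (hs : ‖s‖ ^ 2 ≤ N * B)
    (hL : 12 * (‖(w:ℂ)⁻¹ * η * T‖ ^ 2 / R ^ 2) + η ^ 2 * w⁻¹ ^ 2 * B / R ^ 2 ≤ L) :
    (‖(w:ℂ)⁻¹ * P + 2 * (w:ℂ)⁻¹ * η * T / R + η * d * ((w:ℂ)⁻¹) ^ 2‖ ^ 2 + ‖(w:ℂ)⁻¹ * s‖ ^ 2) * (w ^ 2 * R ^ 2)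
      - L * (w ^ 2 * R ^ 2) ≤ 4 * (R ^ 2 * N * B) + 3 * (η ^ 2 * ‖d‖ ^ 2 * (R ^ 2 / w ^ 2)) - η ^ 2 * B := by
  have h3 := num_three ((w:ℂ)⁻¹ * P) (2 * (w:ℂ)⁻¹ * η * T / R) (η * d * ((w:ℂ)⁻¹) ^ 2)
  have nr : ∀ x : ℝ, ‖(x:ℂ)‖ ^ 2 = x ^ 2 := fun x => by rw [Complex.norm_real, Real.norm_eq_abs, sq_abs]
  generalize ‖(w:ℂ)⁻¹ * P + 2 * (w:ℂ)⁻¹ * η * T / R + η * d * ((w:ℂ)⁻¹) ^ 2‖ ^ 2 = X at h3 ⊢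
  have nw : ‖(w:ℂ)‖ = w := by rw [Complex.norm_real, Real.norm_of_nonneg hw.le]
  have n2 : ‖(2:ℂ)‖ = 2 := by simp
  simp only [norm_mul, mul_pow, norm_div, norm_inv, norm_pow, div_pow, inv_pow, nr, nw, n2] at h3 hL ⊢
  have hww : 0 < w ^ 2 * R ^ 2 := by positivity
  have a1 : X * (w ^ 2 * R ^ 2) ≤ 3 * (R ^ 2 * ‖P‖ ^ 2 + 4 * η ^ 2 * ‖T‖ ^ 2 + η ^ 2 * ‖d‖ ^ 2 * (R ^ 2 / w ^ 2)) := by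
    calc _ ≤ _ := mul_le_mul_of_nonneg_right h3 hww.le
      _ = _ := by
        field_simp
        try ring
  have a2 : 12 * η ^ 2 * ‖T‖ ^ 2 + η ^ 2 * B ≤ L * (w ^ 2 * R ^ 2) := by
    calc _ = _ := ?_
      _ ≤ _ := mul_le_mul_of_nonneg_right hL hww.le
    field_simp
    try ring
  have a3 : (w ^ 2)⁻¹ * ‖s‖ ^ 2 * (w ^ 2 * R ^ 2) = R ^ 2 * ‖s‖ ^ 2 := by field_simp
  have a4 : R ^ 2 * ‖s‖ ^ 2 ≤ R ^ 2 * (N * B) := by gcongr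
  have a5 : R ^ 2 * ‖P‖ ^ 2 ≤ R ^ 2 * (N * B) := by gcongr
  rw [add_mul, a3]
  linarith

end

section
open Complex
open MeasureTheory ComplexConjugate
open Filter Topology
open scoped ENNReal

lemma memLp_cs_mul {c b : ℂ × ℂ → ℂ} (hc : Continuous c) (hcs : HasCompactSupport c) (hb : MemLp b 2) :
    MemLp (fun x => c x * b x) 2 := by
  have : MemLp c ⊤ := hc.memLp_of_hasCompactSupport hcs
  exact hb.mul this

lemma integrable_sq {b : ℂ × ℂ → ℂ} (hb : MemLp b 2) : Integrable (fun x => ‖b x‖ ^ 2) := by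
  simpa using hb.integrable_norm_pow (by norm_num)

lemma integrable_mul_cs {c b : ℂ × ℂ → ℂ} (hc : Continuous c) (hcs : HasCompactSupport c) (hb : MemLp b 2) :
    Integrable (fun x => b x * c x) := by
  have : MemLp c 2 := hc.memLp_of_hasCompactSupport hcs
  exact hb.integrable_mul this

lemma Dat.contW {D r φ} (h : Dat D r φ) : ContDiffOn ℝ 2 (om r φ) D := by
  unfold om
  exact ((h.cφ.neg.div_const 2).exp).div h.cr (fun x hx => (h.rpos x hx).ne')

lemma Dat.ompos {D r φ} (h : Dat D r φ) {x} (hx : x ∈ D) : 0 < om r φ x := by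
  unfold om; have := h.rpos x hx; positivity

lemma om_sq {r φ : ℂ × ℂ → ℝ} {x} (hx : 0 < r x) : Real.exp (-φ x) = om r φ x ^ 2 * r x ^ 2 := by
  unfold om
  rw [div_pow, div_mul_cancel₀ _ (by positivity), ← Real.exp_nat_mul]
  congr 1; push_cast; ring

/-- `ω⁻²` -/
def Zw (r φ : ℂ × ℂ → ℝ) (x : ℂ × ℂ) : ℂ := (r x : ℂ) ^ 2 * cexp (φ x)

lemma Zw_eq {r φ : ℂ × ℂ → ℝ} {x} (hx : 0 < r x) : Zw r φ x = ((om r φ x : ℂ)⁻¹) ^ 2 := by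
  have h : Real.exp (-φ x / 2) ^ 2 = Real.exp (-φ x) := by
    rw [← Real.exp_nat_mul]; congr 1; push_cast; ring
  have : (r x ^ 2 * Real.exp (φ x)) = ((om r φ x)⁻¹) ^ 2 := by
    unfold om
    rw [inv_div, div_pow, h, Real.exp_neg]; field_simp
  unfold Zw
  exact_mod_cast this

lemma contOfReal {D : Set (ℂ × ℂ)} {f : ℂ × ℂ → ℝ} (hf : ContDiffOn ℝ 2 f D) :
    ContDiffOn ℝ 2 (fun x => (f x : ℂ)) D :=
  Complex.ofRealCLM.contDiff.comp_contDiffOn hf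

lemma Dat.contZ {D r φ} (h : Dat D r φ) : ContDiffOn ℝ 2 (Zw r φ) D := by
  unfold Zw
  exact ((contOfReal h.cr).pow 2).mul (contOfReal h.cφ).cexp

lemma dz_Zw {D r φ} (h : Dat D r φ) {x} (hx : x ∈ D) (e) :
    dz e (Zw r φ) x = Zw r φ x * (2 * dz e (fun y => (r y : ℂ)) x / r x + dz e (fun y => (φ y : ℂ)) x) := by
  have dr : DifferentiableAt ℝ (fun y => (r y : ℂ)) x :=
    ((contOfReal h.cr).contDiffAt (h.op.mem_nhds hx)).differentiableAt (by norm_num)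
  have dφ : DifferentiableAt ℝ (fun y => (φ y : ℂ)) x :=
    ((contOfReal h.cφ).contDiffAt (h.op.mem_nhds hx)).differentiableAt (by norm_num)
  have hr : (r x : ℂ) ≠ 0 := by exact_mod_cast (h.rpos x hx).ne'
  have : Zw r φ = fun y => ((r y : ℂ) * (r y : ℂ)) * cexp (φ y) := by ext y; simp [Zw]; ring
  rw [this, dz_mul (f := fun y => (r y : ℂ) * (r y : ℂ)) (dr.mul dr) dφ.cexp, dz_mul dr dr, dz_cexp dφ]
  field_simp
  ring

lemma lemB {D r φ} (h : Dat D r φ) {η θ : ℂ × ℂ → ℝ} {b1 b2 d : ℂ × ℂ → ℂ}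
    (hη : Tst D (fun x => (η x : ℂ))) (hθ : Tst D (fun x => (θ x : ℂ)))
    (hθ1 : ∀ x ∈ tsupport (fun x => (η x : ℂ)), θ =ᶠ[𝓝 x] 1)
    (m1 : MemLp b1 2) (m2 : MemLp b2 2) (hd : Continuous d)
    (F1 : ∀ g, Tst D g → ∫ x, (b2 x * ((om r φ x : ℂ)⁻¹ * db (1,0) g x) - b1 x * ((om r φ x : ℂ)⁻¹ * db (0,1) g x)) = 0)
    (F2 : ∀ h, Tst D h → ∫ x, (b1 x * ((om r φ x : ℂ) * dz (1,0) h x) + b2 x * ((om r φ x : ℂ) * dz (0,1) h x)) =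
        - ∫ x, d x * h x) :
    ∫ x, η x ^ 2 * (‖b1 x‖ ^ 2 + ‖b2 x‖ ^ 2) ≤
      4 * (∫ x, (r x ^ 2 * (‖dz (1,0) (fun y => (η y : ℂ)) x‖ ^ 2 + ‖dz (0,1) (fun y => (η y : ℂ)) x‖ ^ 2)
        * (‖b1 x‖ ^ 2 + ‖b2 x‖ ^ 2))) + 3 * ∫ x, (η x ^ 2 * ‖d x‖ ^ 2 * (r x ^ 2 / om r φ x ^ 2)) := by
  set ηc : ℂ × ℂ → ℂ := fun x => (η x : ℂ) with hηc
  set W : ℂ × ℂ → ℂ := fun x => (om r φ x : ℂ) with hW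
  have Wne : ∀ x ∈ D, W x ≠ 0 := fun x hx => by
    simp only [hW]; exact_mod_cast (h.ompos hx).ne'
  have cW : ContDiffOn ℝ 2 W D := contOfReal h.contW
  have cWi : ContDiffOn ℝ 2 (fun x => (W x)⁻¹) D := cW.inv Wne
  have η0 : ∀ x, x ∉ D → ηc x = 0 := fun x hx => image_eq_zero_of_notMem_tsupport (fun h' => hx (hη.sub h'))
  -- basic functions
  set ζ : ℂ × ℂ → ℂ := fun x => Zw r φ x * ηc x with hζ
  have tζ : Tst D ζ := ⟨cut_contDiff h.op hη.cd hη.sub h.contZ, hη.cs.mul_left,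
    tsupport_mul_subset_right.trans hη.sub⟩
  have Wζ : ∀ x, W x * ζ x = (W x)⁻¹ * ηc x := fun x => by
    by_cases hx : x ∈ D
    · simp only [hζ]; rw [Zw_eq (h.rpos x hx)]
      have := Wne x hx
      change W x * (((W x)⁻¹) ^ 2 * _) = _
      field_simp
    · simp only [hζ]; rw [η0 x hx]; simp
  set ca : ℂ × ℂ → ℂ := fun x => (W x)⁻¹ * ηc x with hca
  have cca : Continuous ca := cut_continuous h.op hη.cd.continuous hη.sub cWi.continuousOn
  have sca : HasCompactSupport ca := hη.cs.mul_left
  set a : ℂ × ℂ → ℂ := fun x => ca x * b1 x with ha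
  set b : ℂ × ℂ → ℂ := fun x => ca x * b2 x with hb
  have ma : MemLp a 2 := memLp_cs_mul cca sca m1
  have mb : MemLp b 2 := memLp_cs_mul cca sca m2
  have cs : ∀ e, Continuous (fun x => (W x)⁻¹ * db e ηc x) := fun e =>
    cut_continuous h.op (continuous_db hη.cd1) (tsupport_db.trans hη.sub) cWi.continuousOn
  have scs : ∀ e, HasCompactSupport (fun x => (W x)⁻¹ * db e ηc x) := fun e => (hcs_db hη.cs).mul_left
  set s : ℂ × ℂ → ℂ := fun x => (W x)⁻¹ * db (1,0) ηc x * b2 x - (W x)⁻¹ * db (0,1) ηc x * b1 x with hs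
  have ms : MemLp s 2 := (memLp_cs_mul (cs _) (scs _) m2).sub (memLp_cs_mul (cs _) (scs _) m1)
  have ck : ∀ e, Continuous (fun x => W x * dz e ζ x) := fun e =>
    cut_continuous h.op (continuous_dz tζ.cd1) (tsupport_dz.trans tζ.sub) cW.continuousOn
  have sck : ∀ e, HasCompactSupport (fun x => W x * dz e ζ x) := fun e => (hcs_dz tζ.cs).mul_left
  set k : ℂ × ℂ → ℂ := fun x => W x * dz (1,0) ζ x * b1 x + W x * dz (0,1) ζ x * b2 x + ζ x * d x with hk
  have mk : MemLp k 2 := ((memLp_cs_mul (ck _) (sck _) m1).add (memLp_cs_mul (ck _) (sck _) m2)).add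
    ((tζ.cd.continuous.mul hd).memLp_of_hasCompactSupport tζ.cs.mul_right)
  have hac : HasCompactSupport a := sca.mul_right
  have hbc : HasCompactSupport b := sca.mul_right
  have hsc : HasCompactSupport s := HasCompactSupport.sub ((scs _).mul_right) ((scs _).mul_right)
  have hkc : HasCompactSupport k := HasCompactSupport.add (HasCompactSupport.add ((sck _).mul_right) ((sck _).mul_right)) tζ.cs.mul_right
  have H1 : ∀ g, ContDiff ℝ 2 g → HasCompactSupport g →
      ∫ x, (b x * db (1,0) g x - a x * db (0,1) g x) = - ∫ x, s x * g x := by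
    intro g hg hgc
    have hg1 : ContDiff ℝ 1 g := hg.of_le (by norm_num)
    have t := F1 _ (hη.mul_left hg)
    rw [eq_neg_iff_add_eq_zero, ← integral_add]
    · refine Eq.trans ?_ t
      congr 1; ext x
      have dη := hη.cd.contDiffAt (x := x) |>.differentiableAt (by norm_num)
      have dg := hg.contDiffAt (x := x) |>.differentiableAt (by norm_num)
      rw [db_mul dg dη, db_mul dg dη]
      simp only [ha, hb, hs, hca]
      ring
    · exact ii_sub (integrable_mul_cs (continuous_db hg1) (hcs_db hgc) mb)
        (integrable_mul_cs (continuous_db hg1) (hcs_db hgc) ma)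
    · exact integrable_mul_cs hg.continuous hgc ms
  have H2 : ∀ g, ContDiff ℝ 2 g → HasCompactSupport g →
      ∫ x, (a x * dz (1,0) g x + b x * dz (0,1) g x) = - ∫ x, k x * g x := by
    intro g hg hgc
    have hg1 : ContDiff ℝ 1 g := hg.of_le (by norm_num)
    have t := F2 _ (tζ.mul_left hg)
    have i1 : Integrable (fun x => a x * dz (1,0) g x + b x * dz (0,1) g x) :=
      ii_add (integrable_mul_cs (continuous_dz hg1) (hcs_dz hgc) ma)
        (integrable_mul_cs (continuous_dz hg1) (hcs_dz hgc) mb)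
    have i2 : Integrable (fun x => k x * g x) := integrable_mul_cs hg.continuous hgc mk
    have i3 : Integrable (fun x => d x * (g x * ζ x)) :=
      (hd.mul (hg.continuous.mul tζ.cd.continuous)).integrable_of_hasCompactSupport (hgc.mul_right.mul_left)
    rw [eq_neg_iff_add_eq_zero, ← integral_add i1 i2]
    have e : ∀ x, a x * dz (1,0) g x + b x * dz (0,1) g x + k x * g x =
      (b1 x * (W x * dz (1,0) (fun y => g y * ζ y) x) + b2 x * (W x * dz (0,1) (fun y => g y * ζ y) x))
        + d x * (g x * ζ x) := by
      intro x
      have dη := tζ.cd.contDiffAt (x := x) |>.differentiableAt (by norm_num)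
      have dg := hg.contDiffAt (x := x) |>.differentiableAt (by norm_num)
      rw [dz_mul dg dη, dz_mul dg dη]
      have w1 := Wζ x
      simp only [ha, hb, hk, hca]
      linear_combination (-(b1 x) * dz (1,0) g x - (b2 x) * dz (0,1) g x) * w1
    have i4 : Integrable (fun x => b1 x * (W x * dz (1,0) (fun y => g y * ζ y) x) + b2 x * (W x * dz (0,1) (fun y => g y * ζ y) x)) := by
      have := ii_sub (ii_add i1 i2) i3
      refine this.congr (Eventually.of_forall fun x => ?_)
      simp only [e x]; ring
    simp_rw [e]
    rw [integral_add i4 i3, t]; ring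
  -- localized weight
  set ψ : ℂ × ℂ → ℝ := fun x => φ x * θ x with hψ
  have cψ : ContDiff ℝ 2 ψ := by
    have := cut_contDiff h.op hθ.cd hθ.sub (contOfReal h.cφ)
    have h2 := Complex.reCLM.contDiff.comp this
    convert h2 using 1
    ext x; simp [hψ]
  have sψ : HasCompactSupport ψ := by
    have : HasCompactSupport θ := by
      have := hθ.cs.comp_left (g := Complex.re) (by simp)
      simpa [Function.comp_def] using this
    exact this.mul_left
  obtain ⟨i1, i2, hle⟩ := wmkh cψ sψ ma mb ms mk hac hbc hsc hkc H1 H2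
  have cr : ∀ e, Continuous (fun x => (r x : ℂ) * dz e ηc x) := fun e =>
    cut_continuous h.op (continuous_dz hη.cd1) (tsupport_dz.trans hη.sub) (contOfReal h.cr).continuousOn
  have scr : ∀ e, HasCompactSupport (fun x => (r x : ℂ) * dz e ηc x) := fun e => (hcs_dz hη.cs).mul_left
  have nr : ∀ x : ℝ, ‖(x:ℂ)‖ ^ 2 = x ^ 2 := fun x => by rw [Complex.norm_real, Real.norm_eq_abs, sq_abs]
  have j1 : Integrable (fun x => r x ^ 2 * (‖dz (1,0) ηc x‖ ^ 2 + ‖dz (0,1) ηc x‖ ^ 2)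
        * (‖b1 x‖ ^ 2 + ‖b2 x‖ ^ 2)) := by
    have q : ∀ e {f : ℂ × ℂ → ℂ}, MemLp f 2 → Integrable (fun x => ‖(r x : ℂ) * dz e ηc x * f x‖ ^ 2) := fun e f hf =>
      integrable_sq (memLp_cs_mul (cr e) (scr e) hf)
    refine (((q (1,0) m1).add (q (0,1) m1)).add ((q (1,0) m2).add (q (0,1) m2))).congr (Eventually.of_forall fun x => ?_)
    simp only [Pi.add_apply, norm_mul, mul_pow, nr]; ring
  have j3 : Integrable (fun x => η x ^ 2 * (‖b1 x‖ ^ 2 + ‖b2 x‖ ^ 2)) := by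
    have q : ∀ {f : ℂ × ℂ → ℂ}, MemLp f 2 → Integrable (fun x => ‖ηc x * f x‖ ^ 2) := fun hf =>
      integrable_sq (memLp_cs_mul hη.cd.continuous hη.cs hf)
    refine ((q m1).add (q m2)).congr (Eventually.of_forall fun x => ?_)
    simp only [Pi.add_apply, norm_mul, mul_pow, nr, hηc]; ring
  have j2 : Integrable (fun x => η x ^ 2 * ‖d x‖ ^ 2 * (r x ^ 2 / om r φ x ^ 2)) := by
    have c1 : Continuous (fun x => ((r x : ℂ) * (W x)⁻¹) * ηc x) :=
      cut_continuous h.op hη.cd.continuous hη.sub ((contOfReal h.cr).mul cWi).continuousOn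
    have m : MemLp (fun x => (((r x : ℂ) * (W x)⁻¹) * ηc x) * d x) 2 :=
      (c1.mul hd).memLp_of_hasCompactSupport hη.cs.mul_left.mul_right
    refine (integrable_sq m).congr (Eventually.of_forall fun x => ?_)
    simp only [norm_mul, mul_pow, nr, hηc, hW, norm_inv, inv_pow]
    ring
  have key := integral_mono (ii_sub i2 i1) (ii_sub (ii_add (j1.const_mul 4) (j2.const_mul 3)) j3) (fun x => ?_)
  · rw [integral_sub i2 i1, integral_sub (ii_add (j1.const_mul 4) (j2.const_mul 3)) j3,
      integral_add (j1.const_mul 4) (j2.const_mul 3), integral_const_mul, integral_const_mul] at key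
    linarith
  by_cases hx : x ∈ tsupport ηc
  · have hxD := hη.sub hx
    have ψe : ψ =ᶠ[𝓝 x] φ := by
      filter_upwards [hθ1 x hx] with y hy
      simp [hψ, hy]
    have ψc : (fun y => (ψ y : ℂ)) =ᶠ[𝓝 x] (fun y => (φ y : ℂ)) := by
      filter_upwards [ψe] with y hy; rw [hy]
    simp only [leviForm_congr ψe, dz_congr ψc, ψe.eq_of_nhds]
    have rp := h.rpos x hxD
    rw [om_sq rp]
    have Wn := Wne x hxD
    have rn : (r x : ℂ) ≠ 0 := by exact_mod_cast rp.ne'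
    have dη := hη.cd.contDiffAt (x := x) |>.differentiableAt (by norm_num)
    have dηr : DifferentiableAt ℝ η x := by
      have := Complex.reCLM.differentiableAt.comp x dη
      simpa [Function.comp_def, hηc] using this
    have dZ := (h.contZ.contDiffAt (h.op.mem_nhds hxD)).differentiableAt (by norm_num)
    have dzζ : ∀ e, dz e ζ x = ((W x)⁻¹) ^ 2 * (dz e ηc x + ηc x * (2 * dz e (fun y => (r y : ℂ)) x / r x + dz e (fun y => (φ y : ℂ)) x)) := by
      intro e
      rw [hζ, dz_mul dZ dη, dz_Zw h hxD, Zw_eq rp]; ring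
    have ek : k x + ((-dz (1,0) (fun y => (φ y : ℂ)) x) * a x
        + (-dz (0,1) (fun y => (φ y : ℂ)) x) * b x) =
        (W x)⁻¹ * (dz (1,0) ηc x * b1 x + dz (0,1) ηc x * b2 x) + 2 * (W x)⁻¹ * η x *
        (dz (1,0) (fun y => (r y : ℂ)) x * b1 x + dz (0,1) (fun y => (r y : ℂ)) x * b2 x) / r x
        + η x * d x * ((W x)⁻¹) ^ 2 := by
      have zx : ζ x = ((W x)⁻¹) ^ 2 * η x := by simp only [hζ, Zw_eq rp, hηc, hW]
      have ee : ηc x = η x := rfl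
      simp only [hk, ha, hb, hca, dzζ, zx, ee]
      field_simp
      ring
    have es : s x = (W x)⁻¹ * (db (1,0) ηc x * b2 x + (- db (0,1) ηc x) * b1 x) := by
      simp only [hs]; ring
    rw [ek, es]
    refine num_main (h.ompos hxD) rp (N := ‖dz (1,0) ηc x‖ ^ 2 + ‖dz (0,1) ηc x‖ ^ 2)
      (B := ‖b1 x‖ ^ 2 + ‖b2 x‖ ^ 2) (num_cs _ _ _ _) ?_ ?_ |>.trans (le_of_eq (by ring))
    · refine (num_cs _ _ _ _).trans (le_of_eq ?_)
      rw [norm_neg, norm_db_real dηr, norm_db_real dηr]; ring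
    · refine le_trans (le_of_eq ?_) (h.lev x hxD (a x) (b x))
      have e1 : dz (1,0) (fun y => (r y : ℂ)) x * a x + dz (0,1) (fun y => (r y : ℂ)) x * b x =
        (W x)⁻¹ * η x * (dz (1,0) (fun y => (r y : ℂ)) x * b1 x + dz (0,1) (fun y => (r y : ℂ)) x * b2 x) := by
        simp only [ha, hb, hca, hηc]; ring
      rw [e1]
      have e2 : η x ^ 2 * (om r φ x)⁻¹ ^ 2 * (‖b1 x‖ ^ 2 + ‖b2 x‖ ^ 2) = ‖a x‖ ^ 2 + ‖b x‖ ^ 2 := by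
        simp only [ha, hb, hca, hηc, hW, norm_mul, mul_pow, nr, norm_inv, inv_pow]; ring
      rw [e2]
  · have z1 := fun e => dz_eq_zero_of_notMem (e := e) hx
    have z2 := fun e => db_eq_zero_of_notMem (e := e) hx
    have z0 : ηc x = 0 := image_eq_zero_of_notMem_tsupport hx
    have z0' : η x = 0 := by simpa [hηc] using z0
    have zz : x ∉ tsupport ζ := fun h' => hx (tsupport_mul_subset_right h')
    have z3 := fun e => dz_eq_zero_of_notMem (e := e) zz
    have z4 : ζ x = 0 := image_eq_zero_of_notMem_tsupport zz
    have a0 : a x = 0 := by simp [ha, hca, z0]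
    have b0 : b x = 0 := by simp [hb, hca, z0]
    have s0 : s x = 0 := by simp [hs, z2]
    have k0 : k x = 0 := by simp [hk, z3, z4]
    simp [a0, b0, s0, k0, z1, z0', leviForm]

end

section
open Complex
open MeasureTheory ComplexConjugate
open Filter Topology
open scoped ENNReal

open Classical in
/-- cut-off functions exhausting `D` -/
def cutf (D : Set (ℂ × ℂ)) (r : ℂ × ℂ → ℝ) (ν : ℝ) (x : ℂ × ℂ) : ℝ :=
  if x ∈ D then Real.smoothTransition (ν * r x - 1) else 0

lemma cutf_zero {D r φ} (h : Dat D r φ) {ν : ℝ} (hν : 0 < ν) {x} (hx : x ∉ {x | x ∈ D ∧ 1 / ν ≤ r x}) :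
    cutf D r ν x = 0 := by
  unfold cutf
  split_ifs with hD
  · apply Real.smoothTransition.zero_of_nonpos
    simp only [Set.mem_setOf_eq, not_and, not_le] at hx
    have := hx hD
    rw [lt_div_iff₀ hν] at this
    linarith
  · rfl

lemma cutf_tsupport {D r φ} (h : Dat D r φ) {ν : ℝ} (hν : 0 < ν) :
    tsupport (fun x => (cutf D r ν x : ℂ)) ⊆ {x | x ∈ D ∧ 1 / ν ≤ r x} := by
  apply closure_minimal
  · intro x hx
    by_contra h'
    apply hx
    simp [cutf_zero h hν h']
  · exact (h.cpt _ (by positivity)).isClosed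

lemma cutf_eventually {D r φ} (h : Dat D r φ) (ν : ℝ) {x} (hx : x ∈ D) :
    cutf D r ν =ᶠ[𝓝 x] fun y => Real.smoothTransition (ν * r y - 1) := by
  filter_upwards [h.op.mem_nhds hx] with y hy
  simp [cutf, hy]

lemma cutf_Tst {D r φ} (h : Dat D r φ) {ν : ℝ} (hν : 0 < ν) : Tst D (fun x => (cutf D r ν x : ℂ)) := by
  have hts := cutf_tsupport h hν
  refine ⟨?_, ?_, fun x hx => (hts hx).1⟩
  · apply contDiff_ofReal
    rw [contDiff_iff_contDiffAt]
    intro x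
    by_cases hx : x ∈ {x | x ∈ D ∧ 1 / ν ≤ r x}
    · refine ContDiffAt.congr_of_eventuallyEq ?_ (cutf_eventually h ν hx.1)
      have hr := h.cr.contDiffAt (h.op.mem_nhds hx.1)
      exact Real.smoothTransition.contDiff.contDiffAt.comp x ((contDiffAt_const.mul hr).sub contDiffAt_const)
    · have : cutf D r ν =ᶠ[𝓝 x] fun _ => 0 := by
        filter_upwards [(h.cpt (1 / ν) (by positivity)).isClosed.isOpen_compl.mem_nhds hx] with y hy
        exact cutf_zero h hν hy
      exact contDiffAt_const.congr_of_eventuallyEq this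
  · exact (h.cpt (1 / ν) (by positivity)).of_isClosed_subset (isClosed_tsupport _) hts

lemma cutf_one {D r φ} (h : Dat D r φ) {ν : ℝ} (hν : 0 < ν) {x}
    (hx : x ∈ tsupport (fun x => (cutf D r ν x : ℂ))) : cutf D r (4 * ν) =ᶠ[𝓝 x] 1 := by
  have h1 := cutf_tsupport h hν hx
  have hr := (h.cr.contDiffAt (h.op.mem_nhds h1.1)).continuousAt
  have : ∀ᶠ y in 𝓝 x, 1 / (2 * ν) < r y := by
    apply hr.eventually_const_lt
    refine lt_of_lt_of_le ?_ h1.2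
    apply one_div_lt_one_div_of_lt hν; linarith
  filter_upwards [this, cutf_eventually h (4 * ν) h1.1] with y hy h2
  rw [h2]
  apply Real.smoothTransition.one_of_one_le
  rw [div_lt_iff₀ (by positivity)] at hy
  linarith

lemma dz_comp_real {g : ℝ → ℝ} {r : ℂ × ℂ → ℝ} {x e} (hg : DifferentiableAt ℝ g (r x)) (hr : DifferentiableAt ℝ r x) :
    dz e (fun y => ((g (r y) : ℝ) : ℂ)) x = ((deriv g (r x) : ℝ) : ℂ) * dz e (fun y => (r y : ℂ)) x := by
  have h1 : HasFDerivAt (fun y => ((g (r y) : ℝ) : ℂ)) (ofRealCLM.comp (deriv g (r x) • fderiv ℝ r x)) x :=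
    ofRealCLM.hasFDerivAt.comp x (hg.hasDerivAt.comp_hasFDerivAt x hr.hasFDerivAt)
  have h2 : HasFDerivAt (fun y => (r y : ℂ)) (ofRealCLM.comp (fderiv ℝ r x)) x :=
    ofRealCLM.hasFDerivAt.comp x hr.hasFDerivAt
  simp only [dz, h1.fderiv, h2.fderiv]
  simp
  ring

lemma st_deriv_zero {t : ℝ} (ht : t < 0 ∨ 1 < t) : deriv Real.smoothTransition t = 0 := by
  rcases ht with ht | ht
  · have : Real.smoothTransition =ᶠ[𝓝 t] fun _ => 0 := by
      filter_upwards [Iio_mem_nhds ht] with s hs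
      exact Real.smoothTransition.zero_of_nonpos (le_of_lt hs)
    rw [this.deriv_eq]; simp
  · have : Real.smoothTransition =ᶠ[𝓝 t] fun _ => 1 := by
      filter_upwards [Ioi_mem_nhds ht] with s hs
      exact Real.smoothTransition.one_of_one_le (le_of_lt hs)
    rw [this.deriv_eq]; simp

lemma st_deriv_bdd : ∃ C, ∀ t, |deriv Real.smoothTransition t| ≤ C := by
  have hc : Continuous (deriv Real.smoothTransition) :=
    Real.smoothTransition.contDiff.continuous_deriv (n := 1) (by norm_num)
  obtain ⟨C, hC⟩ := isCompact_Icc (a := (0:ℝ)) (b := 1) |>.exists_bound_of_continuousOn hc.continuousOn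
  refine ⟨max C 0, fun t => ?_⟩
  by_cases ht : t ∈ Set.Icc (0:ℝ) 1
  · exact (hC t ht).trans (le_max_left _ _)
  · rw [st_deriv_zero]
    · simp
    · simp only [Set.mem_Icc, not_and_or, not_le] at ht; exact ht

lemma dz_cutf {D r φ} (h : Dat D r φ) (ν : ℝ) {x} (hx : x ∈ D) (e) :
    dz e (fun x => (cutf D r ν x : ℂ)) x = ((deriv Real.smoothTransition (ν * r x - 1) * ν : ℝ) : ℂ) * dz e (fun y => (r y : ℂ)) x := by
  have e1 : (fun x => (cutf D r ν x : ℂ)) =ᶠ[𝓝 x] fun y => ((Real.smoothTransition (ν * r y - 1) : ℝ) : ℂ) := by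
    filter_upwards [cutf_eventually h ν hx] with y hy
    rw [hy]
  have hr := (h.cr.contDiffAt (h.op.mem_nhds hx)).differentiableAt (by norm_num)
  have hst : Differentiable ℝ Real.smoothTransition :=
    (Real.smoothTransition.contDiff (n := 1)).differentiable (by norm_num)
  rw [dz_congr e1, dz_comp_real (g := fun t => Real.smoothTransition (ν * t - 1)) (by fun_prop) hr]
  congr 2
  have h1 : HasDerivAt (fun t : ℝ => ν * t - 1) ν (r x) := by
    simpa using ((hasDerivAt_id (r x)).const_mul ν).sub_const 1
  exact ((hst _).hasDerivAt.comp (r x) h1).deriv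

lemma lemC {D r φ} (h : Dat D r φ) {b1 b2 d : ℂ × ℂ → ℂ}
    (m1 : MemLp b1 2) (m2 : MemLp b2 2) (hd : Continuous d) (hdc : HasCompactSupport d) (hds : tsupport d ⊆ D)
    (F1 : ∀ g, Tst D g → ∫ x, (b2 x * ((om r φ x : ℂ)⁻¹ * db (1,0) g x) - b1 x * ((om r φ x : ℂ)⁻¹ * db (0,1) g x)) = 0)
    (F2 : ∀ h, Tst D h → ∫ x, (b1 x * ((om r φ x : ℂ) * dz (1,0) h x) + b2 x * ((om r φ x : ℂ) * dz (0,1) h x)) =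
        - ∫ x, d x * h x) :
    ∫ x in D, (‖b1 x‖ ^ 2 + ‖b2 x‖ ^ 2) ≤ 3 * ∫ x, ‖d x‖ ^ 2 * (r x ^ 2 / om r φ x ^ 2) := by
  have nr : ∀ x : ℝ, ‖(x:ℂ)‖ ^ 2 = x ^ 2 := fun x => by rw [Complex.norm_real, Real.norm_eq_abs, sq_abs]
  obtain ⟨C, hC⟩ := st_deriv_bdd
  obtain ⟨B0, hB0⟩ := h.bdd
  set B := max B0 0
  have hB : ∀ x ∈ D, ‖dz (1,0) (fun y => (r y : ℂ)) x‖ ^ 2 + ‖dz (0,1) (fun y => (r y : ℂ)) x‖ ^ 2 ≤ B :=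
    fun x hx => (hB0 x hx).trans (le_max_left _ _)
  have Bnn : 0 ≤ B := le_max_right _ _
  have mono : ∀ n : ℕ, ∫ x, cutf D r (n+1) x ^ 2 * (‖b1 x‖ ^ 2 + ‖b2 x‖ ^ 2) ≤
      4 * (∫ x, (r x ^ 2 * (‖dz (1,0) (fun y => (cutf D r (n+1) y : ℂ)) x‖ ^ 2 + ‖dz (0,1) (fun y => (cutf D r (n+1) y : ℂ)) x‖ ^ 2)
        * (‖b1 x‖ ^ 2 + ‖b2 x‖ ^ 2))) + 3 * ∫ x, (‖d x‖ ^ 2 * (r x ^ 2 / om r φ x ^ 2)) := by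
    intro n
    have hn : (0:ℝ) < n + 1 := by positivity
    have hη := cutf_Tst h hn
    refine (lemB h hη (cutf_Tst h (ν := 4 * (n+1)) (by positivity))
      (fun x hx => cutf_one h hn hx) m1 m2 hd F1 F2).trans ?_
    gcongr 4 * _ + 3 * ?_
    have cWi : ContinuousOn (fun x => (r x : ℂ) * (om r φ x : ℂ)⁻¹) D :=
      ((contOfReal h.cr).mul ((contOfReal h.contW).inv (fun x hx => by exact_mod_cast (h.ompos hx).ne'))).continuousOn
    have m : MemLp (fun x => ((r x : ℂ) * (om r φ x : ℂ)⁻¹) * d x) 2 := cut_memLp h.op hd hdc hds cWi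
    refine integral_mono_of_nonneg (Eventually.of_forall fun x => by simp only [Pi.zero_apply]; positivity) ?_ (Eventually.of_forall fun x => ?_)
    · refine (integrable_sq m).congr (Eventually.of_forall fun x => ?_)
      simp only [norm_mul, mul_pow, nr, norm_inv, inv_pow]
      ring
    · have : cutf D r (n+1) x ^ 2 ≤ 1 := by
        unfold cutf; split_ifs
        · have h0 := Real.smoothTransition.nonneg ((n+1) * r x - 1)
          have h1 := Real.smoothTransition.le_one ((n+1) * r x - 1)
          nlinarith
        · simp
      simp only
      rw [mul_assoc]
      exact mul_le_of_le_one_left (by positivity) this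
  have iB : Integrable (fun x => ‖b1 x‖ ^ 2 + ‖b2 x‖ ^ 2) := ii_add (integrable_sq m1) (integrable_sq m2)
  have hinf : ∀ x ∈ D, ∀ᶠ n : ℕ in atTop, 1 < ((n:ℝ)+1) * r x - 1 := by
    intro x hx
    have hr := h.rpos x hx
    obtain ⟨N, hN⟩ := exists_nat_gt (2 / r x)
    filter_upwards [eventually_ge_atTop N] with n hn
    have : (N:ℝ) ≤ n := by exact_mod_cast hn
    rw [div_lt_iff₀ hr] at hN
    nlinarith
  have L1 : Tendsto (fun n : ℕ => ∫ x, cutf D r (n+1) x ^ 2 * (‖b1 x‖ ^ 2 + ‖b2 x‖ ^ 2)) atTop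
      (𝓝 (∫ x, D.indicator (fun x => ‖b1 x‖ ^ 2 + ‖b2 x‖ ^ 2) x)) := by
    apply tendsto_integral_of_dominated_convergence (fun x => ‖b1 x‖ ^ 2 + ‖b2 x‖ ^ 2)
    · intro n
      have hη := cutf_Tst h (ν := n + 1) (by positivity)
      have : Continuous (fun x => ‖(cutf D r (n+1) x : ℂ)‖ ^ 2) := hη.cd.continuous.norm.pow 2
      simp only [nr] at this
      exact this.aestronglyMeasurable.mul iB.aestronglyMeasurable
    · exact iB
    · intro n
      refine Eventually.of_forall fun x => ?_
      rw [Real.norm_of_nonneg (by positivity)]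
      refine mul_le_of_le_one_left (by positivity) ?_
      unfold cutf; split_ifs
      · have h0 := Real.smoothTransition.nonneg (((n:ℝ)+1) * r x - 1)
        have h1 := Real.smoothTransition.le_one (((n:ℝ)+1) * r x - 1)
        nlinarith
      · simp
    · refine Eventually.of_forall fun x => ?_
      by_cases hx : x ∈ D
      · apply tendsto_const_nhds.congr'
        filter_upwards [hinf x hx] with n hn
        simp [cutf, hx, Real.smoothTransition.one_of_one_le hn.le]
      · simp [cutf, hx]
  have L2 : Tendsto (fun n : ℕ => ∫ x, (r x ^ 2 * (‖dz (1,0) (fun y => (cutf D r (n+1) y : ℂ)) x‖ ^ 2 + ‖dz (0,1) (fun y => (cutf D r (n+1) y : ℂ)) x‖ ^ 2)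
        * (‖b1 x‖ ^ 2 + ‖b2 x‖ ^ 2))) atTop (𝓝 (∫ x : ℂ × ℂ, 0)) := by
    apply tendsto_integral_of_dominated_convergence (fun x => (4 * C ^ 2 * B) * (‖b1 x‖ ^ 2 + ‖b2 x‖ ^ 2))
    · intro n
      have hη := cutf_Tst h (ν := n + 1) (by positivity)
      have cr : ∀ e, Continuous (fun x => (r x : ℂ) * dz e (fun y => (cutf D r (n+1) y : ℂ)) x) := fun e =>
        cut_continuous h.op (continuous_dz hη.cd1) (tsupport_dz.trans hη.sub) (contOfReal h.cr).continuousOn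
      have : Continuous (fun x => ‖(r x : ℂ) * dz (1,0) (fun y => (cutf D r (n+1) y : ℂ)) x‖ ^ 2
        + ‖(r x : ℂ) * dz (0,1) (fun y => (cutf D r (n+1) y : ℂ)) x‖ ^ 2) :=
        ((cr (1,0)).norm.pow 2).add ((cr (0,1)).norm.pow 2)
      simp only [norm_mul, mul_pow, nr, ← mul_add] at this
      exact this.aestronglyMeasurable.mul iB.aestronglyMeasurable
    · exact iB.const_mul _
    · intro n
      refine Eventually.of_forall fun x => ?_
      rw [Real.norm_of_nonneg (by positivity)]
      refine mul_le_mul_of_nonneg_right ?_ (by positivity)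
      by_cases hx : x ∈ D
      · rw [dz_cutf h _ hx, dz_cutf h _ hx]
        simp only [norm_mul, mul_pow, nr, ← mul_add]
        have hb := hB x hx
        have hr := h.rpos x hx
        have hp : 0 ≤ B := le_trans (by positivity) hb
        have : (deriv Real.smoothTransition (((n:ℝ)+1) * r x - 1)) ^ 2 * ((((n:ℝ)+1) * r x) ^ 2) ≤ C ^ 2 * 4 := by
          by_cases ht : ((n:ℝ)+1) * r x - 1 < 0 ∨ 1 < ((n:ℝ)+1) * r x - 1
          · rw [st_deriv_zero ht]; simp; positivity
          · push Not at ht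
            have a1 : (deriv Real.smoothTransition (((n:ℝ)+1) * r x - 1)) ^ 2 ≤ C ^ 2 := by
              rw [← sq_abs]; gcongr; exact hC _
            have a2 : (((n:ℝ)+1) * r x) ^ 2 ≤ 4 := by nlinarith
            gcongr
        calc _ = ((deriv Real.smoothTransition (((n:ℝ)+1) * r x - 1)) ^ 2 * ((((n:ℝ)+1) * r x) ^ 2)) * (‖dz (1,0) (fun y => (r y : ℂ)) x‖ ^ 2 + ‖dz (0,1) (fun y => (r y : ℂ)) x‖ ^ 2) := by ring
          _ ≤ (C ^ 2 * 4) * B := by gcongr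
          _ = _ := by ring
      · have z : ∀ e, dz e (fun y => (cutf D r (n+1) y : ℂ)) x = 0 := fun e =>
          dz_eq_zero_of_notMem (fun h' => hx ((cutf_Tst h (ν := n + 1) (by positivity)).sub h'))
        simp only [z]
        simp
        positivity
    · refine Eventually.of_forall fun x => ?_
      apply tendsto_const_nhds.congr'
      by_cases hx : x ∈ D
      · filter_upwards [hinf x hx] with n hn
        rw [dz_cutf h _ hx, dz_cutf h _ hx, st_deriv_zero (Or.inr hn)]
        simp
      · refine Eventually.of_forall fun n => ?_
        have z : ∀ e, dz e (fun y => (cutf D r (n+1) y : ℂ)) x = 0 := fun e =>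
          dz_eq_zero_of_notMem (fun h' => hx ((cutf_Tst h (ν := n + 1) (by positivity)).sub h'))
        simp [z]
  have := le_of_tendsto_of_tendsto' L1 ((L2.const_mul 4).add_const _) mono
  rw [integral_indicator h.op.measurableSet] at this
  simpa using this

end

section
open Complex
open MeasureTheory ComplexConjugate
open Filter Topology
open scoped ENNReal

lemma riesz_abs {E H : Type*} [AddCommGroup E] [Module ℂ E] [NormedAddCommGroup H] [InnerProductSpace ℂ H]
    [CompleteSpace H] (T : E →ₗ[ℂ] H) (l : E →ₗ[ℂ] ℂ) (C : ℝ) (hC : 0 ≤ C) (hl : ∀ x, ‖l x‖ ≤ C * ‖T x‖) :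
    ∃ v : H, ‖v‖ ≤ C ∧ ∀ x, inner ℂ v (T x) = l x := by
  have hk : LinearMap.ker T ≤ LinearMap.ker l := by
    intro x hx
    rw [LinearMap.mem_ker] at hx ⊢
    have := hl x
    rw [hx] at this
    simpa using this
  let f0 : LinearMap.range T →ₗ[ℂ] ℂ := ((LinearMap.ker T).liftQ l hk).comp T.quotKerEquivRange.symm.toLinearMap
  have f0e : ∀ x, f0 ⟨T x, x, rfl⟩ = l x := by
    intro x
    have : T.quotKerEquivRange.symm ⟨T x, x, rfl⟩ = (LinearMap.ker T).mkQ x := by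
      rw [LinearEquiv.symm_apply_eq]
      rfl
    simp only [f0, LinearMap.comp_apply, LinearEquiv.coe_coe, this]
    simp
  let f : LinearMap.range T →L[ℂ] ℂ := f0.mkContinuous C (by
    rintro ⟨_, x, rfl⟩
    rw [f0e]; exact hl x)
  obtain ⟨g, hg1, hg2⟩ := exists_extension_norm_eq (LinearMap.range T) f
  refine ⟨(InnerProductSpace.toDual ℂ H).symm g, ?_, fun x => ?_⟩
  · rw [LinearIsometryEquiv.norm_map, hg2]
    exact LinearMap.mkContinuous_norm_le _ hC _
  · rw [InnerProductSpace.toDual_symm_apply]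
    have := hg1 ⟨T x, x, rfl⟩
    exact this.trans (f0e x)

lemma Tst.add {D f g} (hf : Tst D f) (hg : Tst D g) : Tst D (fun x => f x + g x) where
  cd := hf.cd.add hg.cd
  cs := hf.cs.add hg.cs
  sub := (tsupport_add f g).trans (Set.union_subset hf.sub hg.sub)

lemma Tst.zero {D} : Tst D (fun _ => 0) where
  cd := contDiff_const
  cs := HasCompactSupport.zero
  sub := by
    have : tsupport (fun _ : ℂ × ℂ => (0:ℂ)) = ∅ := by simp [tsupport, Function.support_fun_zero]
    rw [this]; simp

lemma Tst.diff {D f} (hf : Tst D f) (x) : DifferentiableAt ℝ f x := hf.cd.contDiffAt.differentiableAt (by norm_num)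

/-- pairs of test functions -/
def TT (D : Set (ℂ × ℂ)) : Submodule ℂ ((ℂ × ℂ → ℂ) × (ℂ × ℂ → ℂ)) where
  carrier := {p | Tst D p.1 ∧ Tst D p.2}
  add_mem' h1 h2 := ⟨h1.1.add h2.1, h1.2.add h2.2⟩
  zero_mem' := ⟨Tst.zero, Tst.zero⟩
  smul_mem' c p hp := ⟨hp.1.mul_left contDiff_const, hp.2.mul_left contDiff_const⟩

/-- divergence -/
def dv (p : (ℂ × ℂ → ℂ) × (ℂ × ℂ → ℂ)) (x : ℂ × ℂ) : ℂ := dz (1,0) p.1 x + dz (0,1) p.2 x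

lemma dz_smul {D f} (hf : Tst D f) (c : ℂ) (e x) : dz e (c • f) x = c * dz e f x := by
  have : c • f = fun y => (fun _ => c) y * f y := rfl
  rw [this, dz_mul (differentiableAt_const c) (hf.diff x)]
  simp [dz]

lemma dv_add {D} (p q : TT D) (x) : dv (p + q : TT D).1 x = dv p x + dv q x := by
  have e := fun e => dz_add (e := e) (p.2.1.diff x) (q.2.1.diff x)
  have e' := fun e => dz_add (e := e) (p.2.2.diff x) (q.2.2.diff x)
  unfold dv
  have h1 : (p + q : TT D).1.1 = fun y => p.1.1 y + q.1.1 y := rfl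
  have h2 : (p + q : TT D).1.2 = fun y => p.1.2 y + q.1.2 y := rfl
  rw [h1, h2, e, e']; ring

lemma dv_smul {D} (c : ℂ) (p : TT D) (x) : dv (c • p : TT D).1 x = c * dv p x := by
  unfold dv
  have h1 : (c • p : TT D).1.1 = c • p.1.1 := rfl
  have h2 : (c • p : TT D).1.2 = c • p.1.2 := rfl
  rw [h1, h2, dz_smul p.2.1, dz_smul p.2.2]; ring

lemma dv_cont {D} (p : TT D) : Continuous (dv p) := (continuous_dz p.2.1.cd1).add (continuous_dz p.2.2.cd1)
lemma dv_cs {D} (p : TT D) : HasCompactSupport (dv p) := (hcs_dz p.2.1.cs).add (hcs_dz p.2.2.cs)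
lemma dv_sub {D} (p : TT D) : tsupport (dv p) ⊆ D :=
  (tsupport_add _ _).trans (Set.union_subset (tsupport_dz.trans p.2.1.sub) (tsupport_dz.trans p.2.2.sub))

lemma normsq_HH {f g : ℂ × ℂ → ℂ} (hf : MemLp f 2) (hg : MemLp g 2) :
    ‖mkHH hf hg‖ ^ 2 = ∫ x, (‖f x‖ ^ 2 + ‖g x‖ ^ 2) := by
  have h := inner_HH hf hg hf hg
  rw [inner_self_eq_norm_sq_to_K] at h
  have : (fun x => f x * conj (f x) + g x * conj (g x)) = fun x => ((‖f x‖ ^ 2 + ‖g x‖ ^ 2 : ℝ) : ℂ) := by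
    ext x; rw [Complex.mul_conj, Complex.mul_conj, Complex.normSq_eq_norm_sq, Complex.normSq_eq_norm_sq]; push_cast; rfl
  rw [this, integral_complex_ofReal] at h
  exact Complex.ofReal_injective ((Complex.ofReal_pow _ _).trans h)

lemma normsq_Lp {f : ℂ × ℂ → ℂ} (hf : MemLp f 2) : ‖hf.toLp f‖ ^ 2 = ∫ x, ‖f x‖ ^ 2 := by
  have h := inner_toLp hf hf
  rw [inner_self_eq_norm_sq_to_K] at h
  have : (fun x => f x * conj (f x)) = fun x => ((‖f x‖ ^ 2 : ℝ) : ℂ) := by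
    ext x; rw [Complex.mul_conj, Complex.normSq_eq_norm_sq]
  rw [this, integral_complex_ofReal] at h
  exact Complex.ofReal_injective ((Complex.ofReal_pow _ _).trans h)

lemma l2core {D r φ} (h : Dat D r φ) {χ : ℂ × ℂ → ℂ} (hχ : Tst D χ) :
    ∃ v : ℂ × ℂ → ℂ, MemLp v 2 ∧
      ∫ x, ‖v x‖ ^ 2 ≤ 3 * ∫ x, om r φ x ^ 2 * (‖db (1,0) χ x‖ ^ 2 + ‖db (0,1) χ x‖ ^ 2) ∧
      ∀ g, Tst D g → (∫ x, χ x * db (1,0) g x = ∫ x, ((r x / om r φ x : ℝ) : ℂ) * v x * db (1,0) g x) ∧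
        (∫ x, χ x * db (0,1) g x = ∫ x, ((r x / om r φ x : ℝ) : ℂ) * v x * db (0,1) g x) := by
  have nr : ∀ x : ℝ, ‖(x:ℂ)‖ ^ 2 = x ^ 2 := fun x => by rw [Complex.norm_real, Real.norm_eq_abs, sq_abs]
  set q : ℂ × ℂ → ℂ := fun x => ((r x / om r φ x : ℝ) : ℂ) with hq
  have cq : ContinuousOn q D := (contOfReal (h.cr.div h.contW (fun x hx => (h.ompos hx).ne'))).continuousOn
  have cW : ContinuousOn (fun x => (om r φ x : ℂ)) D := (contOfReal h.contW).continuousOn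
  have mT : ∀ p : TT D, MemLp (fun x => q x * dv p x) 2 := fun p => cut_memLp h.op (dv_cont p) (dv_cs p) (dv_sub p) cq
  let T : TT D →ₗ[ℂ] Lp ℂ 2 (volume : Measure (ℂ × ℂ)) :=
    { toFun := fun p => (mT p).toLp _
      map_add' := fun p p' => by
        rw [← MemLp.toLp_add]
        congr 1; ext x; simp only [Pi.add_apply, dv_add]; ring
      map_smul' := fun c p => by
        rw [RingHom.id_apply, ← MemLp.toLp_const_smul]
        congr 1; ext x; simp only [Pi.smul_apply, dv_smul, smul_eq_mul]; ring }
  have il : ∀ p : TT D, Integrable (fun x => conj (χ x) * dv p x) := fun p =>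
    (hχ.conj.cd.continuous.mul (dv_cont p)).integrable_of_hasCompactSupport (dv_cs p).mul_left
  let l : TT D →ₗ[ℂ] ℂ :=
    { toFun := fun p => ∫ x, conj (χ x) * dv p x
      map_add' := fun p p' => by
        rw [← integral_add (il p) (il p')]
        congr 1; ext x; rw [dv_add]; ring
      map_smul' := fun c p => by
        rw [RingHom.id_apply, smul_eq_mul, ← integral_const_mul]
        congr 1; ext x; rw [dv_smul]; ring }
  set A := 3 * ∫ x, om r φ x ^ 2 * (‖db (1,0) χ x‖ ^ 2 + ‖db (0,1) χ x‖ ^ 2) with hA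
  have A0 : 0 ≤ A := by
    rw [hA]; exact mul_nonneg (by norm_num) (integral_nonneg fun x => by positivity)
  have hl : ∀ p, ‖l p‖ ≤ Real.sqrt A * ‖T p‖ := by
    intro p
    obtain ⟨b1, b2, m1, m2, F1, F2⟩ := hilb h.op h.contW.continuousOn (fun x hx => h.ompos hx) p.2.1 p.2.2
    have F2' : ∀ g, Tst D g → ∫ x, (b1 x * ((om r φ x : ℂ) * dz (1,0) g x) + b2 x * ((om r φ x : ℂ) * dz (0,1) g x)) =
        - ∫ x, dv p x * g x := by
      intro g hg
      rw [F2 g hg]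
      have I : ∀ {f e}, Tst D f → Integrable (fun x => f x * dz e g x) := fun hf =>
        (hf.cd.continuous.mul (continuous_dz hg.cd1)).integrable_of_hasCompactSupport hf.cs.mul_right
      have I' : ∀ {f e}, Tst D f → Integrable (fun x => dz e f x * g x) := fun hf =>
        ((continuous_dz hf.cd1).mul hg.cd.continuous).integrable_of_hasCompactSupport hg.cs.mul_left
      rw [integral_add (I p.2.1) (I p.2.2), ibp_dz p.2.1.cd1 hg.cd1 p.2.1.cs, ibp_dz p.2.2.cd1 hg.cd1 p.2.2.cs]
      simp only [dv, add_mul]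
      rw [integral_add (I' p.2.1) (I' p.2.2)]; ring
    have C := lemC h m1 m2 (dv_cont p) (dv_cs p) (dv_sub p) F1 F2'
    have m1' := m1.indicator h.op.measurableSet
    have m2' := m2.indicator h.op.measurableSet
    have hc := hχ.conj
    have u1 : MemLp (fun x => conj ((om r φ x : ℂ) * dz (1,0) (fun y => conj (χ y)) x)) 2 := (hc.memLp_dz h.op (1,0) cW).star
    have u2 : MemLp (fun x => conj ((om r φ x : ℂ) * dz (0,1) (fun y => conj (χ y)) x)) 2 := (hc.memLp_dz h.op (0,1) cW).star
    have e1 : l p = - inner ℂ (mkHH u1 u2) (mkHH m1' m2') := by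
      rw [inner_HH, eq_neg_iff_add_eq_zero]
      have := F2' _ hc
      rw [eq_neg_iff_add_eq_zero, add_comm] at this
      refine Eq.trans ?_ this
      congr 1
      · simp only [l, LinearMap.coe_mk, AddHom.coe_mk]
        congr 1; ext x; ring
      · congr 1; ext x
        by_cases hx : x ∈ D
        · simp [hx]
        · have z : ∀ e, dz e (fun y => conj (χ y)) x = 0 := fun e =>
            dz_eq_zero_of_notMem (fun h' => hx (hc.sub h'))
          simp [z]
    have e2 : ‖mkHH m1' m2'‖ ^ 2 = ∫ x in D, (‖b1 x‖ ^ 2 + ‖b2 x‖ ^ 2) := by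
      rw [normsq_HH, ← integral_indicator h.op.measurableSet]
      congr 1; ext x
      by_cases hx : x ∈ D <;> simp [hx]
    have e3 : ‖mkHH u1 u2‖ ^ 2 = ∫ x, om r φ x ^ 2 * (‖db (1,0) χ x‖ ^ 2 + ‖db (0,1) χ x‖ ^ 2) := by
      rw [normsq_HH]
      congr 1; ext x
      have z : ∀ e, dz e (fun y => conj (χ y)) x = conj (db e χ x) := fun e => dz_conj (hχ.diff x)
      simp only [z, RCLike.norm_conj, norm_mul, mul_pow, nr]
      ring
    have e4 : ‖T p‖ ^ 2 = ∫ x, ‖dv p x‖ ^ 2 * (r x ^ 2 / om r φ x ^ 2) := by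
      simp only [T, LinearMap.coe_mk, AddHom.coe_mk]
      rw [normsq_Lp]
      congr 1; ext x
      simp only [norm_mul, mul_pow, hq, nr, div_pow]; ring
    rw [e1, norm_neg]
    refine (norm_inner_le_norm _ _).trans ?_
    apply le_of_sq_le_sq _ (by positivity)
    rw [mul_pow, mul_pow, Real.sq_sqrt A0, e2, e3, e4, hA]
    have : 0 ≤ ∫ x, om r φ x ^ 2 * (‖db (1,0) χ x‖ ^ 2 + ‖db (0,1) χ x‖ ^ 2) := integral_nonneg fun x => by positivity
    nlinarith
  obtain ⟨v0, hv1, hv2⟩ := riesz_abs T l _ (Real.sqrt_nonneg A) hl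
  have mv : MemLp v0 2 := Lp.memLp v0
  refine ⟨v0, mv, ?_, fun g hg => ?_⟩
  · have : ‖v0‖ ^ 2 = ∫ x, ‖v0 x‖ ^ 2 := by
      rw [← normsq_Lp mv, Lp.toLp_coeFn]
    rw [← this, ← Real.sq_sqrt A0]
    gcongr
  · have E : ∀ p : TT D, ∫ x, q x * dv p x * conj (v0 x) = ∫ x, conj (χ x) * dv p x := by
      intro p
      have := hv2 p
      simp only [l, T, LinearMap.coe_mk, AddHom.coe_mk] at this
      rw [← this, ← inner_toLp (mT p) mv, Lp.toLp_coeFn]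
    have z0 : ∀ e x, dz e (fun _ => (0:ℂ)) x = 0 := fun e x => by simp [dz]
    have fin : ∀ e, (∫ x, q x * dz e (fun y => conj (g y)) x * conj (v0 x) = ∫ x, conj (χ x) * dz e (fun y => conj (g y)) x) →
        ∫ x, χ x * db e g x = ∫ x, q x * v0 x * db e g x := by
      intro e he
      have z : ∀ x, dz e (fun y => conj (g y)) x = conj (db e g x) := fun x => dz_conj (hg.diff x)
      simp only [z] at he
      have := congrArg conj he
      rw [← integral_conj, ← integral_conj] at this
      refine Eq.trans ?_ (this.symm.trans ?_)
      · congr 1; ext x; simp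
      · congr 1; ext x; simp only [map_mul, conj_conj, hq, conj_ofReal]; ring
    constructor
    · apply fin
      have := E ⟨(fun y => conj (g y), fun _ => 0), hg.conj, Tst.zero⟩
      simpa only [dv, z0, add_zero] using this
    · apply fin
      have := E ⟨(fun _ => 0, fun y => conj (g y)), Tst.zero, hg.conj⟩
      simpa only [dv, z0, zero_add] using this

end

section
open Complex
open MeasureTheory ComplexConjugate
open Filter Topology
open scoped ENNReal

/-- real Hessian -/
def Hs (u : ℂ × ℂ → ℝ) (x v w : ℂ × ℂ) : ℝ := fderiv ℝ (fderiv ℝ u) x v w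

lemma dz_real {u : ℂ × ℂ → ℝ} {x} (hu : DifferentiableAt ℝ u x) (e) :
    dz e (fun y => (u y : ℂ)) x = (1/2) * ((fderiv ℝ u x e : ℂ) - I * (fderiv ℝ u x (I • e) : ℂ)) := by
  have h2 : HasFDerivAt (fun y => (u y : ℂ)) (ofRealCLM.comp (fderiv ℝ u x)) x :=
    ofRealCLM.hasFDerivAt.comp x hu.hasFDerivAt
  simp [dz, h2.fderiv]

lemma ev_diff {u : ℂ × ℂ → ℝ} {x} (hu : ContDiffAt ℝ 2 u x) : ∀ᶠ y in 𝓝 x, DifferentiableAt ℝ u y := by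
  filter_upwards [hu.eventually (by simp)] with y hy
  exact hy.differentiableAt (by norm_num)

lemma diff_fderiv {u : ℂ × ℂ → ℝ} {x} (hu : ContDiffAt ℝ 2 u x) : DifferentiableAt ℝ (fderiv ℝ u) x :=
  (hu.fderiv_right (m := 1) (by norm_num)).differentiableAt (by norm_num)

lemma fderiv_dz_real {u : ℂ × ℂ → ℝ} {x} (hu : ContDiffAt ℝ 2 u x) (e v) :
    fderiv ℝ (dz e (fun y => (u y : ℂ))) x v = (1/2) * ((Hs u x v e : ℂ) - I * (Hs u x v (I • e) : ℂ)) := by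
  have h1 : dz e (fun y => (u y : ℂ)) =ᶠ[𝓝 x] fun y => (1/2) * ((fderiv ℝ u y e : ℂ) - I * (fderiv ℝ u y (I • e) : ℂ)) := by
    filter_upwards [ev_diff hu] with y hy
    exact dz_real hy e
  rw [h1.fderiv_eq]
  have hd : ∀ w, HasFDerivAt (fun y => (fderiv ℝ u y w : ℂ)) (ofRealCLM.comp ((fderiv ℝ (fderiv ℝ u) x).flip w)) x := fun w => by
    refine ofRealCLM.hasFDerivAt.comp x ?_
    have := (diff_fderiv hu).hasFDerivAt.clm_apply (hasFDerivAt_const w x)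
    simpa using this
  have := (((hd e).sub ((hd (I • e)).const_mul I)).const_mul (1/2 : ℂ)).fderiv
  have t2 := congrArg (fun L => L v) this
  refine Eq.trans t2 ?_
  simp [Hs]

lemma Hs_symm {u : ℂ × ℂ → ℝ} {x} (hu : ContDiffAt ℝ 2 u x) (v w) : Hs u x v w = Hs u x w v :=
  hu.isSymmSndFDerivAt (by simp) v w

lemma levi_eq {u : ℂ × ℂ → ℝ} {x} (hu : ContDiffAt ℝ 2 u x) (w : ℂ × ℂ) :
    leviForm u x w = (Hs u x w w + Hs u x (I • w) (I • w)) / 4 := by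
  obtain ⟨p, q⟩ := w
  rw [leviForm_bil]
  simp only [db, fderiv_dz_real hu]
  have hw : ((p, q) : ℂ × ℂ) = p.re • (1,0) + p.im • (I • (1,0)) + q.re • (0,1) + q.im • (I • (0,1)) := by
    ext <;> simp [Complex.ext_iff]
  have hIw : (I • (p, q) : ℂ × ℂ) = (-p.im) • (1,0) + p.re • (I • (1,0)) + (-q.im) • (0,1) + q.re • (I • (0,1)) := by
    ext <;> simp [Complex.ext_iff]
  have sy := Hs_symm hu
  have lin : ∀ a b c d a' b' c' d' : ℝ, ∀ e1 e2 e3 e4 : ℂ × ℂ, Hs u x (a • e1 + b • e2 + c • e3 + d • e4) (a' • e1 + b' • e2 + c' • e3 + d' • e4)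
    = a * (a' * Hs u x e1 e1 + b' * Hs u x e1 e2 + c' * Hs u x e1 e3 + d' * Hs u x e1 e4)
     + b * (a' * Hs u x e2 e1 + b' * Hs u x e2 e2 + c' * Hs u x e2 e3 + d' * Hs u x e2 e4)
     + c * (a' * Hs u x e3 e1 + b' * Hs u x e3 e2 + c' * Hs u x e3 e3 + d' * Hs u x e3 e4)
     + d * (a' * Hs u x e4 e1 + b' * Hs u x e4 e2 + c' * Hs u x e4 e3 + d' * Hs u x e4 e4) := by
    intros
    simp only [Hs, map_add, map_smul, add_apply, smul_apply, smul_eq_mul]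
    ring
  rw [hIw, hw, lin, lin]
  generalize ((1, 0) : ℂ × ℂ) = e1
  generalize I • e1 = e2
  generalize ((0, 1) : ℂ × ℂ) = e3
  generalize I • e3 = e4
  simp only [sy e2 e1, sy e3 e1, sy e4 e1, sy e3 e2, sy e4 e2, sy e4 e3]
  simp
  ring

lemma Hs_add {u v : ℂ × ℂ → ℝ} {x} (hu : ContDiffAt ℝ 2 u x) (hv : ContDiffAt ℝ 2 v x) (w w') :
    Hs (fun y => u y + v y) x w w' = Hs u x w w' + Hs v x w w' := by
  have h1 : fderiv ℝ (fun y => u y + v y) =ᶠ[𝓝 x] fun y => fderiv ℝ u y + fderiv ℝ v y := by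
    filter_upwards [ev_diff hu, ev_diff hv] with y h1 h2
    exact fderiv_fun_add h1 h2
  simp only [Hs, h1.fderiv_eq]
  rw [fderiv_fun_add (diff_fderiv hu) (diff_fderiv hv)]; rfl

lemma Hs_smul {u : ℂ × ℂ → ℝ} {x} (hu : ContDiffAt ℝ 2 u x) (c : ℝ) (w w') :
    Hs (fun y => c * u y) x w w' = c * Hs u x w w' := by
  have h1 : fderiv ℝ (fun y => c * u y) =ᶠ[𝓝 x] fun y => c • fderiv ℝ u y := by
    filter_upwards [ev_diff hu] with y h1
    exact fderiv_const_mul h1 c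
  simp only [Hs, h1.fderiv_eq]
  rw [fderiv_fun_const_smul (diff_fderiv hu)]; rfl

/-- squared norm of `∂u(w)` -/
def Gd (u : ℂ × ℂ → ℝ) (x w : ℂ × ℂ) : ℝ := ((fderiv ℝ u x w) ^ 2 + (fderiv ℝ u x (I • w)) ^ 2) / 4

lemma Gd_nonneg (u x w) : 0 ≤ Gd u x w := by unfold Gd; positivity

lemma Gd_eq {u : ℂ × ℂ → ℝ} {x} (hu : DifferentiableAt ℝ u x) (p q : ℂ) :
    ‖dz (1,0) (fun y => (u y : ℂ)) x * p + dz (0,1) (fun y => (u y : ℂ)) x * q‖ ^ 2 = Gd u x (p, q) := by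
  rw [dz_real hu, dz_real hu]
  have hw : ((p, q) : ℂ × ℂ) = p.re • (1,0) + p.im • (I • (1,0)) + q.re • (0,1) + q.im • (I • (0,1)) := by
    ext <;> simp [Complex.ext_iff]
  have hIw : (I • (p, q) : ℂ × ℂ) = (-p.im) • (1,0) + p.re • (I • (1,0)) + (-q.im) • (0,1) + q.re • (I • (0,1)) := by
    ext <;> simp [Complex.ext_iff]
  rw [Gd, hIw, hw]
  simp only [map_add, map_smul, smul_eq_mul]
  rw [← Complex.normSq_eq_norm_sq, Complex.normSq_apply]
  simp
  ring

lemma Hs_comp {h : ℝ → ℝ} {u : ℂ × ℂ → ℝ} {x} (hh : ContDiffAt ℝ 2 h (u x)) (hu : ContDiffAt ℝ 2 u x) (w w') :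
    Hs (fun y => h (u y)) x w w' = deriv (deriv h) (u x) * (fderiv ℝ u x w * fderiv ℝ u x w') + deriv h (u x) * Hs u x w w' := by
  have ev : ∀ᶠ y in 𝓝 x, DifferentiableAt ℝ h (u y) := by
    have : ∀ᶠ t in 𝓝 (u x), DifferentiableAt ℝ h t := by
      filter_upwards [hh.eventually (by simp)] with y hy
      exact hy.differentiableAt (by norm_num)
    exact hu.continuousAt.eventually this
  have h1 : fderiv ℝ (fun y => h (u y)) =ᶠ[𝓝 x] fun y => deriv h (u y) • fderiv ℝ u y := by
    filter_upwards [ev_diff hu, ev] with y h1 h2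
    exact (h2.hasDerivAt.comp_hasFDerivAt y h1.hasFDerivAt).fderiv
  have dd : DifferentiableAt ℝ (deriv h) (u x) := by
    have : ContDiffAt ℝ 1 (deriv h) (u x) := by
      have h3 := hh.fderiv_right (m := 1) (by norm_num)
      have : deriv h = fun t => fderiv ℝ h t 1 := by ext t; simp
      rw [this]
      exact h3.clm_apply contDiffAt_const
    exact this.differentiableAt (by norm_num)
  have d1 : HasFDerivAt (fun y => deriv h (u y)) (deriv (deriv h) (u x) • fderiv ℝ u x) x :=
    dd.hasDerivAt.comp_hasFDerivAt x (hu.differentiableAt (by norm_num)).hasFDerivAt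
  have d2 := d1.fun_smul (diff_fderiv hu).hasFDerivAt
  simp only [Hs, h1.fderiv_eq, d2.fderiv]
  simp
  ring

lemma cd_comp {h : ℝ → ℝ} {u : ℂ × ℂ → ℝ} {x} (hh : ContDiffAt ℝ 2 h (u x)) (hu : ContDiffAt ℝ 2 u x) :
    ContDiffAt ℝ 2 (fun y => h (u y)) x := hh.comp x hu

lemma levi_comp {h : ℝ → ℝ} {u : ℂ × ℂ → ℝ} {x} (hh : ContDiffAt ℝ 2 h (u x)) (hu : ContDiffAt ℝ 2 u x) (w) :
    leviForm (fun y => h (u y)) x w = deriv (deriv h) (u x) * Gd u x w + deriv h (u x) * leviForm u x w := by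
  rw [levi_eq (cd_comp hh hu), levi_eq hu, Hs_comp hh hu, Hs_comp hh hu, Gd]; ring

lemma levi_add {u v : ℂ × ℂ → ℝ} {x} (hu : ContDiffAt ℝ 2 u x) (hv : ContDiffAt ℝ 2 v x) (w) :
    leviForm (fun y => u y + v y) x w = leviForm u x w + leviForm v x w := by
  rw [levi_eq (hu.add hv), levi_eq hu, levi_eq hv, Hs_add hu hv, Hs_add hu hv]; ring

lemma levi_smul {u : ℂ × ℂ → ℝ} {x} (hu : ContDiffAt ℝ 2 u x) (c : ℝ) (w) :
    leviForm (fun y => c * u y) x w = c * leviForm u x w := by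
  rw [levi_eq (contDiffAt_const.mul hu), levi_eq hu, Hs_smul hu, Hs_smul hu]; ring

lemma levi_const (c : ℝ) (x w) : leviForm (fun _ => c) x w = 0 := by
  rw [levi_eq contDiffAt_const]; simp [Hs]

/-- C² and plurisubharmonic at a point -/
structure PshAt (u : ℂ × ℂ → ℝ) (x : ℂ × ℂ) : Prop where
  cd : ContDiffAt ℝ 2 u x
  nn : ∀ w, 0 ≤ leviForm u x w

lemma PshAt.congr {u v : ℂ × ℂ → ℝ} {x} (h : PshAt u x) (e : v =ᶠ[𝓝 x] u) : PshAt v x :=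
  ⟨h.cd.congr_of_eventuallyEq e, fun w => by rw [leviForm_congr e]; exact h.nn w⟩

lemma PshAt.add {u v : ℂ × ℂ → ℝ} {x} (h : PshAt u x) (h' : PshAt v x) : PshAt (fun y => u y + v y) x :=
  ⟨h.cd.add h'.cd, fun w => by rw [levi_add h.cd h'.cd]; exact add_nonneg (h.nn w) (h'.nn w)⟩

lemma PshAt.const (c : ℝ) (x) : PshAt (fun _ => c) x := ⟨contDiffAt_const, fun w => by rw [levi_const]⟩

lemma PshAt.smul {u : ℂ × ℂ → ℝ} {x} (h : PshAt u x) {c : ℝ} (hc : 0 ≤ c) : PshAt (fun y => c * u y) x :=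
  ⟨contDiffAt_const.mul h.cd, fun w => by rw [levi_smul h.cd]; exact mul_nonneg hc (h.nn w)⟩

lemma PshAt.comp {h : ℝ → ℝ} {u : ℂ × ℂ → ℝ} {x} (hu : PshAt u x) (hh : ContDiffAt ℝ 2 h (u x))
    (h1 : 0 ≤ deriv h (u x)) (h2 : 0 ≤ deriv (deriv h) (u x)) : PshAt (fun y => h (u y)) x :=
  ⟨cd_comp hh hu.cd, fun w => by
    rw [levi_comp hh hu.cd]
    exact add_nonneg (mul_nonneg h2 (Gd_nonneg _ _ _)) (mul_nonneg h1 (hu.nn w))⟩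

lemma PshAt.sum {ι : Type*} {u : ι → ℂ × ℂ → ℝ} {x} (s : Finset ι) (h : ∀ i ∈ s, PshAt (u i) x) :
    PshAt (fun y => ∑ i ∈ s, u i y) x := by
  classical
  induction s using Finset.induction_on with
  | empty => simpa using PshAt.const 0 x
  | insert a s ha ih =>
    simp only [Finset.sum_insert ha]
    exact (h a (by simp)).add (ih fun i hi => h i (by simp [hi]))

end

section
open Complex
open MeasureTheory ComplexConjugate
open Filter Topology
open scoped ENNReal

lemma osgood1 {f : ℂ × ℂ → ℂ} {Ω : Set (ℂ × ℂ)} (hΩ : IsOpen Ω) (hf : DifferentiableOn ℂ f Ω) (v : ℂ × ℂ) :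
    DifferentiableOn ℂ (fun z => fderiv ℂ f z v) Ω := by
  intro x hx
  apply DifferentiableAt.differentiableWithinAt
  have hfx : ContinuousAt f x := (hf.differentiableAt (hΩ.mem_nhds hx)).continuousAt
  obtain ⟨ρ0, hρ0, hb⟩ := Metric.mem_nhds_iff.mp (Filter.inter_mem (hΩ.mem_nhds hx) (hfx (Metric.ball_mem_nhds (f x) (by norm_num : (0:ℝ) < 1/2))))
  set ρ := ρ0 / 2 with hρ
  have ρpos : 0 < ρ := by positivity
  have bd : ∀ c ∈ Metric.ball x ρ, ‖fderiv ℂ f c‖ ≤ 1 / ρ := by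
    intro c hc
    have sub : Metric.ball c ρ ⊆ Metric.ball x ρ0 := by
      intro y hy
      rw [Metric.mem_ball] at *
      calc dist y x ≤ dist y c + dist c x := dist_triangle _ _ _
        _ < ρ0 := by linarith
    refine norm_fderiv_le_div_of_mapsTo_ball (hf.mono fun y hy => (hb (sub hy)).1) (fun y hy => ?_) ρpos
    have h1 : dist (f y) (f x) < 1/2 := (hb (sub hy)).2
    have h2 : dist (f c) (f x) < 1/2 := (hb (sub (Metric.mem_ball_self ρpos))).2
    rw [Metric.mem_closedBall]
    calc dist (f y) (f c) ≤ dist (f y) (f x) + dist (f c) (f x) := dist_triangle_right _ _ _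
      _ ≤ 1 := by linarith
  set s := ρ / (2 * (‖v‖ + 1)) with hs
  have spos : 0 < s := by positivity
  have sv : s * ‖v‖ < ρ / 2 := by
    rw [hs, div_mul_eq_mul_div, div_lt_div_iff₀ (by positivity) (by norm_num)]
    nlinarith [norm_nonneg v]
  have mem : ∀ z ∈ Metric.ball x (ρ/2), ∀ ζ : ℂ, ‖ζ‖ ≤ s → z + ζ • v ∈ Metric.ball x ρ := by
    intro z hz ζ hζ
    rw [Metric.mem_ball, dist_eq_norm] at *
    calc ‖z + ζ • v - x‖ = ‖(z - x) + ζ • v‖ := by congr 1; abel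
      _ ≤ ‖z - x‖ + ‖ζ‖ * ‖v‖ := (norm_add_le _ _).trans (by rw [norm_smul])
      _ ≤ ‖z - x‖ + s * ‖v‖ := by gcongr
      _ < ρ := by linarith
  have sub0 : Metric.ball x ρ ⊆ Ω := fun y hy => (hb (Metric.ball_subset_ball (by rw [hρ]; linarith) hy)).1
  have dAt : ∀ y ∈ Metric.ball x ρ, DifferentiableAt ℂ f y := fun y hy => hf.differentiableAt (hΩ.mem_nhds (sub0 hy))
  have cm : ∀ θ, ‖circleMap 0 s θ‖ ≤ s := fun θ => by rw [norm_circleMap_zero, abs_of_pos spos]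
  set k : ℝ → ℂ := fun θ => deriv (circleMap 0 s) θ * (1 / (circleMap 0 s θ - 0) ^ 2) with hk
  have ck : Continuous k := by
    simp only [hk, deriv_circleMap]
    refine ((continuous_circleMap 0 s).mul continuous_const).mul (continuous_const.div ((((continuous_circleMap 0 s).sub continuous_const)).pow 2) ?_)
    intro θ
    have := circleMap_ne_center (c := 0) (R := s) spos.ne' (θ := θ)
    simpa using this
  have formula : ∀ z ∈ Metric.ball x (ρ/2), fderiv ℂ f z v = (2 * Real.pi * I)⁻¹ * ∫ θ in (0:ℝ)..2 * Real.pi, k θ * f (z + circleMap 0 s θ • v) := by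
    intro z hz
    have hd : DifferentiableOn ℂ (fun ζ : ℂ => f (z + ζ • v)) (Metric.closedBall 0 s) := by
      intro ζ hζ
      have := dAt _ (mem z hz ζ (by simpa using hζ))
      apply DifferentiableAt.differentiableWithinAt
      exact this.comp ζ (f := fun ζ : ℂ => z + ζ • v) (by fun_prop)
    have h1 := hd.deriv_eq_smul_circleIntegral spos
    have h2 : deriv (fun ζ : ℂ => f (z + ζ • v)) 0 = fderiv ℂ f z v := by
      have hz' := dAt z (by simpa using mem z hz 0 (by simp [spos.le]))
      have l : HasDerivAt (fun ζ : ℂ => z + ζ • v) v 0 := by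
        simpa using ((hasDerivAt_id (0:ℂ)).smul_const v).const_add z
      have hz2 : HasFDerivAt f (fderiv ℂ f z) (z + (0:ℂ) • v) := by simpa using hz'.hasFDerivAt
      exact (hz2.comp_hasDerivAt 0 l).deriv
    rw [h2, circleIntegral, smul_eq_mul] at h1
    have h3 : (2 * Real.pi * I : ℂ) ≠ 0 := by simp [Real.pi_ne_zero]
    rw [eq_inv_mul_iff_mul_eq₀ h3, ← h1]
    congr 1; ext θ; simp only [hk, smul_eq_mul]; ring
  have key := intervalIntegral.hasFDerivAt_integral_of_dominated_of_fderiv_le (𝕜 := ℂ) (μ := volume)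
    (F := fun z θ => k θ * f (z + circleMap 0 s θ • v)) (F' := fun z θ => k θ • fderiv ℂ f (z + circleMap 0 s θ • v))
    (a := 0) (b := 2 * Real.pi) (x₀ := x) (s := Metric.ball x (ρ/2)) (bound := fun θ => ‖k θ‖ * (1 / ρ))
    (Metric.ball_mem_nhds x (by positivity)) ?_ ?_ ?_ ?_ ?_ ?_
  · have e : (fun z => fderiv ℂ f z v) =ᶠ[𝓝 x] fun z => (2 * Real.pi * I)⁻¹ * ∫ θ in (0:ℝ)..2 * Real.pi, k θ * f (z + circleMap 0 s θ • v) := by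
      filter_upwards [Metric.ball_mem_nhds x (by positivity : 0 < ρ/2)] with z hz
      exact formula z hz
    exact (key.differentiableAt.const_mul _).congr_of_eventuallyEq e
  · filter_upwards [Metric.ball_mem_nhds x (by positivity : 0 < ρ/2)] with z hz
    apply Continuous.aestronglyMeasurable
    refine ck.mul ?_
    rw [continuous_iff_continuousAt]
    intro θ
    have := (dAt _ (mem z hz _ (cm θ))).continuousAt
    exact ContinuousAt.comp (f := fun θ => z + circleMap 0 s θ • v) this (by fun_prop)
  · apply Continuous.intervalIntegrable
    refine ck.mul ?_
    rw [continuous_iff_continuousAt]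
    intro θ
    have := (dAt _ (mem x (Metric.mem_ball_self (by positivity)) _ (cm θ))).continuousAt
    exact ContinuousAt.comp (f := fun θ => x + circleMap 0 s θ • v) this (by fun_prop)
  · have m : Measurable (fun θ => fderiv ℂ f (x + circleMap 0 s θ • v)) :=
      (measurable_fderiv ℂ f).comp (Continuous.measurable (by fun_prop))
    exact (ck.measurable.smul m).aestronglyMeasurable
  · refine Eventually.of_forall fun θ _ z hz => ?_
    rw [norm_smul]
    gcongr
    exact bd _ (mem z hz _ (cm θ))
  · exact (ck.norm.mul continuous_const).intervalIntegrable _ _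
  · refine Eventually.of_forall fun θ _ z hz => ?_
    have := (dAt _ (mem z hz _ (cm θ))).hasFDerivAt
    have h2 := this.comp z ((hasFDerivAt_id z).add_const (circleMap 0 s θ • v))
    exact h2.const_mul (k θ)

lemma osgood {Ω : Set (ℂ × ℂ)} (hΩ : IsOpen Ω) (n : ℕ) : ∀ {f : ℂ × ℂ → ℂ}, DifferentiableOn ℂ f Ω →
    ContDiffOn ℂ n f Ω := by
  induction n with
  | zero => intro f hf; exact contDiffOn_zero.mpr hf.continuousOn
  | succ n ih =>
    intro f hf
    rw [Nat.cast_succ, contDiffOn_succ_iff_fderiv_of_isOpen hΩ]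
    refine ⟨hf, by simp, ?_⟩
    rw [contDiffOn_clm_apply]
    intro v
    exact ih (osgood1 hΩ hf v)

/-- holomorphic near a point -/
def HolAt (g : ℂ × ℂ → ℂ) (x : ℂ × ℂ) : Prop := ∀ᶠ y in 𝓝 x, DifferentiableAt ℂ g y

lemma HolAt.cd {g x} (h : HolAt g x) : ContDiffAt ℂ 2 g x := by
  obtain ⟨t, ht, ho, hx⟩ := eventually_nhds_iff.mp h
  exact (osgood ho 2 (fun y hy => (ht y hy).differentiableWithinAt)).contDiffAt (ho.mem_nhds hx)

lemma HolAt.levi_re {g x} (h : HolAt g x) (L : ℂ →L[ℝ] ℝ) (w) : leviForm (fun y => L (g y)) x w = 0 := by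
  have c := h.cd.restrict_scalars ℝ
  have c2 : ContDiffAt ℝ 2 (fun y => L (g y)) x := L.contDiff.contDiffAt.comp x c
  rw [levi_eq c2]
  have e : fderiv ℝ (fun y => L (g y)) =ᶠ[𝓝 x] fun y => L.comp ((fderiv ℂ g y).restrictScalars ℝ) := by
    filter_upwards [h] with y hy
    exact (L.hasFDerivAt.comp y (hy.hasFDerivAt.restrictScalars ℝ)).fderiv
  have d : DifferentiableAt ℂ (fderiv ℂ g) x := (h.cd.fderiv_right (m := 1) (by norm_num)).differentiableAt (by norm_num)
  have hH : ∀ v v', Hs (fun y => L (g y)) x v v' = L (fderiv ℂ (fderiv ℂ g) x v v') := by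
    intro v v'
    have h1 : DifferentiableAt ℝ (fderiv ℝ (fun y => L (g y))) x := diff_fderiv c2
    have h2 : fderiv ℝ (fun y => fderiv ℝ (fun y => L (g y)) y v') x v = Hs (fun y => L (g y)) x v v' := by
      have := (h1.hasFDerivAt.clm_apply (hasFDerivAt_const v' x)).fderiv
      rw [this]; simp [Hs]
    rw [← h2]
    have e2 : (fun y => fderiv ℝ (fun y => L (g y)) y v') =ᶠ[𝓝 x] fun y => L (fderiv ℂ g y v') := by
      filter_upwards [e] with y hy
      rw [hy]; rfl
    rw [e2.fderiv_eq]
    have h3 := d.hasFDerivAt.clm_apply (hasFDerivAt_const v' x)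
    have h4 := (L.hasFDerivAt.comp x (h3.restrictScalars ℝ)).fderiv
    have h5 := congrArg (fun T => T v) h4
    refine Eq.trans h5 ?_
    simp
  rw [hH, hH]
  simp only [map_smul, smul_apply, smul_eq_mul]
  rw [← mul_assoc, I_mul_I]
  simp

lemma HolAt.psh_sq {g x} (h : HolAt g x) : PshAt (fun y => ‖g y‖ ^ 2) x := by
  have e : (fun y => ‖g y‖ ^ 2) = fun y => (reCLM (g y)) ^ 2 + (imCLM (g y)) ^ 2 := by
    ext y; rw [← Complex.normSq_eq_norm_sq, Complex.normSq_apply]; simp; ring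
  rw [e]
  have c := h.cd.restrict_scalars ℝ
  have sq : ∀ L : ℂ →L[ℝ] ℝ, PshAt (fun y => (L (g y)) ^ 2) x := by
    intro L
    have c2 : ContDiffAt ℝ 2 (fun y => L (g y)) x := L.contDiff.contDiffAt.comp x c
    refine ⟨c2.pow 2, fun w => ?_⟩
    rw [levi_comp (h := fun t => t ^ 2) (contDiff_id.pow 2).contDiffAt c2, h.levi_re L w]
    have d1 : deriv (fun t : ℝ => t ^ 2) = fun t => 2 * t := by ext t; simp
    have d2 : deriv (deriv (fun t : ℝ => t ^ 2)) (L (g x)) = 2 := by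
      rw [d1]; simpa using ((hasDerivAt_id (L (g x))).const_mul (2:ℝ)).deriv
    rw [d2]
    have := Gd_nonneg (fun y => L (g y)) x w
    linarith
  exact (sq _).add (sq _)

/-- shifted square norm -/
def sq2 (a : ℂ × ℂ) (τ : ℝ) (z : ℂ × ℂ) : ℝ := ‖z.1 - a.1‖ ^ 2 + ‖z.2 - a.2‖ ^ 2 + τ

lemma sq2_cd (a τ) : ContDiff ℝ 2 (sq2 a τ) := by
  unfold sq2
  exact (((contDiff_fst.sub contDiff_const).norm_sq ℝ).add ((contDiff_snd.sub contDiff_const).norm_sq ℝ)).add contDiff_const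

lemma sq2_fd (a τ x w) : fderiv ℝ (sq2 a τ) x w = 2 * (conj (x.1 - a.1) * w.1 + conj (x.2 - a.2) * w.2).re := by
  have h1 : HasFDerivAt (fun z : ℂ × ℂ => z.1 - a.1) (ContinuousLinearMap.fst ℝ ℂ ℂ) x := hasFDerivAt_fst.sub_const _
  have h2 : HasFDerivAt (fun z : ℂ × ℂ => z.2 - a.2) (ContinuousLinearMap.snd ℝ ℂ ℂ) x := hasFDerivAt_snd.sub_const _
  have h3 : HasFDerivAt (sq2 a τ) _ x := (h1.norm_sq.add h2.norm_sq).add_const τ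
  rw [h3.fderiv]
  simp [Complex.inner]
  ring

lemma sq2_levi (a τ x w) : leviForm (sq2 a τ) x w = ‖w.1‖ ^ 2 + ‖w.2‖ ^ 2 := by
  have c := (sq2_cd a τ).contDiffAt (x := x)
  rw [levi_eq c]
  have hH : ∀ v v', Hs (sq2 a τ) x v v' = 2 * (conj v.1 * v'.1 + conj v.2 * v'.2).re := by
    intro v v'
    have h1 := diff_fderiv c
    have h2 : fderiv ℝ (fun y => fderiv ℝ (sq2 a τ) y v') x v = Hs (sq2 a τ) x v v' := by
      have := (h1.hasFDerivAt.clm_apply (hasFDerivAt_const v' x)).fderiv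
      rw [this]; simp [Hs]
    rw [← h2]
    simp only [sq2_fd]
    set L : ℂ × ℂ →L[ℝ] ℝ := (2:ℝ) • (reCLM.comp (((ContinuousLinearMap.mul ℝ ℂ).flip v'.1).comp ((conjCLE : ℂ →L[ℝ] ℂ).comp (ContinuousLinearMap.fst ℝ ℂ ℂ)) + ((ContinuousLinearMap.mul ℝ ℂ).flip v'.2).comp ((conjCLE : ℂ →L[ℝ] ℂ).comp (ContinuousLinearMap.snd ℝ ℂ ℂ)))) with hL
    have hl : ∀ y : ℂ × ℂ, L y = 2 * (conj y.1 * v'.1 + conj y.2 * v'.2).re := by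
      intro y; simp [hL]; ring
    clear_value L
    have e : (fun y : ℂ × ℂ => 2 * (conj (y.1 - a.1) * v'.1 + conj (y.2 - a.2) * v'.2).re) = fun y => L (y - a) := by
      ext y; rw [hl]; rfl
    rw [e]
    have : HasFDerivAt (fun y => L (y - a)) L x := by
      have e3 : (fun y => L (y - a)) = fun y => L y - L a := by ext y; rw [map_sub]
      rw [e3]
      exact L.hasFDerivAt.sub_const _
    rw [this.fderiv, hl]
  rw [hH, hH, ← Complex.normSq_eq_norm_sq, ← Complex.normSq_eq_norm_sq, Complex.normSq_apply, Complex.normSq_apply]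
  simp
  ring

lemma sq2_gd {a τ} (hτ : 0 ≤ τ) (x w) : Gd (sq2 a τ) x w ≤ (‖w.1‖ ^ 2 + ‖w.2‖ ^ 2) * sq2 a τ x := by
  have h : Gd (sq2 a τ) x w = ‖conj (x.1 - a.1) * w.1 + conj (x.2 - a.2) * w.2‖ ^ 2 := by
    rw [Gd, sq2_fd, sq2_fd, ← Complex.normSq_eq_norm_sq, Complex.normSq_apply]
    simp
    ring
  rw [h]
  refine (num_cs _ _ _ _).trans ?_
  simp only [RCLike.norm_conj, sq2]
  have := mul_nonneg (add_nonneg (sq_nonneg ‖w.1‖) (sq_nonneg ‖w.2‖)) hτ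
  nlinarith

lemma psh_log {a τ} (hτ : 0 < τ) (x) : PshAt (fun y => Real.log (sq2 a τ y)) x := by
  have pos : 0 < sq2 a τ x := by unfold sq2; positivity
  have c := (sq2_cd a τ).contDiffAt (x := x)
  have cl : ContDiffAt ℝ 2 Real.log (sq2 a τ x) := Real.contDiffAt_log.mpr pos.ne'
  refine ⟨cd_comp cl c, fun w => ?_⟩
  rw [levi_comp cl c, sq2_levi, Real.deriv_log]
  have d : deriv (deriv Real.log) (sq2 a τ x) = - ((sq2 a τ x) ^ 2)⁻¹ := by
    rw [Real.deriv_log']; simp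
  rw [d]
  have := sq2_gd (a := a) hτ.le x w
  have e : -((sq2 a τ x) ^ 2)⁻¹ * Gd (sq2 a τ) x w + (sq2 a τ x)⁻¹ * (‖w.1‖ ^ 2 + ‖w.2‖ ^ 2) = ((sq2 a τ x) ^ 2)⁻¹ * ((‖w.1‖ ^ 2 + ‖w.2‖ ^ 2) * sq2 a τ x - Gd (sq2 a τ) x w) := by
    field_simp; ring
  rw [e]
  exact mul_nonneg (by positivity) (by linarith)

/-- cubic ramp -/
def ramp (t : ℝ) : ℝ := max 0 t ^ 3

lemma ramp_hd (t : ℝ) : HasDerivAt ramp (3 * max 0 t ^ 2) t := by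
  rcases lt_trichotomy t 0 with h | h | h
  · have e : ramp =ᶠ[𝓝 t] fun _ => 0 := by
      filter_upwards [eventually_lt_nhds h] with s hs
      simp [ramp, max_eq_left hs.le]
    rw [max_eq_left h.le]
    simpa using (hasDerivAt_const t (0:ℝ)).congr_of_eventuallyEq e
  · subst h
    rw [hasDerivAt_iff_isLittleO_nhds_zero]
    simp only [ramp, zero_add, max_self]
    simp
    have h1 : (fun h : ℝ => max 0 h ^ 3) =O[𝓝 0] fun h => h ^ 3 := by
      refine Asymptotics.IsBigO.of_bound 1 (Eventually.of_forall fun h => ?_)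
      rw [norm_pow, norm_pow, one_mul]
      gcongr
      rw [Real.norm_eq_abs, Real.norm_eq_abs, abs_of_nonneg (le_max_left _ _)]
      exact max_le (abs_nonneg _) (le_abs_self _)
    refine h1.trans_isLittleO ?_
    simpa using Asymptotics.isLittleO_pow_pow (𝕜 := ℝ) (m := 1) (n := 3) (by norm_num)
  · have e : ramp =ᶠ[𝓝 t] fun s => s ^ 3 := by
      filter_upwards [eventually_gt_nhds h] with s hs
      simp [ramp, max_eq_right hs.le]
    rw [max_eq_right h.le]
    simpa using (hasDerivAt_pow 3 t).congr_of_eventuallyEq e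

lemma ramp_hd2 (t : ℝ) : HasDerivAt (fun t : ℝ => 3 * max 0 t ^ 2) (6 * max 0 t) t := by
  rcases lt_trichotomy t 0 with h | h | h
  · have e : (fun t : ℝ => 3 * max 0 t ^ 2) =ᶠ[𝓝 t] fun _ => 0 := by
      filter_upwards [eventually_lt_nhds h] with s hs
      simp [max_eq_left hs.le]
    rw [max_eq_left h.le]
    simpa using (hasDerivAt_const t (0:ℝ)).congr_of_eventuallyEq e
  · subst h
    rw [hasDerivAt_iff_isLittleO_nhds_zero]
    simp only [max_self]
    simp
    have h1 : (fun h : ℝ => 3 * max 0 h ^ 2) =O[𝓝 0] fun h => h ^ 2 := by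
      refine Asymptotics.IsBigO.of_bound 3 (Eventually.of_forall fun h => ?_)
      rw [norm_mul, norm_pow, norm_pow]
      simp only [Real.norm_ofNat]
      gcongr
      rw [Real.norm_eq_abs, Real.norm_eq_abs, abs_of_nonneg (le_max_left _ _)]
      exact max_le (abs_nonneg _) (le_abs_self _)
    refine h1.trans_isLittleO ?_
    simpa using Asymptotics.isLittleO_pow_pow (𝕜 := ℝ) (m := 1) (n := 2) (by norm_num)
  · have e : (fun t : ℝ => 3 * max 0 t ^ 2) =ᶠ[𝓝 t] fun s => 3 * s ^ 2 := by
      filter_upwards [eventually_gt_nhds h] with s hs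
      simp [max_eq_right hs.le]
    rw [max_eq_right h.le]
    have h2 := (((hasDerivAt_pow 2 t).const_mul 3).congr_of_eventuallyEq e)
    exact h2.congr_deriv (by norm_num; ring)

lemma ramp_d1 : deriv ramp = fun t => 3 * max 0 t ^ 2 := by ext t; exact (ramp_hd t).deriv
lemma ramp_d2 (t) : deriv (deriv ramp) t = 6 * max 0 t := by rw [ramp_d1]; exact (ramp_hd2 t).deriv

lemma ramp_cd : ContDiff ℝ 2 ramp := by
  have e : (2 : WithTop ℕ∞) = 1 + 1 := by norm_num
  rw [e, contDiff_succ_iff_deriv]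
  refine ⟨fun t => (ramp_hd t).differentiableAt, by simp, ?_⟩
  rw [ramp_d1, contDiff_one_iff_deriv]
  refine ⟨fun t => (ramp_hd2 t).differentiableAt, ?_⟩
  have : deriv (fun t : ℝ => 3 * max 0 t ^ 2) = fun t => 6 * max 0 t := by ext t; exact (ramp_hd2 t).deriv
  rw [this]
  fun_prop

lemma ramp_nonneg (t) : 0 ≤ ramp t := by unfold ramp; positivity
lemma ramp_pos {t} (h : 0 < t) : 0 < ramp t := by unfold ramp; rw [max_eq_right h.le]; positivity
lemma ramp_zero {t} (h : t ≤ 0) : ramp t = 0 := by unfold ramp; rw [max_eq_left h]; simp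

lemma PshAt.ramp {u x} (h : PshAt u x) : PshAt (fun y => ramp (u y)) x := by
  refine h.comp ramp_cd.contDiffAt ?_ ?_
  · rw [ramp_d1]; positivity
  · rw [ramp_d2]; positivity

/-- regularised max: `b + ramp (a - b) / (3 G²)` -/
def rmax (G : ℝ) (a b : ℂ × ℂ → ℝ) (x : ℂ × ℂ) : ℝ := b x + (3 * G ^ 2)⁻¹ * ramp (a x + (-1) * b x)

lemma PshAt.rmax {G : ℝ} (hG : 0 < G) {a b x} (ha : PshAt a x) (hb : PshAt b x) (hab : a x - b x ≤ G) :
    PshAt (rmax G a b) x := by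
  have c1 : ContDiffAt ℝ 2 (fun y => (-1) * b y) x := contDiffAt_const.mul hb.cd
  have c : ContDiffAt ℝ 2 (fun y => a y + (-1) * b y) x := ha.cd.add c1
  have c2 := cd_comp (h := _root_.ramp) ramp_cd.contDiffAt c
  have c3 : ContDiffAt ℝ 2 (fun y => (3 * G ^ 2)⁻¹ * _root_.ramp (a y + (-1) * b y)) x := contDiffAt_const.mul c2
  refine ⟨hb.cd.add c3, fun w => ?_⟩
  have e : leviForm (_root_.rmax G a b) x w = _ := levi_add hb.cd c3 w
  rw [e, levi_smul c2, levi_comp ramp_cd.contDiffAt c, levi_add ha.cd c1, levi_smul hb.cd, ramp_d2, ramp_d1]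
  set m := max 0 (a x + (-1) * b x)
  have m0 : 0 ≤ m := le_max_left _ _
  have mG : m ≤ G := max_le hG.le (by linarith)
  have h1 := Gd_nonneg (fun y => a y + (-1) * b y) x w
  have h2 := ha.nn w
  have h3 := hb.nn w
  set t := (3 * G ^ 2)⁻¹ * (3 * m ^ 2) with ht
  have t0 : 0 ≤ t := by positivity
  have t1 : t ≤ 1 := by
    rw [ht, inv_mul_le_iff₀ (by positivity)]
    nlinarith
  have e2 : leviForm b x w + (3 * G ^ 2)⁻¹ * (6 * m * Gd (fun y => a y + -1 * b y) x w + 3 * m ^ 2 * (leviForm a x w + -1 * leviForm b x w)) = (1 - t) * leviForm b x w + t * leviForm a x w + (3 * G ^ 2)⁻¹ * (6 * m * Gd (fun y => a y + -1 * b y) x w) := by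
    rw [ht]; ring
  rw [e2]
  have := mul_nonneg (sub_nonneg.mpr t1) h3
  positivity

end

section
open Complex
open MeasureTheory ComplexConjugate
open Filter Topology
open scoped ENNReal

lemma normI (w : ℂ × ℂ) : ‖I • w‖ = ‖w‖ := by rw [norm_smul]; simp

lemma norm_sq_le (w : ℂ × ℂ) : ‖w.1‖ ^ 2 + ‖w.2‖ ^ 2 ≤ 2 * ‖w‖ ^ 2 := by
  have h1 := norm_fst_le w
  have h2 := norm_snd_le w
  nlinarith [norm_nonneg w.1, norm_nonneg w.2]

lemma norm_sq_ge (w : ℂ × ℂ) : ‖w‖ ^ 2 ≤ ‖w.1‖ ^ 2 + ‖w.2‖ ^ 2 := by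
  rw [Prod.norm_def]
  rcases max_cases ‖w.1‖ ‖w.2‖ with h | h <;> rw [h.1] <;> nlinarith [norm_nonneg w.1, norm_nonneg w.2]

lemma levi_bound {u : ℂ × ℂ → ℝ} {x} (hu : ContDiffAt ℝ 2 u x) (w) :
    |leviForm u x w| ≤ ‖fderiv ℝ (fderiv ℝ u) x‖ * ‖w‖ ^ 2 := by
  rw [levi_eq hu]
  have h : ∀ v, |Hs u x v v| ≤ ‖fderiv ℝ (fderiv ℝ u) x‖ * ‖v‖ ^ 2 := by
    intro v
    have := (fderiv ℝ (fderiv ℝ u) x).le_opNorm₂ v v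
    rw [Real.norm_eq_abs] at this
    unfold Hs
    nlinarith
  have h1 := h w
  have h2 := h (I • w)
  rw [normI] at h2
  rw [abs_le] at *
  have : 0 ≤ ‖fderiv ℝ (fderiv ℝ u) x‖ * ‖w‖ ^ 2 := by positivity
  constructor <;> linarith

lemma levi_hom {u : ℂ × ℂ → ℝ} {x} (hu : ContDiffAt ℝ 2 u x) (t : ℝ) (w) :
    leviForm u x (t • w) = t ^ 2 * leviForm u x w := by
  rw [levi_eq hu, levi_eq hu, smul_comm]
  unfold Hs
  simp only [map_smul, smul_apply, smul_eq_mul]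
  ring

lemma levi_lower {ρ : ℂ × ℂ → ℝ} {U L : Set (ℂ × ℂ)} (hU : IsOpen U) (cd : ContDiffOn ℝ 2 ρ U) (hL : IsCompact L)
    (hLU : L ⊆ U) (pos : ∀ z ∈ U, ∀ w : ℂ × ℂ, w ≠ 0 → 0 < leviForm ρ z w) :
    ∃ c > 0, ∀ x ∈ L, ∀ w, c * (‖w.1‖ ^ 2 + ‖w.2‖ ^ 2) ≤ leviForm ρ x w := by
  have cda : ∀ x ∈ U, ContDiffAt ℝ 2 ρ x := fun x hx => cd.contDiffAt (hU.mem_nhds hx)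
  have c1 : ContinuousOn (fderiv ℝ (fderiv ℝ ρ)) U := by
    have h1 : ContDiffOn ℝ 1 (fderiv ℝ ρ) U := cd.fderiv_of_isOpen hU (by norm_num)
    exact h1.continuousOn_fderiv_of_isOpen hU (by norm_num)
  have c2 : ContinuousOn (fun z : (ℂ × ℂ) × (ℂ × ℂ) => (fderiv ℝ (fderiv ℝ ρ) z.1 z.2 z.2 + fderiv ℝ (fderiv ℝ ρ) z.1 (I • z.2) (I • z.2)) / 4) (U ×ˢ Set.univ) := by
    have c3 : ContinuousOn (fun z : (ℂ × ℂ) × (ℂ × ℂ) => fderiv ℝ (fderiv ℝ ρ) z.1) (U ×ˢ Set.univ) :=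
      c1.comp continuousOn_fst (fun z hz => hz.1)
    have c4 : ContinuousOn (fun z : (ℂ × ℂ) × (ℂ × ℂ) => I • z.2) (U ×ˢ Set.univ) := by fun_prop
    exact (((c3.clm_apply continuousOn_snd).clm_apply continuousOn_snd).add ((c3.clm_apply c4).clm_apply c4)).div_const 4
  have cpt : IsCompact (L ×ˢ Metric.sphere (0 : ℂ × ℂ) 1) := hL.prod (isCompact_sphere _ _)
  have main : ∃ c > 0, ∀ x ∈ L, ∀ w ∈ Metric.sphere (0 : ℂ × ℂ) 1, c ≤ leviForm ρ x w := by
    rcases (L ×ˢ Metric.sphere (0 : ℂ × ℂ) 1).eq_empty_or_nonempty with h | h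
    · refine ⟨1, one_pos, fun x hx w hw => ?_⟩
      have : (x, w) ∈ L ×ˢ Metric.sphere (0 : ℂ × ℂ) 1 := ⟨hx, hw⟩
      rw [h] at this; exact this.elim
    · obtain ⟨z, hz, hm⟩ := cpt.exists_isMinOn h (c2.mono (Set.prod_mono hLU (Set.subset_univ _)))
      refine ⟨leviForm ρ z.1 z.2, pos _ (hLU hz.1) _ ?_, fun x hx w hw => ?_⟩
      · intro h0
        have := hz.2
        rw [h0] at this; simp at this
      · rw [levi_eq (cda _ (hLU hz.1)), levi_eq (cda _ (hLU hx))]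
        exact hm (show (x, w) ∈ _ from ⟨hx, hw⟩)
  obtain ⟨c, c0, hc⟩ := main
  refine ⟨c / 2, by positivity, fun x hx w => ?_⟩
  by_cases h0 : w = 0
  · subst h0
    have : leviForm ρ x 0 = 0 := by rw [levi_eq (cda _ (hLU hx))]; simp [Hs]
    rw [this]; simp
  have hn : 0 < ‖w‖ := norm_pos_iff.mpr h0
  have e : w = ‖w‖ • (‖w‖⁻¹ • w) := by rw [smul_smul, mul_inv_cancel₀ hn.ne', one_smul]
  have h1 := hc x hx (‖w‖⁻¹ • w) (by simp [norm_smul, hn.ne'])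
  have h2 : leviForm ρ x w = ‖w‖ ^ 2 * leviForm ρ x (‖w‖⁻¹ • w) := by
    conv_lhs => rw [e]
    exact levi_hom (cda _ (hLU hx)) _ _
  rw [h2]
  have := norm_sq_le w
  have h3 : ‖w‖ ^ 2 * c ≤ ‖w‖ ^ 2 * leviForm ρ x (‖w‖⁻¹ • w) := by gcongr
  nlinarith

/-- the standing data of a bounded strongly pseudoconvex domain -/
structure Spc (Ω U : Set (ℂ × ℂ)) (ρ : ℂ × ℂ → ℝ) : Prop where
  op : IsOpen Ω
  bd : Bornology.IsBounded Ω
  opU : IsOpen U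
  sub : closure Ω ⊆ U
  cd : ContDiffOn ℝ 2 ρ U
  eq : Ω = {z ∈ U | ρ z < 0}
  fr : frontier Ω = {z ∈ U | ρ z = 0}
  lev : ∀ z ∈ U, ∀ w : ℂ × ℂ, w ≠ 0 → 0 < leviForm ρ z w

variable {Ω U : Set (ℂ × ℂ)} {ρ : ℂ × ℂ → ℝ}

lemma Spc.cpt (h : Spc Ω U ρ) : IsCompact (closure Ω) := h.bd.isCompact_closure

lemma Spc.neg (h : Spc Ω U ρ) {x} (hx : x ∈ closure Ω) : ρ x ≤ 0 := by
  rw [closure_eq_self_union_frontier, h.fr] at hx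
  rcases hx with hx | hx
  · rw [h.eq] at hx; exact hx.2.le
  · exact hx.2.le

lemma Spc.pos (h : Spc Ω U ρ) {x} (hU : x ∈ U) (hx : x ∉ closure Ω) : 0 < ρ x := by
  by_contra hc
  rcases lt_or_eq_of_le (not_lt.mp hc) with h1 | h1
  · exact hx (subset_closure (by rw [h.eq]; exact ⟨hU, h1⟩))
  · exact hx (frontier_subset_closure (by rw [h.fr]; exact ⟨hU, h1⟩))

lemma Spc.cda (h : Spc Ω U ρ) {x} (hx : x ∈ U) : ContDiffAt ℝ 2 ρ x := h.cd.contDiffAt (h.opU.mem_nhds hx)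

lemma Gd_le (u x w) : Gd u x w ≤ ‖fderiv ℝ u x‖ ^ 2 * ‖w‖ ^ 2 / 2 := by
  have h : ∀ v, (fderiv ℝ u x v) ^ 2 ≤ (‖fderiv ℝ u x‖ * ‖v‖) ^ 2 := by
    intro v
    rw [← sq_abs]
    have := (fderiv ℝ u x).le_opNorm v
    rw [Real.norm_eq_abs] at this
    gcongr
  have h1 := h w
  have h2 := h (I • w)
  rw [normI] at h2
  unfold Gd
  nlinarith

lemma inv_d {A ε t : ℝ} (ht : t < ε) : HasDerivAt (fun t => A / (ε - t)) (A / (ε - t) ^ 2) t := by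
  have h1 : HasDerivAt (fun t => ε - t) (-1) t := by simpa using (hasDerivAt_id t).const_sub ε
  have h2 := (hasDerivAt_const t A).div h1 (sub_pos.mpr ht).ne'
  exact h2.congr_deriv (by ring)

lemma inv_d2 {A ε t : ℝ} (ht : t < ε) : deriv (deriv fun t => A / (ε - t)) t = 2 * A / (ε - t) ^ 3 := by
  have e : (deriv fun t => A / (ε - t)) =ᶠ[𝓝 t] fun t => A / (ε - t) ^ 2 := by
    filter_upwards [eventually_lt_nhds ht] with s hs
    exact (inv_d hs).deriv
  rw [e.deriv_eq]
  have h1 : HasDerivAt (fun t => ε - t) (-1) t := by simpa using (hasDerivAt_id t).const_sub ε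
  have p : 0 < ε - t := sub_pos.mpr ht
  have h2 := (hasDerivAt_const t A).div (h1.pow 2) (pow_pos p 2).ne'
  refine Eq.trans h2.deriv ?_
  simp only [Pi.pow_apply]
  field_simp
  ring

lemma Spc.domain (h : Spc Ω U ρ) {W : Set (ℂ × ℂ)} (hW : IsOpen W) (hΩW : closure Ω ⊆ W) :
    ∃ (D : Set (ℂ × ℂ)) (A ε : ℝ), 0 < A ∧ 0 < ε ∧ IsOpen D ∧ D ⊆ W ∧ D ⊆ U ∧ Bornology.IsBounded D ∧ closure Ω ⊆ D ∧
      (∀ x ∈ D, 0 < ε - ρ x) ∧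
      (∀ t > 0, IsCompact {x | x ∈ D ∧ t ≤ ε - ρ x}) ∧
      ∀ u : ℂ × ℂ → ℝ, (∀ x ∈ D, PshAt u x) → Dat D (fun x => ε - ρ x) (fun x => A / (ε - ρ x) + u x) := by
  obtain ⟨L, hL, hΩL, hLW⟩ := exists_compact_between h.cpt (hW.inter h.opU) (Set.subset_inter hΩW h.sub)
  have hLU : L ⊆ U := fun x hx => (hLW hx).2
  have cρ : ContinuousOn ρ L := h.cd.continuousOn.mono hLU
  obtain ⟨ε, ε0, hε⟩ : ∃ ε > 0, ∀ x ∈ L, x ∉ interior L → ε < ρ x := by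
    rcases (L \ interior L).eq_empty_or_nonempty with he | he
    · refine ⟨1, one_pos, fun x hx hx' => ?_⟩
      have : x ∈ L \ interior L := ⟨hx, hx'⟩
      rw [he] at this; exact this.elim
    · obtain ⟨z, hz, hm⟩ := (hL.diff isOpen_interior).exists_isMinOn he (cρ.mono Set.diff_subset)
      have zp : 0 < ρ z := h.pos (hLU hz.1) (fun hc => hz.2 (hΩL hc))
      refine ⟨ρ z / 2, by positivity, fun x hx hx' => ?_⟩
      have : ρ z ≤ ρ x := hm ⟨hx, hx'⟩
      linarith
  obtain ⟨c, c0, hc⟩ := levi_lower h.opU h.cd hL hLU h.lev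
  obtain ⟨M, hM⟩ : ∃ M, ∀ x ∈ L, ‖fderiv ℝ ρ x‖ ≤ M :=
    hL.exists_bound_of_continuousOn ((h.cd.continuousOn_fderiv_of_isOpen h.opU (by norm_num)).mono hLU)
  set D := interior L ∩ {x | ρ x < ε} with hD
  have DL : D ⊆ L := fun x hx => interior_subset hx.1
  have DU : D ⊆ U := DL.trans hLU
  have Dop : IsOpen D := by
    exact (cρ.mono interior_subset).isOpen_inter_preimage isOpen_interior isOpen_Iio
  have cpt : ∀ t > 0, IsCompact {x | x ∈ D ∧ t ≤ ε - ρ x} := by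
    intro t ht
    have e : {x | x ∈ D ∧ t ≤ ε - ρ x} = L ∩ ρ ⁻¹' (Set.Iic (ε - t)) := by
      ext x
      constructor
      · rintro ⟨h1, h2⟩; exact ⟨DL h1, by simp; linarith⟩
      · rintro ⟨h1, h2⟩
        simp at h2
        refine ⟨⟨?_, ?_⟩, by linarith⟩
        · by_contra h3
          have := hε x h1 h3
          linarith
        · simp; linarith
    rw [e]
    exact hL.of_isClosed_subset (cρ.preimage_isClosed_of_isClosed hL.isClosed isClosed_Iic) Set.inter_subset_left
  set A := (12 * M ^ 2 + 1) / c with hA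
  have A0 : 0 < A := by positivity
  refine ⟨D, A, ε, A0, ε0, Dop, fun x hx => (hLW (DL hx)).1, DU, hL.isBounded.subset DL, fun x hx => ⟨hΩL hx, ?_⟩, fun x hx => sub_pos.mpr hx.2, cpt, fun u hu => ?_⟩
  · exact lt_of_le_of_lt (h.neg hx) ε0
  have cr : ∀ x ∈ D, ContDiffAt ℝ 2 (fun x => ε - ρ x) x := fun x hx => contDiffAt_const.sub (h.cda (DU hx))
  have rp : ∀ x ∈ D, 0 < ε - ρ x := fun x hx => sub_pos.mpr hx.2
  have cinv : ∀ x ∈ D, ContDiffAt ℝ 2 (fun t => A / (ε - t)) (ρ x) := fun x hx =>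
    contDiffAt_const.div (contDiffAt_const.sub contDiffAt_id) (rp x hx).ne'
  have gd : ∀ x ∈ D, ∀ p q, ‖dz (1,0) (fun y => ((ε - ρ y : ℝ) : ℂ)) x * p
    + dz (0,1) (fun y => ((ε - ρ y : ℝ) : ℂ)) x * q‖ ^ 2 = Gd ρ x (p, q) := by
    intro x hx p q
    rw [Gd_eq ((cr x hx).differentiableAt (by norm_num))]
    have : fderiv ℝ (fun y => ε - ρ y) x = - fderiv ℝ ρ x := by
      rw [fderiv_const_sub]
    unfold Gd
    rw [this]
    simp
  have gb : ∀ x ∈ D, ∀ w, Gd ρ x w ≤ M ^ 2 * (‖w.1‖ ^ 2 + ‖w.2‖ ^ 2) := by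
    intro x hx w
    have h1 := Gd_le ρ x w
    have h2 := norm_sq_ge w
    have h3 := hM x (DL hx)
    have h4 : ‖fderiv ℝ ρ x‖ ^ 2 * ‖w‖ ^ 2 ≤ M ^ 2 * (‖w.1‖ ^ 2 + ‖w.2‖ ^ 2) := by gcongr
    have : 0 ≤ ‖fderiv ℝ ρ x‖ ^ 2 * ‖w‖ ^ 2 := by positivity
    linarith
  refine ⟨Dop, fun x hx => (cr x hx).contDiffWithinAt, fun x hx => ?_, rp, cpt, ⟨2 * M ^ 2, fun x hx => ?_⟩, fun x hx p q => ?_⟩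
  · exact ((cd_comp (cinv x hx) (h.cda (DU hx))).add (hu x hx).cd).contDiffWithinAt
  · have h1 := gd x hx 1 0
    have h2 := gd x hx 0 1
    have h3 := gb x hx (1, 0)
    have h4 := gb x hx (0, 1)
    simp at h1 h2 h3 h4
    simp only [ofReal_sub]
    rw [h1, h2]; linarith
  · have e := levi_add (cd_comp (cinv x hx) (h.cda (DU hx))) (hu x hx).cd (p, q)
    rw [e, levi_comp (cinv x hx) (h.cda (DU hx)), inv_d2 hx.2, (inv_d hx.2).deriv, gd x hx]
    have r0 := rp x hx
    have h1 := gb x hx (p, q)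
    have h2 := hc x (DL hx) (p, q)
    have h3 := (hu x hx).nn (p, q)
    have h4 : 0 ≤ 2 * A / (ε - ρ x) ^ 3 * Gd ρ x (p, q) := mul_nonneg (by positivity) (Gd_nonneg _ _ _)
    have h5 : 12 * (Gd ρ x (p, q) / (ε - ρ x) ^ 2) + (‖p‖ ^ 2 + ‖q‖ ^ 2) / (ε - ρ x) ^ 2 ≤ A / (ε - ρ x) ^ 2 * leviForm ρ x (p, q) := by
      have : 12 * Gd ρ x (p, q) + (‖p‖ ^ 2 + ‖q‖ ^ 2) ≤ A * leviForm ρ x (p, q) := by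
        have h6 : A * (c * (‖p‖ ^ 2 + ‖q‖ ^ 2)) ≤ A * leviForm ρ x (p, q) := by gcongr
        have h7 : A * (c * (‖p‖ ^ 2 + ‖q‖ ^ 2)) = (12 * M ^ 2 + 1) * (‖p‖ ^ 2 + ‖q‖ ^ 2) := by
          rw [hA]; field_simp
        simp only at h1
        linarith
      calc _ = (12 * Gd ρ x (p, q) + (‖p‖ ^ 2 + ‖q‖ ^ 2)) / (ε - ρ x) ^ 2 := by ring
        _ ≤ A * leviForm ρ x (p, q) / (ε - ρ x) ^ 2 := by gcongr
        _ = _ := by ring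
    linarith

end

section
open Complex
open MeasureTheory ComplexConjugate
open Filter Topology
open scoped ENNReal

lemma hol_of_db {f : ℂ × ℂ → ℂ} {x} (hf : DifferentiableAt ℝ f x) (h1 : db (1,0) f x = 0) (h2 : db (0,1) f x = 0) :
    DifferentiableAt ℂ f x := by
  have k : ∀ a b : ℂ, (1/2) * (a + I * b) = 0 → b = I * a := by
    intro a b h
    have h3 : a + I * b = 0 := by simpa using h
    have : I * (a + I * b) = 0 := by rw [h3, mul_zero]
    rw [mul_add, ← mul_assoc, I_mul_I] at this
    linear_combination -this
  have h1' := k _ _ h1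
  have h2' := k _ _ h2
  rw [differentiableAt_iff_restrictScalars ℝ hf]
  refine ⟨(ContinuousLinearMap.fst ℂ ℂ ℂ).smulRight (fderiv ℝ f x (1,0)) + (ContinuousLinearMap.snd ℂ ℂ ℂ).smulRight (fderiv ℝ f x (0,1)), ?_⟩
  apply ContinuousLinearMap.ext
  rintro ⟨p, q⟩
  have hw : ((p, q) : ℂ × ℂ) = p.re • (1,0) + p.im • (I • (1,0)) + q.re • (0,1) + q.im • (I • (0,1)) := by
    ext <;> simp
  conv_rhs => rw [hw]
  simp only [map_add, map_smul, h1', h2']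
  simp
  conv_lhs => rw [← Complex.re_add_im p, ← Complex.re_add_im q]
  ring

lemma cs_norm {f g : ℂ × ℂ → ℂ} (hf : MemLp f 2) (hg : MemLp g 2) :
    ∫ x, ‖f x‖ * ‖g x‖ ≤ √(∫ x, ‖f x‖ ^ 2) * √(∫ x, ‖g x‖ ^ 2) := by
  have := integral_mul_norm_le_Lp_mul_Lq (μ := (volume : Measure (ℂ × ℂ))) (p := 2) (q := 2) (f := f) (g := g) Real.HolderConjugate.two_two (by simpa using hf) (by simpa using hg)
  simpa [Real.sqrt_eq_rpow] using this

lemma approx {D r φ χ} (hd : Dat D r φ) (hχ : Tst D χ) {O : Set (ℂ × ℂ)} {ε0 : ℝ} (hε0 : 0 < ε0) (n : ℕ)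
    (hK : ∀ x ∈ O, Metric.closedBall x (1 / ((n : ℝ) + 1)) ⊆ {x | x ∈ D ∧ ε0 ≤ r x}) :
    ∃ F : ℂ × ℂ → ℂ, (∀ x ∈ O, DifferentiableAt ℂ F x) ∧ ∀ x ∈ O, ∀ B ≥ 0,
      (∀ y ∈ Metric.closedBall x (1 / ((n : ℝ) + 1)), r y / om r φ y ≤ B) →
      ‖F x - mo (fun y => (kap n y : ℂ)) χ x‖ ≤ B * (√(3 * ∫ x, om r φ x ^ 2 * (‖db (1,0) χ x‖ ^ 2 + ‖db (0,1) χ x‖ ^ 2)) *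
        √(∫ x, ‖(kap n x : ℂ)‖ ^ 2)) := by
  obtain ⟨v, hv, hvn, hvt⟩ := l2core hd hχ
  set q : ℂ × ℂ → ℂ := fun x => ((r x / om r φ x : ℝ) : ℂ) with hq
  have cq : ContinuousOn q D := (contOfReal (hd.cr.div hd.contW (fun x hx => (hd.ompos hx).ne'))).continuousOn
  set K : Set (ℂ × ℂ) := {x | x ∈ D ∧ ε0 ≤ r x} with hKdef
  have KD : K ⊆ D := fun x hx => hx.1
  have Kc : IsCompact K := hd.cpt ε0 hε0
  have vi : IntegrableOn v K := (hv.locallyIntegrable (by norm_num)).integrableOn_isCompact Kc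
  have qvi : IntegrableOn (fun x => q x * v x) K := vi.continuousOn_mul (cq.mono KD) Kc
  set w : ℂ × ℂ → ℂ := K.indicator (fun x => q x * v x) with hw
  have wi : Integrable w := qvi.integrable_indicator Kc.measurableSet
  have χi : Integrable χ := hχ.cd.continuous.integrable_of_hasCompactSupport hχ.cs
  set κ : ℂ × ℂ → ℂ := fun y => (kap n y : ℂ) with hκ
  have κcd := (kapC n).1
  have κcs := (kapC n).2
  have κz : ∀ x ∈ O, ∀ t, t ∉ K → κ (x - t) = 0 := by
    intro x hx t ht
    rw [hκ]
    simp only [ofReal_eq_zero]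
    apply kap_zero
    by_contra hc
    exact ht (hK x hx (by rw [Metric.mem_closedBall, dist_comm, dist_eq_norm]; exact (not_le.mp hc).le))
  have κts : ∀ x ∈ O, tsupport (fun y => κ (x - y)) ⊆ K := by
    intro x hx
    exact closure_minimal (fun t ht => by by_contra h; exact ht (κz x hx t h)) Kc.isClosed
  have κT : ∀ x ∈ O, Tst D (fun y => κ (x - y)) := fun x hx =>
    ⟨κcd.comp (contDiff_const.sub contDiff_id), hcs_refl κcs x, (κts x hx).trans KD⟩
  have fi : Integrable (fun x => χ x - w x) := ii_sub χi wi
  have ind : ∀ (g : ℂ × ℂ → ℂ), (∀ t, t ∉ K → g t = 0) → ∀ t, w t * g t = q t * v t * g t := by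
    intro g hg t
    by_cases ht : t ∈ K
    · rw [hw, Set.indicator_of_mem ht]
    · rw [hg t ht]; simp
  have db0 : ∀ x ∈ O, ∀ e, (∫ t, χ t * db e (fun y => κ (x - y)) t = ∫ t, q t * v t * db e (fun y => κ (x - y)) t) → db e (mo κ (fun x => χ x - w x)) x = 0 := by
    intro x hx e he
    rw [db_mo κcd κcs fi.locallyIntegrable]
    have g0 : ∀ t, t ∉ K → db e (fun y => κ (x - y)) t = 0 := fun t ht =>
      db_eq_zero_of_notMem (fun h => ht (κts x hx h))
    have e1 := ind _ g0
    have c1 : Continuous (db e (fun y => κ (x - y))) := continuous_db (κT x hx).cd1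
    have c2 := hcs_db (e := e) (κT x hx).cs
    obtain ⟨C, hC⟩ := c1.bounded_above_of_compact_support c2
    have i1 : Integrable (fun t => χ t * db e (fun y => κ (x - y)) t) :=
      χi.mul_bdd (c := C) c1.aestronglyMeasurable (Eventually.of_forall hC)
    have i2 : Integrable (fun t => w t * db e (fun y => κ (x - y)) t) :=
      wi.mul_bdd (c := C) c1.aestronglyMeasurable (Eventually.of_forall hC)
    simp only [sub_mul]
    rw [integral_sub i1 i2, he]
    simp only [e1, sub_self, neg_zero]
  refine ⟨mo κ (fun x => χ x - w x), fun x hx => ?_, fun x hx B hB hb => ?_⟩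
  · refine hol_of_db ((mo_contDiff κcd κcs fi.locallyIntegrable).differentiable (by norm_num) x) ?_ ?_
    · exact db0 x hx _ (hvt _ (κT x hx)).1
    · exact db0 x hx _ (hvt _ (κT x hx)).2
  · have e1 : mo κ (fun x => χ x - w x) x - mo κ χ x = - ∫ t, w t * κ (x - t) := by
      unfold mo
      simp only [sub_mul]
      rw [integral_sub (integrable_mo κcd.continuous κcs χi.locallyIntegrable x) (integrable_mo κcd.continuous κcs wi.locallyIntegrable x)]
      ring
    have m2 : MemLp (fun t => κ (x - t)) 2 := (κT x hx).cd.continuous.memLp_of_hasCompactSupport (κT x hx).cs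
    have e2 : ∫ t, ‖κ (x - t)‖ ^ 2 = ∫ t, ‖κ t‖ ^ 2 := integral_sub_left_eq_self (fun t => ‖κ t‖ ^ 2) volume x
    have e3 : ∫ t, ‖w t * κ (x - t)‖ ≤ ∫ t, B * (‖v t‖ * ‖κ (x - t)‖) := by
      refine integral_mono (integrable_mo κcd.continuous κcs wi.locallyIntegrable x).norm ((MemLp.integrable_mul hv.norm m2.norm).const_mul B) fun t => ?_
      simp only
      by_cases ht : t ∈ Metric.closedBall x (1 / ((n : ℝ) + 1))
      · rw [ind _ (κz x hx), norm_mul, norm_mul, mul_assoc]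
        gcongr
        have tK := hK x hx ht
        rw [hq]
        simp only [Complex.norm_real, Real.norm_eq_abs]
        rw [abs_of_nonneg (div_nonneg (hd.rpos t tK.1).le (hd.ompos tK.1).le)]
        exact hb t ht
      · have : κ (x - t) = 0 := by
          rw [hκ]; simp only [ofReal_eq_zero]
          apply kap_zero
          rw [Metric.mem_closedBall, dist_comm, dist_eq_norm] at ht
          exact (not_le.mp ht).le
        rw [this]; simp
    rw [e1, norm_neg]
    calc _ ≤ ∫ t, ‖w t * κ (x - t)‖ := norm_integral_le_integral_norm _
      _ ≤ _ := e3
      _ = B * ∫ t, ‖v t‖ * ‖κ (x - t)‖ := integral_const_mul _ _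
      _ ≤ B * (√(∫ t, ‖v t‖ ^ 2) * √(∫ t, ‖κ (x - t)‖ ^ 2)) := by gcongr; exact cs_norm hv m2
      _ ≤ _ := by rw [e2]; gcongr

end

section
open Complex
open MeasureTheory ComplexConjugate
open Filter Topology
open scoped ENNReal

lemma hull_core {D : Set (ℂ × ℂ)} {r u : ℂ × ℂ → ℝ} {χ : ℂ × ℂ → ℂ} {A ε g : ℝ} (hA : 0 < A) (hε : 0 < ε) (hg : 0 < g)
    (dat : ∀ N : ℝ, 0 ≤ N → Dat D r (fun x => A / r x + N * u x)) (hχ : Tst D χ)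
    (hann : ∀ x, (db (1,0) χ x ≠ 0 ∨ db (0,1) χ x ≠ 0) → g / 2 ≤ u x) {O : Set (ℂ × ℂ)} {n : ℕ}
    (hK : ∀ x ∈ O, Metric.closedBall x (1 / ((n : ℝ) + 1)) ⊆ {x | x ∈ D ∧ ε / 2 ≤ r x})
    {T : Set (ℂ × ℂ)} (hTO : T ⊆ O) (hT : ∀ x ∈ T, ∀ y ∈ Metric.closedBall x (1 / ((n : ℝ) + 1)), u y ≤ g / 4) :
    ∃ F : ℂ × ℂ → ℂ, (∀ x ∈ O, DifferentiableAt ℂ F x) ∧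
      ∀ x ∈ T, ‖F x - mo (fun y => (kap n y : ℂ)) χ x‖ < 1 / 2 := by
  have d0 := dat 0 le_rfl
  -- upper bound for r on K
  obtain ⟨R, hR⟩ : ∃ R, ∀ x ∈ {x | x ∈ D ∧ ε / 2 ≤ r x}, ‖r x‖ ≤ R :=
    (d0.cpt (ε / 2) (by positivity)).exists_bound_of_continuousOn (d0.cr.continuousOn.mono fun x hx => hx.1)
  -- lower bound for r on the support
  obtain ⟨t0, t0pos, ht0⟩ : ∃ t0 > 0, ∀ x ∈ tsupport χ, t0 ≤ r x := by
    rcases (tsupport χ).eq_empty_or_nonempty with he | he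
    · exact ⟨1, one_pos, fun x hx => by rw [he] at hx; exact hx.elim⟩
    · obtain ⟨z, hz, hm⟩ := hχ.cs.isCompact.exists_isMinOn he (d0.cr.continuousOn.mono hχ.sub)
      exact ⟨r z, d0.rpos z (hχ.sub hz), fun x hx => hm hx⟩
  set dd : ℂ × ℂ → ℝ := fun x => ‖db (1,0) χ x‖ ^ 2 + ‖db (0,1) χ x‖ ^ 2 with hdd
  have ddi : Integrable dd := by
    have c1 := (continuous_db (e := (1,0)) hχ.cd1)
    have c2 := (continuous_db (e := (0,1)) hχ.cd1)
    have m1 : MemLp (db (1,0) χ) 2 := c1.memLp_of_hasCompactSupport (hcs_db hχ.cs)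
    have m2 : MemLp (db (0,1) χ) 2 := c2.memLp_of_hasCompactSupport (hcs_db hχ.cs)
    exact ii_add (integrable_sq m1) (integrable_sq m2)
  have dd0 : ∀ x, 0 ≤ dd x := fun x => by rw [hdd]; positivity
  set J := ∫ x, dd x with hJ
  have J0 : 0 ≤ J := integral_nonneg dd0
  set k := √(∫ x, ‖(kap n x : ℂ)‖ ^ 2) with hk
  set C := R ^ 2 * Real.exp (A / ε) * (√(3 * ((t0 ^ 2)⁻¹ * J)) * k) with hC
  have C0 : 0 ≤ C := by positivity
  set N := 8 / g * (2 * C + 1) with hN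
  have N0 : 0 ≤ N := by positivity
  have d := dat N N0
  obtain ⟨F, hF, hFb⟩ := approx d hχ (by positivity : 0 < ε / 2) n hK
  refine ⟨F, hF, fun x hx => ?_⟩
  set φ : ℂ × ℂ → ℝ := fun x => A / r x + N * u x with hφ
  have I1 : ∫ x, om r φ x ^ 2 * dd x ≤ Real.exp (-(N * g / 2)) * ((t0 ^ 2)⁻¹ * J) := by
    have e : Real.exp (-(N * g / 2)) * ((t0 ^ 2)⁻¹ * J) = ∫ x, (Real.exp (-(N * g / 2)) * (t0 ^ 2)⁻¹) * dd x := by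
      rw [integral_const_mul, ← mul_assoc]
    rw [e]
    refine integral_mono_of_nonneg (Eventually.of_forall fun x => mul_nonneg (sq_nonneg _) (dd0 x)) (ddi.const_mul _) (Eventually.of_forall fun x => ?_)
    simp only
    by_cases hc : db (1,0) χ x ≠ 0 ∨ db (0,1) χ x ≠ 0
    · have hxs : x ∈ tsupport χ := by
        by_contra h
        rcases hc with h' | h' <;> exact h' (db_eq_zero_of_notMem h)
      refine mul_le_mul_of_nonneg_right ?_ (dd0 x)
      have h1 := ht0 x hxs
      have rp : 0 < r x := lt_of_lt_of_le t0pos h1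
      have h2 : om r φ x ^ 2 = Real.exp (-φ x) * (r x ^ 2)⁻¹ := by
        rw [om_sq rp, mul_assoc, mul_inv_cancel₀ (by positivity), mul_one]
      rw [h2]
      gcongr
      have h3 := mul_le_mul_of_nonneg_left (hann x hc) N0
      have h4 : 0 ≤ A / r x := by positivity
      simp only [hφ]; linarith
    · push Not at hc
      have : dd x = 0 := by rw [hdd]; simp [hc.1, hc.2]
      rw [this]; simp
  have B1 : ∀ y ∈ Metric.closedBall x (1 / ((n : ℝ) + 1)), r y / om r φ y ≤ R ^ 2 * Real.exp (A / ε) * Real.exp (N * g / 8) := by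
    intro y hy
    obtain ⟨yD, hr⟩ := hK x (hTO hx) hy
    have rp := d.rpos y yD
    have e : r y / om r φ y = r y ^ 2 * Real.exp (φ y / 2) := by
      unfold om
      rw [neg_div, Real.exp_neg]
      field_simp
    rw [e, mul_assoc, ← Real.exp_add]
    have h1 : r y ≤ R := (le_abs_self _).trans (hR y ⟨yD, hr⟩)
    gcongr
    have h2 := mul_le_mul_of_nonneg_left (hT x hx y hy) N0
    have h3 : A / r y ≤ A / (ε / 2) := by gcongr
    have h4 : A / (ε / 2) = 2 * (A / ε) := by field_simp
    simp only [hφ]; linarith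
  have fin := hFb x (hTO hx) _ (by positivity) B1
  have s1 : √(3 * ∫ x, om r φ x ^ 2 * dd x) ≤ Real.exp (-(N * g / 4)) * √(3 * ((t0 ^ 2)⁻¹ * J)) := by
    apply Real.sqrt_le_iff.mpr ⟨by positivity, ?_⟩
    rw [mul_pow, Real.sq_sqrt (by positivity), ← Real.exp_nat_mul]
    have : ((2:ℕ):ℝ) * -(N * g / 4) = -(N * g / 2) := by push_cast; ring
    rw [this]
    linarith
  have s2 : ‖F x - mo (fun y => (kap n y : ℂ)) χ x‖ ≤ C * Real.exp (-(N * g / 8)) := by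
    refine fin.trans ?_
    calc _ ≤ R ^ 2 * Real.exp (A / ε) * Real.exp (N * g / 8) * ((Real.exp (-(N * g / 4)) * √(3 * ((t0 ^ 2)⁻¹ * J))) * k) := by
          gcongr
      _ = C * (Real.exp (N * g / 8) * Real.exp (-(N * g / 4))) := by rw [hC]; ring
      _ = _ := by rw [← Real.exp_add]; congr 2; ring
  refine lt_of_le_of_lt s2 ?_
  have e5 : N * g / 8 = 2 * C + 1 := by rw [hN]; field_simp
  rw [e5, Real.exp_neg, ← div_eq_mul_inv, div_lt_div_iff₀ (Real.exp_pos _) (by norm_num)]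
  have := Real.add_one_le_exp (2 * C + 1)
  linarith

variable {Ω U : Set (ℂ × ℂ)} {ρ : ℂ × ℂ → ℝ}

lemma exists_n {δ : ℝ} (h : 0 < δ) : ∃ n : ℕ, 1 / ((n : ℝ) + 1) < δ := exists_nat_one_div_lt h

/-- points of the `A(Ω)`-hull of `S` -/
def InHull (Ω S : Set (ℂ × ℂ)) (x : ℂ × ℂ) : Prop := ∀ f : ℂ × ℂ → ℂ,
      DifferentiableOn ℂ f Ω → ContinuousOn f (closure Ω) →
      ∀ c : ℝ, (∀ s ∈ S, ‖f s‖ ≤ c) → ‖f x‖ ≤ c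

lemma ball_of_cpt {T G : Set (ℂ × ℂ)} (hT : IsCompact T) (hG : IsOpen G) (h : T ⊆ G) :
    ∃ δ > 0, ∀ x ∈ T, ∀ η, η < δ → Metric.closedBall x η ⊆ G := by
  obtain ⟨δ, δ0, hδ⟩ := hT.exists_thickening_subset_open hG h
  refine ⟨δ, δ0, fun x hx η hη y hy => hδ ?_⟩
  rw [Metric.mem_thickening_iff]
  exact ⟨x, hx, lt_of_le_of_lt hy hη⟩

lemma Spc.hull (h : Spc Ω U ρ) {S : Set (ℂ × ℂ)} (hScl : IsClosed S) (hSb : S ⊆ closure Ω) {x1 : ℂ × ℂ}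
    (hx1 : x1 ∈ closure Ω) (hhull : InHull Ω S x1) {u0 : ℂ × ℂ → ℝ}
    (hu : ∀ x ∈ closure Ω, ∀ᶠ y in 𝓝 x, PshAt u0 y) (hS : ∀ s ∈ S, u0 s ≤ 0) : u0 x1 ≤ 0 := by
  by_contra hg
  push Not at hg
  set g := u0 x1 with hgd
  set W := {x | ∀ᶠ y in 𝓝 x, PshAt u0 y} with hW
  have Wo : IsOpen W := isOpen_setOf_eventually_nhds
  have Wp : ∀ x ∈ W, PshAt u0 x := fun x hx => hx.self_of_nhds
  obtain ⟨D, A, ε, A0, ε0, Do, DW, DU, Db, ΩD, rp, cpt, hdat⟩ := h.domain Wo hu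
  have Sc : IsCompact S := h.cpt.of_isClosed_subset hScl hSb
  have cu0 : ContinuousOn u0 D := fun x hx => (Wp x (DW hx)).cd.continuousAt.continuousWithinAt
  have cρ : ContinuousOn ρ D := h.cd.continuousOn.mono DU
  -- the radius
  have G0o : IsOpen (D ∩ u0 ⁻¹' (Set.Ioi (3 * g / 4))) := cu0.isOpen_inter_preimage Do isOpen_Ioi
  obtain ⟨r2, r2pos, hr2⟩ := Metric.nhds_basis_closedBall.mem_iff.mp (G0o.mem_nhds ⟨ΩD hx1, by simp; linarith⟩)
  set r1 := r2 / 2 with hr1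
  have r1pos : 0 < r1 := by positivity
  -- the upper bound
  obtain ⟨R0, hR0⟩ : ∃ R0, ∀ x ∈ D, ‖x - x1‖ ≤ R0 := by
    obtain ⟨R0, hR0⟩ := Db.exists_norm_le
    exact ⟨R0 + ‖x1‖, fun x hx => (norm_sub_le _ _).trans (by have := hR0 x hx; linarith)⟩
  set R := 2 * R0 ^ 2 + 1 + r1 ^ 2 with hR
  have Rpos : 0 < R := by positivity
  have lg : 0 ≤ Real.log R - Real.log (r1 ^ 2) := sub_nonneg.mpr (Real.log_le_log (by positivity) (by rw [hR]; nlinarith [sq_nonneg R0]))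
  set κ := g / (4 * (Real.log R - Real.log (r1 ^ 2) + 1)) with hκ
  have κpos : 0 < κ := by positivity
  have κb : κ * (Real.log R - Real.log (r1 ^ 2)) ≤ g / 4 := by
    rw [hκ, div_mul_eq_mul_div, div_le_div_iff₀ (by positivity) (by norm_num)]
    nlinarith
  set τ := min 1 (Real.exp (Real.log R - g / κ)) with hτ
  have τpos : 0 < τ := lt_min one_pos (Real.exp_pos _)
  set u : ℂ × ℂ → ℝ := fun x => u0 x + κ * (Real.log (sq2 x1 τ x) + (-Real.log R)) with hud
  have up : ∀ x ∈ D, PshAt u x := fun x hx => (Wp x (DW hx)).add (((psh_log τpos x).add (PshAt.const _ x)).smul κpos.le)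
  have cu : ContinuousOn u D := fun x hx => (up x hx).cd.continuousAt.continuousWithinAt
  have sqpos : ∀ x, 0 < sq2 x1 τ x := fun x => by unfold sq2; positivity
  have ule : ∀ x ∈ D, u x ≤ u0 x := by
    intro x hx
    have h1 : sq2 x1 τ x ≤ R := by
      have h2 := norm_sq_le (x - x1)
      have h3 := hR0 x hx
      have h4 : ‖x - x1‖ ^ 2 ≤ R0 ^ 2 := by gcongr
      have h5 : τ ≤ 1 := min_le_left _ _
      have h6 : sq2 x1 τ x = ‖(x - x1).1‖ ^ 2 + ‖(x - x1).2‖ ^ 2 + τ := rfl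
      rw [h6]; nlinarith [sq_nonneg r1]
    have h2 := Real.log_le_log (sqpos x) h1
    have h3 : κ * (Real.log (sq2 x1 τ x) + (-Real.log R)) ≤ 0 := mul_nonpos_of_nonneg_of_nonpos κpos.le (by linarith)
    simp only [hud]; linarith
  have ux1 : u x1 ≤ 0 := by
    have h1 : sq2 x1 τ x1 = τ := by simp [sq2]
    have h2 : Real.log τ ≤ Real.log R - g / κ := by
      rw [Real.log_le_iff_le_exp τpos]; exact min_le_right _ _
    have h3 : κ * (Real.log τ + (-Real.log R)) ≤ κ * (-(g / κ)) := by gcongr; linarith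
    have h4 : κ * (-(g / κ)) = - g := by field_simp
    simp only [hud, h1]; linarith
  have uann : ∀ x ∈ Metric.closedBall x1 r2, r1 ≤ ‖x - x1‖ → g / 2 ≤ u x := by
    intro x hx hr
    have h1 : 3 * g / 4 < u0 x := (hr2 hx).2
    have h2 : r1 ^ 2 ≤ sq2 x1 τ x := by
      have h3 := norm_sq_ge (x - x1)
      have h4 : r1 ^ 2 ≤ ‖x - x1‖ ^ 2 := by gcongr
      have h6 : sq2 x1 τ x = ‖(x - x1).1‖ ^ 2 + ‖(x - x1).2‖ ^ 2 + τ := rfl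
      linarith
    have h3 := Real.log_le_log (by positivity) h2
    have h4 : κ * (Real.log (r1 ^ 2) + (-Real.log R)) ≤ κ * (Real.log (sq2 x1 τ x) + (-Real.log R)) := by gcongr
    simp only [hud]; linarith
  -- cutoff
  set b : ContDiffBump x1 := ⟨r1, r2, r1pos, by rw [hr1]; linarith⟩ with hb
  set χ : ℂ × ℂ → ℂ := fun x => (b x : ℂ) with hχ
  have χT : Tst D χ := by
    refine ⟨contDiff_ofReal b.contDiff, HasCompactSupport.comp_left (g := Complex.ofReal) b.hasCompactSupport (by simp), ?_⟩
    have : tsupport χ ⊆ tsupport b := closure_mono (fun x hx => by simpa [hχ] using hx)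
    rw [b.tsupport_eq] at this
    exact fun x hx => (hr2 (this hx)).1
  have χz : ∀ x, x ∉ Metric.closedBall x1 r2 → χ x = 0 := by
    intro x hx
    rw [hχ]; simp only [ofReal_eq_zero]
    exact b.zero_of_le_dist (not_le.mp hx).le
  have χo : ∀ x ∈ Metric.closedBall x1 r1, χ x = 1 := by
    intro x hx
    rw [hχ]; simp only [ofReal_eq_one]
    exact b.one_of_mem_closedBall hx
  have dbz : ∀ e x, db e χ x ≠ 0 → x ∈ Metric.closedBall x1 r2 ∧ r1 ≤ ‖x - x1‖ := by
    intro e x hx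
    constructor
    · by_contra hc
      apply hx
      have : χ =ᶠ[𝓝 x] fun _ => 0 := by
        filter_upwards [Metric.isClosed_closedBall.isOpen_compl.mem_nhds hc] with y hy
        exact χz y hy
      rw [db_congr this]; simp [db]
    · by_contra hc
      apply hx
      have : χ =ᶠ[𝓝 x] fun _ => 1 := by
        filter_upwards [Metric.isOpen_ball.mem_nhds (show x ∈ Metric.ball x1 r1 by rw [mem_ball_iff_norm]; exact not_le.mp hc)] with y hy
        exact χo y (Metric.ball_subset_closedBall hy)
      rw [db_congr this]; simp [db]
  -- neighbourhoods
  obtain ⟨δ1, δ1p, hδ1⟩ := ball_of_cpt Sc (cu0.isOpen_inter_preimage Do (isOpen_Iio (a := g / 4)))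
    (fun s hs => ⟨ΩD (hSb hs), by have := hS s hs; simp; linarith⟩)
  obtain ⟨δ2, δ2p, hδ2⟩ := ball_of_cpt (isCompact_singleton (x := x1)) ((cu.isOpen_inter_preimage Do (isOpen_Iio (a := g / 4))).inter (Metric.isOpen_ball (x := x1) (ε := r1)))
    (by rintro s rfl; exact ⟨⟨ΩD hx1, by simp; linarith⟩, Metric.mem_ball_self r1pos⟩)
  obtain ⟨δ3, δ3p, hδ3⟩ := ball_of_cpt h.cpt (cρ.isOpen_inter_preimage Do (isOpen_Iio (a := ε / 2)))
    (fun s hs => ⟨ΩD hs, by have := h.neg hs; simp; linarith⟩)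
  obtain ⟨n, hn⟩ := exists_n (lt_min δ1p (lt_min δ2p δ3p))
  have n1 := hn.trans_le (min_le_left _ _)
  have n2 := hn.trans_le ((min_le_right _ _).trans (min_le_left _ _))
  have n3 := hn.trans_le ((min_le_right _ _).trans (min_le_right _ _))
  obtain ⟨F, hF, hFe⟩ := hull_core (r := fun x => ε - ρ x) (u := u) (O := closure Ω) (T := S ∪ {x1}) (n := n) A0 ε0 hg
    (fun N hN => hdat (fun x => N * u x) (fun x hx => (up x hx).smul hN)) χT
    (by rintro x (hx | hx) <;> exact uann x (dbz _ x hx).1 (dbz _ x hx).2)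
    (fun x hx y hy => by
      have := hδ3 x hx _ n3 hy
      refine ⟨this.1, ?_⟩
      have h2 : ρ y < ε / 2 := this.2
      linarith)
    (Set.union_subset hSb (Set.singleton_subset_iff.mpr hx1))
    (by
      rintro x (hx | hx) y hy
      · have := hδ1 x hx _ n1 hy
        have h2 : u0 y < g / 4 := this.2
        exact (ule y this.1).trans h2.le
      · have h2 : u y < g / 4 := (hδ2 x hx _ n2 hy).1.2
        exact h2.le)
  have mS : ∀ s ∈ S, mo (fun y => (kap n y : ℂ)) χ s = 0 := by
    intro s hs
    unfold mo
    refine integral_eq_zero_of_ae (Eventually.of_forall fun t => ?_)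
    simp only [Pi.zero_apply]
    by_cases ht : t ∈ Metric.closedBall s (1 / ((n : ℝ) + 1))
    · have h2 : u0 t < g / 4 := (hδ1 s hs _ n1 ht).2
      rw [χz t, zero_mul]
      intro hc
      have h3 : 3 * g / 4 < u0 t := (hr2 hc).2
      linarith
    · rw [Metric.mem_closedBall, dist_comm, dist_eq_norm] at ht
      rw [kap_zero (not_le.mp ht).le]; simp
  have m1 : mo (fun y => (kap n y : ℂ)) χ x1 = 1 := by
    have e : (fun t => χ t * (kap n (x1 - t) : ℂ)) = fun t => (kap n (x1 - t) : ℂ) := by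
      ext t
      by_cases ht : t ∈ Metric.closedBall x1 (1 / ((n : ℝ) + 1))
      · rw [χo t (Metric.ball_subset_closedBall (hδ2 x1 rfl _ n2 ht).2), one_mul]
      · rw [Metric.mem_closedBall, dist_comm, dist_eq_norm] at ht
        rw [kap_zero (not_le.mp ht).le]; simp
    unfold mo
    rw [e, integral_sub_left_eq_self (fun t => (kap n t : ℂ)) volume x1, integral_complex_ofReal, kap_integral]
    simp
  have fin := hhull F (fun x hx => (hF x (subset_closure hx)).differentiableWithinAt)
    (fun x hx => (hF x hx).continuousAt.continuousWithinAt) (1 / 2) (fun s hs => by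
      have := hFe s (Or.inl hs)
      rw [mS s hs, sub_zero] at this
      exact this.le)
  have h5 := hFe x1 (Or.inr rfl)
  rw [m1] at h5
  have h6 : (1:ℝ) ≤ ‖F x1‖ + ‖F x1 - 1‖ := by
    have := norm_sub_le (F x1) (F x1 - 1)
    simpa using this
  linarith

end

section
open Complex
open MeasureTheory ComplexConjugate
open Filter Topology
open scoped ENNReal

variable {Ω U : Set (ℂ × ℂ)} {ρ : ℂ × ℂ → ℝ}

/-- plurisubharmonic near the closure, nonnegative, zero on `S` -/
structure Good (Ω S : Set (ℂ × ℂ)) (u : ℂ × ℂ → ℝ) : Prop where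
  psh : ∀ x ∈ closure Ω, ∀ᶠ y in 𝓝 x, PshAt u y
  nn : ∀ x, 0 ≤ u x
  z : ∀ s ∈ S, u s = 0

lemma Good.cont {S u} (h : Good Ω S u) {x} (hx : x ∈ closure Ω) : ContinuousAt u x :=
  (h.psh x hx).self_of_nhds.cd.continuousAt

lemma Good.cover {S Q : Set (ℂ × ℂ)} (hQ : IsCompact Q) (hQΩ : Q ⊆ closure Ω)
    (h : ∀ y ∈ Q, ∃ u, Good Ω S u ∧ 0 < u y) (C : ℝ) : ∃ u, Good Ω S u ∧ ∀ y ∈ Q, C < u y := by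
  suffices hs : ∃ u, Good Ω S u ∧ ∀ y ∈ Q, |C| < u y by
    obtain ⟨u, h1, h2⟩ := hs
    exact ⟨u, h1, fun y hy => (le_abs_self C).trans_lt (h2 y hy)⟩
  refine hQ.induction_on (p := fun t => ∃ u, Good Ω S u ∧ ∀ y ∈ t, |C| < u y) ?_ ?_ ?_ ?_
  · exact ⟨fun _ => 0, ⟨fun x _ => Eventually.of_forall fun y => PshAt.const 0 y, fun _ => le_rfl, fun _ _ => rfl⟩, by simp⟩
  · rintro s t hst ⟨u, h1, h2⟩
    exact ⟨u, h1, fun y hy => h2 y (hst hy)⟩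
  · rintro s t ⟨u, h1, h2⟩ ⟨v, h3, h4⟩
    refine ⟨fun x => u x + v x, ⟨fun x hx => ?_, fun x => add_nonneg (h1.nn x) (h3.nn x), fun s hs => by simp [h1.z s hs, h3.z s hs]⟩, ?_⟩
    · filter_upwards [h1.psh x hx, h3.psh x hx] with y a b
      exact a.add b
    · rintro y (hy | hy)
      · have := h2 y hy; have := h3.nn y; linarith
      · have := h4 y hy; have := h1.nn y; linarith
  · intro y hy
    obtain ⟨u, h1, h2⟩ := h y hy
    have c := h1.cont (hQΩ hy)
    refine ⟨Q ∩ {x | u y / 2 < u x}, Filter.inter_mem self_mem_nhdsWithin (mem_nhdsWithin_of_mem_nhds (c.eventually (eventually_gt_nhds (by linarith)))),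
      fun x => (2 * (|C| + 1) / u y) * u x, ⟨fun x hx => ?_, fun x => mul_nonneg (by positivity) (h1.nn x), fun s hs => by simp [h1.z s hs]⟩, ?_⟩
    · filter_upwards [h1.psh x hx] with w hw
      exact hw.smul (by positivity)
    · rintro x ⟨_, hx⟩
      have hx' : u y / 2 < u x := hx
      have : (2 * (|C| + 1) / u y) * (u y / 2) < (2 * (|C| + 1) / u y) * u x := by gcongr
      have e : (2 * (|C| + 1) / u y) * (u y / 2) = |C| + 1 := by field_simp
      linarith

open Classical in
/-- glued regularised maximum -/
def glue (O : Set (ℂ × ℂ)) (G : ℝ) (a b : ℂ × ℂ → ℝ) (x : ℂ × ℂ) : ℝ := if x ∈ O then rmax G a b x else b x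

lemma glue_psh {O : Set (ℂ × ℂ)} (hO : IsOpen O) {G : ℝ} (hG : 0 < G) {a b : ℂ × ℂ → ℝ}
    (ha : ∀ x ∈ O, PshAt a x) (hb : ∀ x ∈ closure Ω, ∀ᶠ y in 𝓝 x, PshAt b y) (hab : ∀ x ∈ O, a x - b x ≤ G)
    (hbd : ∀ x ∈ closure Ω, x ∉ O → ∀ᶠ y in 𝓝 x, y ∈ O → a y ≤ b y) :
    ∀ x ∈ closure Ω, ∀ᶠ y in 𝓝 x, PshAt (glue O G a b) y := by
  intro x hx
  by_cases hxO : x ∈ O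
  · filter_upwards [hb x hx, hO.mem_nhds hxO] with y h1 h2
    refine (PshAt.rmax hG (ha y h2) h1 (hab y h2)).congr ?_
    filter_upwards [hO.mem_nhds h2] with t ht
    simp [glue, ht]
  · have h1 := (hbd x hx hxO).eventually_nhds
    filter_upwards [hb x hx, h1] with y h2 h3
    refine h2.congr ?_
    filter_upwards [h3] with t ht
    unfold glue
    split_ifs with h4
    · unfold rmax
      rw [ramp_zero (by have := ht h4; linarith)]; simp
    · rfl

lemma glue_ge (O G a b x) : b x ≤ glue O G a b x := by
  unfold glue
  split_ifs
  · unfold rmax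
    have := ramp_nonneg (a x + (-1) * b x)
    have : 0 ≤ (3 * G ^ 2)⁻¹ * ramp (a x + (-1) * b x) := by positivity
    linarith
  · exact le_rfl

lemma glue_pos {O G a b x} (hx : x ∈ O) (hG : 0 < G) (h : 0 ≤ b x) (hab : b x < a x) : 0 < glue O G a b x := by
  unfold glue
  rw [if_pos hx]
  unfold rmax
  have := ramp_pos (t := a x + (-1) * b x) (by linarith)
  positivity

lemma exists_bump2 (y : ℂ × ℂ) {δ : ℝ} (δ0 : 0 < δ) : ∃ b : ℂ × ℂ → ℝ, ContDiff ℝ 2 b ∧ HasCompactSupport b ∧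
      (∀ x, x ∉ Metric.closedBall y δ → b x = 0) ∧ b y = 1 := by
  obtain ⟨B, hB⟩ : ∃ B : ContDiffBump y, B.rOut = δ :=
    ⟨⟨δ / 2, δ, by positivity, by linarith⟩, rfl⟩
  refine ⟨B, B.contDiff, B.hasCompactSupport, fun x hx => B.zero_of_le_dist ?_, ?_⟩
  · rw [hB]
    by_contra hcon
    exact hx (Metric.mem_closedBall.mpr (not_le.mp hcon).le)
  · exact B.one_of_mem_closedBall (Metric.mem_closedBall_self B.rIn_pos.le)

lemma bump_bound_gen {E : Type*} [NormedAddCommGroup E] [NormedSpace ℝ E] {b : E → ℝ} (bc : ContDiff ℝ 2 b) (bcs : HasCompactSupport b) :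
    ∃ M, 0 ≤ M ∧ ∀ x, ‖fderiv ℝ (fderiv ℝ b) x‖ ≤ M := by
  have c1 : ContDiff ℝ 1 (fderiv ℝ b) := bc.fderiv_right (m := 1) (by norm_num)
  have c2 : Continuous (fderiv ℝ (fderiv ℝ b)) := c1.continuous_fderiv (by norm_num)
  have c3 : Continuous (fun x => ‖fderiv ℝ (fderiv ℝ b) x‖) := by
    have h3 := Continuous.norm (E := E →L[ℝ] E →L[ℝ] ℝ) c2
    exact h3
  obtain ⟨M, hM⟩ := (IsCompact.image (f := fun x => ‖fderiv ℝ (fderiv ℝ b) x‖) bcs c3).bddAbove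
  refine ⟨max M 0, le_max_right _ _, fun x => ?_⟩
  by_cases hx : x ∈ tsupport b
  · exact le_max_of_le_left (hM ⟨x, hx, rfl⟩)
  · have h1 : x ∉ tsupport (fderiv ℝ (fderiv ℝ b)) := fun h => hx (tsupport_fderiv_subset ℝ (tsupport_fderiv_subset ℝ h))
    rw [image_eq_zero_of_notMem_tsupport h1]
    exact le_max_of_le_right (le_of_eq (norm_zero (E := E →L[ℝ] E →L[ℝ] ℝ)))

lemma bump_bound {b : ℂ × ℂ → ℝ} (bc : ContDiff ℝ 2 b) (bcs : HasCompactSupport b) :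
    ∃ M, 0 ≤ M ∧ ∀ x, ‖fderiv ℝ (fderiv ℝ b) x‖ ≤ M :=
  bump_bound_gen bc bcs

lemma bump_psh {b : ℂ × ℂ → ℝ} (bc : ContDiff ℝ 2 b) {M c η : ℝ} (hM : ∀ x, ‖fderiv ℝ (fderiv ℝ b) x‖ ≤ M)
    (c0 : 0 < c) (η0 : 0 < η) (ηM : η * M ≤ c) {x : ℂ × ℂ} (hρ : ContDiffAt ℝ 2 ρ x)
    (hc : ∀ w : ℂ × ℂ, c * (‖w.1‖ ^ 2 + ‖w.2‖ ^ 2) ≤ leviForm ρ x w) : PshAt (fun x => ρ x + η * b x) x := by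
  have c3 : ContDiffAt ℝ 2 (fun x => η * b x) x := contDiffAt_const.mul bc.contDiffAt
  refine ⟨hρ.add c3, fun w => ?_⟩
  rw [levi_add hρ c3, levi_smul bc.contDiffAt]
  have h1 := hc w
  have h2 := (abs_le.mp (levi_bound (bc.contDiffAt (x := x)) w)).1
  have h3 : ‖fderiv ℝ (fderiv ℝ b) x‖ * ‖w‖ ^ 2 ≤ M * ‖w‖ ^ 2 :=
    mul_le_mul_of_nonneg_right (hM x) (sq_nonneg _)
  have h4 : η * (-(M * ‖w‖ ^ 2)) ≤ η * leviForm b x w :=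
    mul_le_mul_of_nonneg_left (by linarith) η0.le
  have h5 : c * ‖w‖ ^ 2 ≤ c * (‖w.1‖ ^ 2 + ‖w.2‖ ^ 2) :=
    mul_le_mul_of_nonneg_left (norm_sq_ge w) c0.le
  have h6 : (η * M) * ‖w‖ ^ 2 ≤ c * ‖w‖ ^ 2 := mul_le_mul_of_nonneg_right ηM (sq_nonneg _)
  linarith

lemma Spc.bdry (h : Spc Ω U ρ) {S : Set (ℂ × ℂ)} (hScl : IsClosed S) (hSb : S ⊆ frontier Ω) {y} (hy : y ∈ frontier Ω)
    (hyS : y ∉ S) : ∃ u, Good Ω S u ∧ 0 < u y := by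
  obtain ⟨L, hL, hΩL, hLU⟩ := exists_compact_between h.cpt h.opU h.sub
  obtain ⟨c, c0, hc⟩ := levi_lower h.opU h.cd hL hLU h.lev
  obtain ⟨δ, δ0, hδ⟩ := Metric.nhds_basis_closedBall.mem_iff.mp (hScl.isOpen_compl.mem_nhds hyS)
  obtain ⟨b, bc, bcs, bz, by1⟩ := exists_bump2 y δ0
  obtain ⟨M, M0, hM⟩ := bump_bound bc bcs
  obtain ⟨η, η0, ηM⟩ : ∃ η : ℝ, 0 < η ∧ η * M ≤ c := by
    refine ⟨c / (M + 1), by positivity, ?_⟩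
    rw [div_mul_eq_mul_div, div_le_iff₀ (by positivity)]; nlinarith
  have z0 : ∀ x ∈ frontier Ω, ρ x = 0 := fun x hx => by rw [h.fr] at hx; exact hx.2
  refine ⟨fun x => ramp (ρ x + η * b x), ⟨fun x hx => ?_, fun x => ramp_nonneg _, fun s hs => ?_⟩, ?_⟩
  · filter_upwards [isOpen_interior.mem_nhds (hΩL hx)] with t ht
    have htL := interior_subset ht
    exact (bump_psh bc hM c0 η0 ηM (h.cda (hLU htL)) (hc t htL)).ramp
  · have hb0 : b s = 0 := bz s fun hcon => hδ hcon hs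
    simp only [z0 s (hSb hs), hb0]
    exact ramp_zero (by simp)
  · simp only [z0 y hy, by1]
    exact ramp_pos (by simpa using η0)

lemma Spc.inner (h : Spc Ω U ρ) {S : Set (ℂ × ℂ)} (hne : S.Nonempty) (hScl : IsClosed S) (hSb : S ⊆ frontier Ω) {y}
    (hy : y ∈ Ω) (hyS : ¬ InHull Ω S y) : ∃ u, Good Ω S u ∧ 0 < u y := by
  unfold InHull at hyS
  push Not at hyS
  obtain ⟨f, hf, hfc, c, hc, hcy⟩ := hyS
  have c0 : 0 ≤ c := by
    obtain ⟨s, hs⟩ := hne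
    exact (norm_nonneg _).trans (hc s hs)
  obtain ⟨δ, hδ1, hδ2⟩ : ∃ δ, c ^ 2 < δ ∧ δ < ‖f y‖ ^ 2 :=
    exists_between (by gcongr)
  have δ0 : 0 < δ := (sq_nonneg c).trans_lt hδ1
  obtain ⟨B, hB⟩ := h.cpt.exists_bound_of_continuousOn hfc
  have B0 : 0 ≤ B := (norm_nonneg _).trans (hB y (subset_closure hy))
  have frc : ∀ x, x ∈ frontier Ω → x ∈ closure Ω ∧ x ∉ Ω := fun x hx => by
    rw [h.op.frontier_eq] at hx; exact hx
  have fsq : ContinuousOn (fun x => ‖f x‖ ^ 2) (closure Ω) := hfc.norm.pow 2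
  set Y := closure Ω ∩ (fun x => ‖f x‖ ^ 2) ⁻¹' (Set.Ici δ) with hY
  have Ycl : IsClosed Y := fsq.preimage_isClosed_of_isClosed isClosed_closure isClosed_Ici
  have YQ : IsCompact (frontier Ω ∩ Y) := by
    refine h.cpt.of_isClosed_subset (isClosed_frontier.inter Ycl) ?_
    intro x hx
    exact hx.2.1
  obtain ⟨l, hl, hl2⟩ := Good.cover (S := S) YQ (fun x hx => hx.2.1) (fun x hx => h.bdry hScl hSb hx.1 (fun hxS => by
    have h1 := hc x hxS
    have h2 : δ ≤ ‖f x‖ ^ 2 := hx.2.2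
    have h3 : ‖f x‖ ^ 2 ≤ c ^ 2 := by gcongr
    linarith)) (B ^ 2)
  have hG : 0 < B ^ 2 + 1 := by positivity
  have ha : ∀ x ∈ Ω, PshAt (fun x => ‖f x‖ ^ 2 + (-δ)) x := fun x hx => by
    have : HolAt f x := by
      filter_upwards [h.op.mem_nhds hx] with t ht
      exact hf.differentiableAt (h.op.mem_nhds ht)
    exact this.psh_sq.add (PshAt.const (-δ) x)
  have hab : ∀ x ∈ Ω, (‖f x‖ ^ 2 + (-δ)) - l x ≤ B ^ 2 + 1 := fun x hx => by
    have h1 := hB x (subset_closure hx)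
    have h2 : ‖f x‖ ^ 2 ≤ B ^ 2 := by gcongr
    have := hl.nn x
    linarith
  have hbd : ∀ x ∈ closure Ω, x ∉ Ω → ∀ᶠ y in 𝓝 x, y ∈ Ω → (‖f y‖ ^ 2 + (-δ)) ≤ l y := by
    intro x hx hxn
    have hfr : x ∈ frontier Ω := by rw [h.op.frontier_eq]; exact ⟨hx, hxn⟩
    have lt : ‖f x‖ ^ 2 + (-δ) < l x := by
      by_cases hd : δ ≤ ‖f x‖ ^ 2
      · have h1 := hl2 x ⟨hfr, hx, hd⟩
        have h2 : ‖f x‖ ^ 2 ≤ B ^ 2 := by gcongr; exact hB x hx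
        linarith
      · have := hl.nn x
        linarith
    have t1 : Tendsto (fun x => ‖f x‖ ^ 2 + (-δ)) (𝓝[closure Ω] x) (𝓝 (‖f x‖ ^ 2 + (-δ))) :=
      (fsq x hx).add tendsto_const_nhds
    have t2 : Tendsto l (𝓝[closure Ω] x) (𝓝 (l x)) := (hl.cont hx).tendsto.mono_left nhdsWithin_le_nhds
    have t3 := t1.eventually_lt t2 lt
    rw [eventually_nhdsWithin_iff] at t3
    filter_upwards [t3] with t ht htΩ
    exact (ht (subset_closure htΩ)).le
  refine ⟨glue Ω (B ^ 2 + 1) (fun x => ‖f x‖ ^ 2 + (-δ)) l, ⟨glue_psh h.op hG ha hl.psh hab hbd,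
    fun x => (hl.nn x).trans (glue_ge _ _ _ _ _), fun s hs => ?_⟩, ?_⟩
  · unfold glue
    rw [if_neg (frc s (hSb hs)).2, hl.z s hs]
  · rcases (hl.nn y).eq_or_lt with e | e
    · exact glue_pos hy hG (hl.nn y) (by rw [← e]; simpa using hδ2)
    · exact e.trans_le (glue_ge _ _ _ _ _)

lemma Spc.off (h : Spc Ω U ρ) {S : Set (ℂ × ℂ)} (hne : S.Nonempty) (hScl : IsClosed S) (hSb : S ⊆ frontier Ω) {y}
    (hy : y ∈ closure Ω) (hyS : ¬ InHull Ω S y) : ∃ u, Good Ω S u ∧ 0 < u y := by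
  by_cases hyΩ : y ∈ Ω
  · exact h.inner hne hScl hSb hyΩ hyS
  · refine h.bdry hScl hSb (by rw [h.op.frontier_eq]; exact ⟨hy, hyΩ⟩) fun hs => hyS ?_
    intro f _ _ c hc
    exact hc y hs

lemma polyEval_diff (P : MvPolynomial (Fin 2) ℂ) : Differentiable ℂ (polyEval P) := by
  induction P using MvPolynomial.induction_on with
  | C a =>
    have : polyEval (MvPolynomial.C a) = fun _ => a := by ext z; simp [polyEval]
    rw [this]; exact differentiable_const _
  | add p q hp hq =>
    have : polyEval (p + q) = fun z => polyEval p z + polyEval q z := by ext z; simp [polyEval]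
    rw [this]; exact hp.add hq
  | mul_X p i hp =>
    have : polyEval (p * MvPolynomial.X i) = fun z => polyEval p z * (if i = 0 then z.1 else z.2) := by
      ext z; simp [polyEval]
    rw [this]
    refine hp.mul ?_
    split_ifs
    · exact differentiable_fst
    · exact differentiable_snd

lemma Spc.lmp (h : Spc Ω U ρ) {S : Set (ℂ × ℂ)} (hne : S.Nonempty) (hScl : IsClosed S) (hSb : S ⊆ frontier Ω)
    {K : Set (ℂ × ℂ)} (hK : IsCompact K) (hKS : K ⊆ Sᶜ) {p : ℂ × ℂ → ℂ} (hp : Differentiable ℂ p) {z}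
    (hzK : z ∈ interior K) (hzΩ : z ∈ closure Ω) (hz : InHull Ω S z)
    (hlt : ∀ w ∈ frontier K, w ∈ closure Ω → InHull Ω S w → ‖p w‖ < ‖p z‖) : False := by
  have pc : Continuous (fun x => ‖p x‖ ^ 2) := hp.continuous.norm.pow 2
  have Hcl : IsClosed {x | x ∈ closure Ω ∧ InHull Ω S x} := by
    have : {x | x ∈ closure Ω ∧ InHull Ω S x} = closure Ω ∩ ⋂ (f : ℂ × ℂ → ℂ), ⋂ (_ : DifferentiableOn ℂ f Ω),
        ⋂ (_ : ContinuousOn f (closure Ω)), ⋂ (c : ℝ), ⋂ (_ : ∀ s ∈ S, ‖f s‖ ≤ c),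
          closure Ω ∩ (fun x => ‖f x‖) ⁻¹' (Set.Iic c) := by
      ext x
      simp only [Set.mem_setOf_eq, Set.mem_inter_iff, Set.mem_iInter, Set.mem_preimage, Set.mem_Iic]
      constructor
      · rintro ⟨a, b⟩
        exact ⟨a, fun f h1 h2 c h3 => ⟨a, b f h1 h2 c h3⟩⟩
      · rintro ⟨a, b⟩
        exact ⟨a, fun f h1 h2 c h3 => (b f h1 h2 c h3).2⟩
    rw [this]
    refine isClosed_closure.inter (isClosed_iInter fun f => isClosed_iInter fun _ => isClosed_iInter fun h2 =>
      isClosed_iInter fun c => isClosed_iInter fun _ => h2.norm.preimage_isClosed_of_isClosed isClosed_closure isClosed_Iic)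
  have frK : IsCompact (frontier K) := hK.of_isClosed_subset isClosed_frontier hK.isClosed.frontier_subset
  obtain ⟨δ, hδ1, hδ2⟩ : ∃ δ, δ < ‖p z‖ ^ 2 ∧ ∀ w ∈ frontier K, w ∈ closure Ω → InHull Ω S w → ‖p w‖ ^ 2 < δ := by
    have TK : IsCompact (frontier K ∩ {x | x ∈ closure Ω ∧ InHull Ω S x}) := frK.inter_right Hcl
    rcases (frontier K ∩ {x | x ∈ closure Ω ∧ InHull Ω S x}).eq_empty_or_nonempty with he | he
    · refine ⟨‖p z‖ ^ 2 - 1, by linarith, fun w h1 h2 h3 => ?_⟩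
      have : w ∈ frontier K ∩ {x | x ∈ closure Ω ∧ InHull Ω S x} := ⟨h1, h2, h3⟩
      rw [he] at this; exact this.elim
    · obtain ⟨m, hm, hm2⟩ := TK.exists_isMaxOn he pc.continuousOn
      have h1 := hlt m hm.1 hm.2.1 hm.2.2
      obtain ⟨δ, h2, h3⟩ : ∃ δ, ‖p m‖ ^ 2 < δ ∧ δ < ‖p z‖ ^ 2 := exists_between (by gcongr)
      exact ⟨δ, h3, fun w a b c => lt_of_le_of_lt (hm2 (show w ∈ frontier K ∩ {x | x ∈ closure Ω ∧ InHull Ω S x} from ⟨a, b, c⟩)) h2⟩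
  obtain ⟨B, hB⟩ := hK.exists_bound_of_continuousOn (f := fun x => ‖p x‖ ^ 2 + (-δ)) (pc.add continuous_const).continuousOn
  have hB' : ∀ x ∈ K, ‖p x‖ ^ 2 + (-δ) ≤ B := fun x hx => (le_abs_self _).trans (hB x hx)
  have Qc : IsCompact (frontier K ∩ (closure Ω ∩ {x | δ ≤ ‖p x‖ ^ 2})) :=
    frK.inter_right (isClosed_closure.inter (isClosed_le continuous_const pc))
  obtain ⟨l, hl, hl2⟩ := Good.cover (S := S) Qc (fun x hx => hx.2.1) (fun x hx => h.off hne hScl hSb hx.2.1 (fun hxS => by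
    have h1 := hδ2 x hx.1 hx.2.1 hxS
    have h2 : δ ≤ ‖p x‖ ^ 2 := hx.2.2
    linarith)) B
  have B0 : 0 ≤ B := (norm_nonneg _).trans (hB z (interior_subset hzK))
  have hG : 0 < B + 1 := by positivity
  have ha : ∀ x, PshAt (fun x => ‖p x‖ ^ 2 + (-δ)) x := fun x => by
    have : HolAt p x := Eventually.of_forall fun y => hp y
    exact this.psh_sq.add (PshAt.const (-δ) x)
  have hab : ∀ x ∈ interior K, (‖p x‖ ^ 2 + (-δ)) - l x ≤ B + 1 := fun x hx => by
    have h1 := hB' x (interior_subset hx)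
    have := hl.nn x
    linarith
  have hbd : ∀ x ∈ closure Ω, x ∉ interior K → ∀ᶠ y in 𝓝 x, y ∈ interior K → (‖p y‖ ^ 2 + (-δ)) ≤ l y := by
    intro x hx hxn
    by_cases hxK : x ∈ K
    · have hfr : x ∈ frontier K := ⟨subset_closure hxK, hxn⟩
      have lt : ‖p x‖ ^ 2 + (-δ) < l x := by
        by_cases hd : δ ≤ ‖p x‖ ^ 2
        · exact (hB' x hxK).trans_lt (hl2 x ⟨hfr, hx, hd⟩)
        · have := hl.nn x
          linarith
      have t3 := ((pc.add continuous_const).continuousAt (x := x)).tendsto.eventually_lt (hl.cont hx).tendsto lt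
      filter_upwards [t3] with t ht _
      exact ht.le
    · filter_upwards [hK.isClosed.isOpen_compl.mem_nhds hxK] with t ht ht2
      exact (ht (interior_subset ht2)).elim
  have hS' : S ⊆ closure Ω := hSb.trans frontier_subset_closure
  have lz : l z = 0 := le_antisymm (h.hull hScl hS' hzΩ hz hl.psh fun s hs => (hl.z s hs).le) (hl.nn z)
  have key := h.hull hScl hS' hzΩ hz (glue_psh isOpen_interior hG (fun x _ => ha x) hl.psh hab hbd) (fun s hs => by
    unfold glue
    rw [if_neg fun hsK => hKS (interior_subset hsK) hs, hl.z s hs])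
  have pos : 0 < glue (interior K) (B + 1) (fun x => ‖p x‖ ^ 2 + (-δ)) l z :=
    glue_pos hzK hG (hl.nn z) (by rw [lz]; simpa using hδ1)
  linarith

end

/-- if `Ω ⋐ ℂ²` is a bounded strongly pseudoconvex domain and `S ⊆ bΩ` is
nonempty and closed, then `Ŝ ∖ S` has the local maximum property, where `Ŝ` is the hull
of `S` with respect to `ℋ(Ω) = 𝒪(Ω) ∩ C⁰(closure Ω)`. -/
theorem hull_has_local_max_property (Ω : Set (ℂ × ℂ)) (hΩo : IsOpen Ω)
    (hΩc : IsConnected Ω) (hΩb : Bornology.IsBounded Ω)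
    (hΩspc : IsStronglyPseudoconvex Ω)
    (S : Set (ℂ × ℂ)) (hS : S.Nonempty) (hScl : IsClosed S) (hSb : S ⊆ frontier Ω)
    (Shat : Set (ℂ × ℂ))
    (hShat : Shat = {z ∈ closure Ω | ∀ f : ℂ × ℂ → ℂ,
      DifferentiableOn ℂ f Ω → ContinuousOn f (closure Ω) →
      ∀ c : ℝ, (∀ s ∈ S, ‖f s‖ ≤ c) → ‖f z‖ ≤ c}) :
    HasLocalMaxProperty (Shat \ S) := by
  obtain ⟨U, ρ, h1, h2, h3, h4, h5, h6, _⟩ := hΩspc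
  have h : Spc Ω U ρ := ⟨hΩo, hΩb, h1, h2, h3, h4, h5, h6⟩
  have hm : ∀ x, x ∈ Shat ↔ x ∈ closure Ω ∧ InHull Ω S x := fun x => by rw [hShat]; exact Iff.rfl
  intro x hx
  refine ⟨Sᶜ, hScl.isOpen_compl.mem_nhds hx.2, fun K hK hKS P z hz => ?_⟩
  by_cases hzf : z ∈ frontier K
  · exact ⟨z, ⟨hz.2, hzf⟩, le_rfl⟩
  have hzi : z ∈ interior K := by
    by_contra hcon
    exact hzf ⟨subset_closure hz.1, hcon⟩
  by_contra hcon
  push Not at hcon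
  have hz' := (hm z).mp hz.2.1
  refine h.lmp hS hScl hSb hK hKS (polyEval_diff P) hzi hz'.1 hz'.2 fun w hw hw1 hw2 => ?_
  exact hcon w ⟨⟨(hm w).mpr ⟨hw1, hw2⟩, hKS (hK.isClosed.frontier_subset hw)⟩, hw⟩

end
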